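/- arXiv:2010.12336 — 2 statements merged into one kernel-verified Lean document; each statement's English description precedes it below -/
import Mathlib

section
/- Let G be a finite group acting on the 2-sphere S² such that every element of G acts as a homeomorphism (the action is continuous in each group element) and the action is free, i.e. g·x ≠ x for every x ∈ S² and every g ≠ 1. Then G has order at most 2. -/
/-- The unit 2-sphere in euclidean 3-space. -/
abbrev TwoSphere : Set (EuclideanSpace ℝ (Fin 3)) :=
  Metric.sphere (0 : EuclideanSpace ℝ (Fin 3)) 1

open MeasureTheory Set

/-- 3 by 3 determinant of three columns. -/
def hdet (a b c : Fin 3 → ℝ) : ℝ :=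
  a 0 * (b 1 * c 2 - b 2 * c 1) - a 1 * (b 0 * c 2 - b 2 * c 0) + a 2 * (b 0 * c 1 - b 1 * c 0)

lemma hdet_fderiv {E : Type*} [NormedAddCommGroup E] [NormedSpace ℝ E]
    (g : E → ℝ) (a b c : Fin 3 → E → ℝ) (x v : E)
    (hg : DifferentiableAt ℝ g x) (ha : ∀ j, DifferentiableAt ℝ (a j) x)
    (hb : ∀ j, DifferentiableAt ℝ (b j) x) (hc : ∀ j, DifferentiableAt ℝ (c j) x) :
    fderiv ℝ (fun y => g y * hdet (fun j => a j y) (fun j => b j y) (fun j => c j y)) x v =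
      fderiv ℝ g x v * hdet (fun j => a j x) (fun j => b j x) (fun j => c j x) +
      g x * (hdet (fun j => fderiv ℝ (a j) x v) (fun j => b j x) (fun j => c j x) +
        hdet (fun j => a j x) (fun j => fderiv ℝ (b j) x v) (fun j => c j x) +
        hdet (fun j => a j x) (fun j => b j x) (fun j => fderiv ℝ (c j) x v)) := by
  have A := fun j => (ha j).hasFDerivAt
  have B := fun j => (hb j).hasFDerivAt
  have C := fun j => (hc j).hasFDerivAt
  have := hg.hasFDerivAt.mul ((((A 0).mul (((B 1).mul (C 2)).sub ((B 2).mul (C 1)))).sub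
    ((A 1).mul (((B 0).mul (C 2)).sub ((B 2).mul (C 0))))).add
    ((A 2).mul (((B 0).mul (C 1)).sub ((B 1).mul (C 0)))))
  have h2 := this.fderiv
  have h3 := congrArg (fun L => L v) h2
  refine Eq.trans ?_ (h3.trans ?_)
  · rfl
  · simp [hdet]
    ring

/-- basis vector -/
noncomputable def ee (i : Fin 4) : Fin 4 → ℝ := Pi.single i 1

noncomputable def pA (Q : Fin 3 → (Fin 4 → ℝ) → ℝ) (i : Fin 4) (j : Fin 3) (x : Fin 4 → ℝ) : ℝ :=
  fderiv ℝ (Q j) x (ee i)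

noncomputable def gg (Q : Fin 3 → (Fin 4 → ℝ) → ℝ) (x : Fin 4 → ℝ) : ℝ :=
  expNegInvGlue (1/16 - ((Q 0 x)^2 + (Q 1 x)^2 + (Q 2 x)^2))

noncomputable def VV (Q : Fin 3 → (Fin 4 → ℝ) → ℝ) (i : Fin 4) (x : Fin 4 → ℝ) : ℝ :=
  ![gg Q x * hdet (fun j => pA Q 1 j x) (fun j => pA Q 2 j x) (fun j => pA Q 3 j x),
    gg Q x * hdet (fun j => pA Q 2 j x) (fun j => pA Q 0 j x) (fun j => pA Q 3 j x),
    gg Q x * hdet (fun j => pA Q 0 j x) (fun j => pA Q 1 j x) (fun j => pA Q 3 j x),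
    gg Q x * hdet (fun j => pA Q 0 j x) (fun j => pA Q 2 j x) (fun j => pA Q 1 j x)] i

lemma pA_contDiff (Q : Fin 3 → (Fin 4 → ℝ) → ℝ) (hQ : ∀ j, ContDiff ℝ 2 (Q j)) (i j) :
    ContDiff ℝ 1 (pA Q i j) := by
  unfold pA
  exact ((hQ j).fderiv_right (m := 1) (by norm_num)).clm_apply contDiff_const

lemma gg_contDiff (Q : Fin 3 → (Fin 4 → ℝ) → ℝ) (hQ : ∀ j, ContDiff ℝ 2 (Q j)) :
    ContDiff ℝ 1 (gg Q) := by
  unfold gg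
  have h : ∀ j, ContDiff ℝ 1 (Q j) := fun j => (hQ j).of_le (by norm_num)
  have h0 := h 0
  have h1 := h 1
  have h2 := h 2
  exact expNegInvGlue.contDiff.comp (by fun_prop)

lemma VV_contDiff (Q : Fin 3 → (Fin 4 → ℝ) → ℝ) (hQ : ∀ j, ContDiff ℝ 2 (Q j)) (i) :
    ContDiff ℝ 1 (VV Q i) := by
  have := gg_contDiff Q hQ
  have h2 := fun i j => pA_contDiff Q hQ i j
  unfold VV
  fin_cases i <;> simp [hdet] <;> fun_prop

lemma pA_symm (Q : Fin 3 → (Fin 4 → ℝ) → ℝ) (hQ : ∀ j, ContDiff ℝ 2 (Q j)) (i k j x) :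
    fderiv ℝ (pA Q i j) x (ee k) = fderiv ℝ (pA Q k j) x (ee i) := by
  have hs : IsSymmSndFDerivAt ℝ (Q j) x :=
    (hQ j).contDiffAt.isSymmSndFDerivAt (by simp)
  have hd : DifferentiableAt ℝ (fderiv ℝ (Q j)) x :=
    ((hQ j).fderiv_right (m := 1) (by norm_num)).differentiable (by norm_num) x
  have key : ∀ i k, fderiv ℝ (pA Q i j) x (ee k) = fderiv ℝ (fderiv ℝ (Q j)) x (ee k) (ee i) := by
    intro i k
    unfold pA
    rw [fderiv_clm_apply hd (by fun_prop)]
    simp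
  rw [key, key]
  exact hs _ _

lemma gg_fderiv (Q : Fin 3 → (Fin 4 → ℝ) → ℝ) (hQ : ∀ j, ContDiff ℝ 2 (Q j)) (x) :
    ∃ w : Fin 3 → ℝ, ∀ i, fderiv ℝ (gg Q) x (ee i) =
      w 0 * pA Q i 0 x + w 1 * pA Q i 1 x + w 2 * pA Q i 2 x := by
  have h : ∀ j, HasFDerivAt (Q j) (fderiv ℝ (Q j) x) x :=
    fun j => ((hQ j).differentiable (by norm_num) x).hasFDerivAt
  have e : HasDerivAt expNegInvGlue _ (1/16 - ((Q 0 x)^2 + (Q 1 x)^2 + (Q 2 x)^2)) :=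
    ((expNegInvGlue.contDiff (n := 1)).differentiable (by norm_num) _).hasDerivAt
  have := e.comp_hasFDerivAt x
    (((((h 0).pow 2).add ((h 1).pow 2)).add ((h 2).pow 2)).const_sub (1/16))
  refine ⟨fun j => - 2 * deriv expNegInvGlue (1/16 - ((Q 0 x)^2 + (Q 1 x)^2 + (Q 2 x)^2)) * Q j x,
    fun i => ?_⟩
  refine (congrArg (fun L => L (ee i)) this.fderiv).trans ?_
  simp [pA]
  ring

lemma VV_div_zero (Q : Fin 3 → (Fin 4 → ℝ) → ℝ) (hQ : ∀ j, ContDiff ℝ 2 (Q j)) (x) :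
    ∑ i, fderiv ℝ (VV Q i) x (ee i) = 0 := by
  have hg : DifferentiableAt ℝ (gg Q) x := (gg_contDiff Q hQ).differentiable (by norm_num) x
  have ha : ∀ i j, DifferentiableAt ℝ (pA Q i j) x :=
    fun i j => (pA_contDiff Q hQ i j).differentiable (by norm_num) x
  obtain ⟨w, hw⟩ := gg_fderiv Q hQ x
  have S := fun i k j => pA_symm Q hQ i k j x
  rw [Fin.sum_univ_four]
  have e0 := hdet_fderiv (gg Q) (pA Q 1) (pA Q 2) (pA Q 3) x (ee 0) hg (ha _) (ha _) (ha _)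
  have e1 := hdet_fderiv (gg Q) (pA Q 2) (pA Q 0) (pA Q 3) x (ee 1) hg (ha _) (ha _) (ha _)
  have e2 := hdet_fderiv (gg Q) (pA Q 0) (pA Q 1) (pA Q 3) x (ee 2) hg (ha _) (ha _) (ha _)
  have e3 := hdet_fderiv (gg Q) (pA Q 0) (pA Q 2) (pA Q 1) x (ee 3) hg (ha _) (ha _) (ha _)
  refine (congrArg₂ _ (congrArg₂ _ (congrArg₂ _ e0 e1) e2) e3).trans ?_
  simp only [hw, S 1 0, S 2 0, S 3 0, S 2 1, S 3 1, S 3 2]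
  simp only [hdet]
  ring

lemma pA_face (Q : Fin 3 → (Fin 4 → ℝ) → ℝ) (hQ : ∀ j, ContDiff ℝ 2 (Q j)) (t s : ℝ)
    (h : ∀ j (y : Fin 3 → ℝ), Q j (Fin.cons t y) = s * y j) (i j : Fin 3) (y : Fin 3 → ℝ) :
    pA Q i.succ j (Fin.cons t y) = s * (if j = i then 1 else 0) := by
  have h1 : HasFDerivAt (Q j) (fderiv ℝ (Q j) (Fin.cons t y)) (Fin.cons t y) :=
    ((hQ j).differentiable (by norm_num) _).hasFDerivAt
  have h2 : HasDerivAt (fun r : ℝ => (Fin.cons t y : Fin 4 → ℝ) + r • ee i.succ) (ee i.succ) 0 := by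
    simpa using ((hasDerivAt_id (0 : ℝ)).smul_const (ee i.succ)).const_add
      (Fin.cons t y : Fin 4 → ℝ)
  have h3 := HasFDerivAt.comp_hasDerivAt (x := (0 : ℝ)) (l := Q j)
    (l' := fderiv ℝ (Q j) (Fin.cons t y)) (hl := by simpa using h1) (hf := h2)
  have e : (Q j ∘ fun r : ℝ => (Fin.cons t y : Fin 4 → ℝ) + r • ee i.succ)
      = fun r : ℝ => s * (y j + r * (if j = i then 1 else 0)) := by
    funext r
    have : (Fin.cons t y : Fin 4 → ℝ) + r • ee i.succ
        = Fin.cons t (fun k => y k + r * (if k = i then 1 else 0)) := by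
      funext k
      refine Fin.cases ?_ (fun k => ?_) k
      · simp [ee]
      · simp [ee, Pi.single_apply]
    simp only [Function.comp]
    rw [this, h]
  rw [e] at h3
  have h4 : HasDerivAt (fun r : ℝ => s * (y j + r * (if j = i then (1:ℝ) else 0)))
      (s * (if j = i then 1 else 0)) 0 := by
    simpa using (((hasDerivAt_id (0 : ℝ)).mul_const (if j = i then (1:ℝ) else 0)).const_add
      (y j)).const_mul s
  exact h3.unique h4

lemma no_smooth (Q : Fin 3 → (Fin 4 → ℝ) → ℝ) (hQ : ∀ j, ContDiff ℝ 2 (Q j))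
    (h0 : ∀ j (y : Fin 3 → ℝ), Q j (Fin.cons 0 y) = y j)
    (h1 : ∀ j (y : Fin 3 → ℝ), Q j (Fin.cons 1 y) = - y j)
    (hs : ∀ x : Fin 4 → ℝ, x 0 ∈ Icc (0:ℝ) 1 → (∃ i : Fin 3, |x i.succ| = 1) →
      1/16 ≤ (Q 0 x)^2 + (Q 1 x)^2 + (Q 2 x)^2) : False := by
  set a : Fin 4 → ℝ := Fin.cons 0 (fun _ => -1) with ha
  set b : Fin 4 → ℝ := fun _ => 1 with hb
  have hle : a ≤ b := by
    intro k
    refine Fin.cases ?_ (fun k => ?_) k <;> simp [ha, hb]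
  have D := integral_divergence_of_hasFDerivAt_off_countable' a b hle (VV Q)
    (fun i x => fderiv ℝ (VV Q i) x) ∅ countable_empty
    (fun i => (VV_contDiff Q hQ i).continuous.continuousOn)
    (fun x _ i => ((VV_contDiff Q hQ i).differentiable (by norm_num) x).hasFDerivAt)
    (by
      have : ∀ x, ∑ i, fderiv ℝ (VV Q i) x (Pi.single i 1) = 0 := VV_div_zero Q hQ
      simp [this])
  have hz : ∀ x, ∑ i, fderiv ℝ (VV Q i) x (Pi.single i 1) = 0 := VV_div_zero Q hQ
  simp only [hz, integral_zero] at D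
  rw [Fin.sum_univ_succ] at D
  have side : ∀ (i : Fin 3) (c : ℝ), |c| = 1 →
      ∫ x in Icc (a ∘ i.succ.succAbove) (b ∘ i.succ.succAbove),
        VV Q i.succ (i.succ.insertNth c x) = 0 := by
    intro i c hc
    apply setIntegral_eq_zero_of_forall_eq_zero
    intro x hx
    have g0 : gg Q (i.succ.insertNth c x) = 0 := by
      unfold gg
      apply expNegInvGlue.zero_of_nonpos
      have := hs (i.succ.insertNth c x) ?_ ⟨i, by simpa using hc⟩
      · linarith
      · have e : (i.succ.insertNth c x : Fin 4 → ℝ) 0 = x 0 := by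
          have := Fin.insertNth_apply_succAbove (α := fun _ => ℝ) i.succ c x 0
          simpa using this
        rw [e]
        have l := hx.1 0
        have u := hx.2 0
        simp [ha, hb] at l u
        exact ⟨l, u⟩
    unfold VV
    rw [g0]
    generalize i.succ = k
    fin_cases k <;> simp
  have side' : ∀ i : Fin 3, ((∫ x in Icc (a ∘ i.succ.succAbove) (b ∘ i.succ.succAbove),
        VV Q i.succ (i.succ.insertNth (b i.succ) x)) -
      ∫ x in Icc (a ∘ i.succ.succAbove) (b ∘ i.succ.succAbove),
        VV Q i.succ (i.succ.insertNth (a i.succ) x)) = 0 := by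
    intro i
    rw [side i _ (by simp [hb]), side i _ (by simp [ha]), sub_zero]
  rw [Finset.sum_eq_zero (fun i _ => side' i)] at D
  set φ : (Fin 3 → ℝ) → ℝ := fun y => expNegInvGlue (1/16 - ((y 0)^2 + (y 1)^2 + (y 2)^2)) with hφ
  have f1 : ∀ y : Fin 3 → ℝ, VV Q 0 ((0 : Fin 4).insertNth (b 0) y) = - φ y := by
    intro y
    have E : ((0 : Fin 4).insertNth (b 0) y : Fin 4 → ℝ) = Fin.cons 1 y := by
      simp [hb]
    rw [E]
    have P := fun i j => pA_face Q hQ 1 (-1) (by simpa using h1) i j y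
    have P1 := P 0
    have P2 := P 1
    have P3 := P 2
    simp only [Fin.succ_zero_eq_one, Fin.succ_one_eq_two] at P1 P2
    have e3 : (2 : Fin 3).succ = 3 := rfl
    rw [e3] at P3
    simp [VV, hdet, P1, P2, P3, gg, h1, hφ]
  have f0 : ∀ y : Fin 3 → ℝ, VV Q 0 ((0 : Fin 4).insertNth (a 0) y) = φ y := by
    intro y
    have E : ((0 : Fin 4).insertNth (a 0) y : Fin 4 → ℝ) = Fin.cons 0 y := by
      simp [ha]
    rw [E]
    have P := fun i j => pA_face Q hQ 0 1 (by simpa using h0) i j y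
    have P1 := P 0
    have P2 := P 1
    have P3 := P 2
    simp only [Fin.succ_zero_eq_one, Fin.succ_one_eq_two] at P1 P2
    have e3 : (2 : Fin 3).succ = 3 := rfl
    rw [e3] at P3
    simp [VV, hdet, P1, P2, P3, gg, h0, hφ]
  simp only [f1, f0, integral_neg] at D
  have hφc : Continuous φ := (expNegInvGlue.contDiff (n := 0)).continuous.comp (by fun_prop)
  have hpos : 0 < ∫ y in Icc (a ∘ (0 : Fin 4).succAbove) (b ∘ (0 : Fin 4).succAbove), φ y := by
    have hab : a ∘ (0 : Fin 4).succAbove = fun _ => -1 := by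
      funext k; simp [ha]
    have hbb : b ∘ (0 : Fin 4).succAbove = fun _ => 1 := by
      funext k; simp [hb]
    rw [hab, hbb]
    rw [setIntegral_pos_iff_support_of_nonneg_ae]
    · have hU : IsOpen ({y : Fin 3 → ℝ | φ y ≠ 0} ∩ Set.pi univ (fun _ => Ioo (-1:ℝ) 1)) :=
        (isOpen_ne_fun hφc continuous_const).inter
          (isOpen_set_pi finite_univ (fun _ _ => isOpen_Ioo))
      have hne : ({y : Fin 3 → ℝ | φ y ≠ 0} ∩ Set.pi univ (fun _ => Ioo (-1:ℝ) 1)).Nonempty := by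
        refine ⟨0, ?_, ?_⟩
        · have : 0 < φ 0 := by
            simp only [hφ]
            exact expNegInvGlue.pos_of_pos (by norm_num)
          exact this.ne'
        · intro k _
          simp
      refine lt_of_lt_of_le (hU.measure_pos volume hne) (measure_mono ?_)
      rintro y ⟨hy1, hy2⟩
      exact ⟨hy1, fun k => (hy2 k trivial).1.le, fun k => (hy2 k trivial).2.le⟩
    · exact Filter.Eventually.of_forall fun y => expNegInvGlue.nonneg _
    · exact hφc.continuousOn.integrableOn_compact isCompact_Icc
  linarith

lemma id_not_homotopic_neg :
    ¬ ContinuousMap.Homotopic (ContinuousMap.id ↥TwoSphere)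
      (⟨fun x => -x, continuous_neg⟩ : C(↥TwoSphere, ↥TwoSphere)) := by
  rintro ⟨F⟩
  let Y : (Fin 4 → ℝ) → EuclideanSpace ℝ (Fin 3) := fun x => WithLp.toLp 2 (fun j => x j.succ)
  have hY : Continuous Y := by
    apply (PiLp.continuous_toLp 2 _).comp
    fun_prop
  let S : Set (Fin 4 → ℝ) := {x | 1 ≤ ‖Y x‖}
  have hS : IsClosed S := isClosed_le continuous_const hY.norm
  have hne : ∀ x : S, ‖Y x‖ ≠ 0 := fun x => (lt_of_lt_of_le one_pos x.2).ne'
  let N : S → ↥TwoSphere := fun x => ⟨‖Y x‖⁻¹ • Y x, by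
    simp [norm_smul, inv_mul_cancel₀ (hne x)]⟩
  have hYS : Continuous fun x : S => Y x := hY.comp continuous_subtype_val
  have hN : Continuous N := by
    apply Continuous.subtype_mk
    exact (hYS.norm.inv₀ hne).smul hYS
  let K : S → EuclideanSpace ℝ (Fin 3) := fun x =>
    ‖Y x‖ • (F (projIcc 0 1 zero_le_one ((x : Fin 4 → ℝ) 0), N x) : EuclideanSpace ℝ (Fin 3))
  have hK : Continuous K := by
    apply hYS.norm.smul
    apply continuous_subtype_val.comp
    apply F.continuous.comp
    refine Continuous.prodMk (continuous_projIcc.comp ?_) hN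
    exact (continuous_apply 0).comp continuous_subtype_val
  have hKn : ∀ x : S, 1 ≤ ‖K x‖ := by
    intro x
    have : ‖(F (projIcc 0 1 zero_le_one ((x : Fin 4 → ℝ) 0), N x) : EuclideanSpace ℝ (Fin 3))‖ = 1 :=
      mem_sphere_zero_iff_norm.1 (Subtype.prop _)
    simp only [K, norm_smul, this, norm_norm, mul_one]
    exact x.2
  have hK0 : ∀ x : S, (x : Fin 4 → ℝ) 0 = 0 → K x = Y x := by
    intro x hx
    simp only [K, hx]
    have : projIcc (0:ℝ) 1 zero_le_one 0 = 0 := projIcc_left _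
    rw [this, F.apply_zero]
    simp [N, smul_smul, mul_inv_cancel₀ (hne x)]
  have hK1 : ∀ x : S, (x : Fin 4 → ℝ) 0 = 1 → K x = - Y x := by
    intro x hx
    simp only [K, hx]
    have : projIcc (0:ℝ) 1 zero_le_one 1 = 1 := projIcc_right _
    rw [this, F.apply_one]
    simp [N, smul_smul, mul_inv_cancel₀ (hne x)]
  have hext : ∀ j : Fin 3, ∃ P : (Fin 4 → ℝ) → ℝ, ContDiff ℝ 2 P ∧
      ∀ x : S, |P x - K x j| < 1/8 := by
    intro j
    have hKj : Continuous fun x => K x j := by fun_prop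
    obtain ⟨g, hg⟩ := ContinuousMap.exists_restrict_eq hS (⟨fun x => K x j, hKj⟩ : C(S, ℝ))
    obtain ⟨P, hP, hP2, -⟩ := g.continuous.exists_contDiff_approx 2 (ε := fun _ => 1/8)
      continuous_const (fun _ => by norm_num)
    refine ⟨P, by exact_mod_cast hP, fun x => ?_⟩
    have h1 := hP2 x
    have h2 : g x = K x j := congrArg (fun f : C(S, ℝ) => f x) hg
    rw [Real.dist_eq, h2] at h1
    exact h1
  choose P hP hPK using hext
  let c0 : ℝ → (Fin 4 → ℝ) → (Fin 4 → ℝ) := fun t x => Fin.cons t (fun k => x k.succ)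
  have hc0 : ∀ t, ContDiff ℝ 2 (c0 t) := by
    intro t
    rw [contDiff_pi]
    intro k
    refine Fin.cases ?_ (fun k => ?_) k
    · simp only [c0, Fin.cons_zero]; fun_prop
    · simp only [c0, Fin.cons_succ]; fun_prop
  let Q : Fin 3 → (Fin 4 → ℝ) → ℝ := fun j x =>
    P j x + (1 - x 0) * (x j.succ - P j (c0 0 x)) + x 0 * (- x j.succ - P j (c0 1 x))
  refine no_smooth Q ?_ ?_ ?_ ?_
  · intro j
    have A := (hP j).comp (hc0 0)
    have B := (hP j).comp (hc0 1)
    have C := hP j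
    simp only [Function.comp_def] at A B
    simp only [Q]
    fun_prop
  · intro j y
    simp [Q, c0]
  · intro j y
    simp [Q, c0]
  · rintro x ⟨hx0, hx1⟩ ⟨i, hi⟩
    have memS : ∀ z : Fin 4 → ℝ, |z i.succ| = 1 → z ∈ S := by
      intro z hz
      have := PiLp.norm_apply_le (Y z) i
      simp only [Y, Real.norm_eq_abs] at this
      rw [hz] at this
      exact this
    have hxS := memS x hi
    have h0S := memS (c0 0 x) (by simpa [c0] using hi)
    have h1S := memS (c0 1 x) (by simpa [c0] using hi)
    have close : ∀ j, |Q j x - K ⟨x, hxS⟩ j| ≤ 1/4 := by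
      intro j
      have e1 := hPK j ⟨x, hxS⟩
      have e2 := hPK j ⟨_, h0S⟩
      have e3 := hPK j ⟨_, h1S⟩
      rw [hK0 _ (by simp [c0])] at e2
      rw [hK1 _ (by simp [c0])] at e3
      simp only [Y, c0, Fin.cons_succ, PiLp.neg_apply] at e2 e3
      rw [abs_lt] at e1 e2 e3
      simp only [Q, c0]
      rw [abs_le]
      constructor <;> nlinarith
    have hn := hKn ⟨x, hxS⟩
    have hsq : 1 ≤ (K ⟨x, hxS⟩ 0)^2 + (K ⟨x, hxS⟩ 1)^2 + (K ⟨x, hxS⟩ 2)^2 := by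
      have := EuclideanSpace.norm_sq_eq (K ⟨x, hxS⟩)
      simp only [Fin.sum_univ_three, Real.norm_eq_abs, sq_abs] at this
      rw [← this]
      nlinarith
    have fin : ∀ q k : ℝ, |q - k| ≤ 1/4 → k^2 ≤ 1/4 + 4 * (q^2) := by
      intro q k h
      rw [abs_le] at h
      rcases le_total 0 k with h' | h' <;> nlinarith [sq_nonneg (q - 1/4), sq_nonneg (q+1/4),
        sq_nonneg (2*q - k), sq_nonneg (q - k)]
    have a0 := fin _ _ (close 0)
    have a1 := fin _ _ (close 1)
    have a2 := fin _ _ (close 2)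
    nlinarith

lemma homotopic_neg (f : C(↥TwoSphere, ↥TwoSphere)) (hf : ∀ x, f x ≠ x) :
    ContinuousMap.Homotopic f (⟨fun x => -x, continuous_neg⟩ : C(↥TwoSphere, ↥TwoSphere)) := by
  let L : unitInterval × ↥TwoSphere → EuclideanSpace ℝ (Fin 3) := fun p =>
    (1 - (p.1 : ℝ)) • (f p.2 : EuclideanSpace ℝ (Fin 3)) -
      (p.1 : ℝ) • (p.2 : EuclideanSpace ℝ (Fin 3))
  have hn : ∀ x : ↥TwoSphere, ‖(x : EuclideanSpace ℝ (Fin 3))‖ = 1 :=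
    fun x => mem_sphere_zero_iff_norm.1 x.2
  have hL : Continuous L := by fun_prop
  have hL0 : ∀ p, ‖L p‖ ≠ 0 := by
    rintro ⟨t, x⟩ h
    rw [norm_eq_zero] at h
    have h' := sub_eq_zero.1 h
    have h2 := congrArg norm h'
    simp only [norm_smul, hn, mul_one, Real.norm_eq_abs] at h2
    rw [abs_of_nonneg (by linarith [t.2.2]), abs_of_nonneg t.2.1] at h2
    have ht : (t : ℝ) = 1/2 := by linarith
    apply hf x
    apply Subtype.ext
    simp only [ht] at h'
    norm_num at h'
    exact h'
  refine ⟨⟨⟨fun p => ⟨‖L p‖⁻¹ • L p, by simp [norm_smul, inv_mul_cancel₀ (hL0 p)]⟩, ?_⟩, ?_, ?_⟩⟩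
  · apply Continuous.subtype_mk
    exact (hL.norm.inv₀ hL0).smul hL
  · intro x
    apply Subtype.ext
    simp [L, hn]
  · intro x
    apply Subtype.ext
    simp [L, hn]

/-- A finite group acting freely on the 2-sphere, each element acting as a
(continuous) homeomorphism, has order at most 2. -/
theorem stmt_3 {G : Type*} [Group G] [Fintype G] [MulAction G ↥TwoSphere]
    (hcont : ∀ g : G, Continuous fun x : ↥TwoSphere => g • x)
    (hfree : ∀ g : G, g ≠ 1 → ∀ x : ↥TwoSphere, g • x ≠ x) :
    Fintype.card G ≤ 2 := by
  classical
  by_contra! hc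
  obtain ⟨g, hg⟩ := Fintype.exists_ne_of_one_lt_card (by omega : 1 < Fintype.card G) 1
  obtain ⟨h, hh⟩ : ∃ h : G, h ∉ ({1, g⁻¹} : Finset G) := by
    by_contra! H
    have h1 : (Finset.univ : Finset G) ⊆ {1, g⁻¹} := fun x _ => H x
    have h2 := Finset.card_le_card h1
    have h3 := Finset.card_le_two (a := (1 : G)) (b := g⁻¹)
    rw [Finset.card_univ] at h2
    omega
  simp only [Finset.mem_insert, Finset.mem_singleton, not_or] at hh
  have hgh : g * h ≠ 1 := fun e => hh.2 (eq_inv_of_mul_eq_one_right e)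
  let c : G → C(↥TwoSphere, ↥TwoSphere) := fun g => ⟨fun x => g • x, hcont g⟩
  have A := homotopic_neg (c g) (hfree g hg)
  have B := homotopic_neg (c h) (hfree h hh.1)
  have C := homotopic_neg (c (g * h)) (hfree _ hgh)
  have D := A.comp B
  have e1 : (c g).comp (c h) = c (g * h) := by
    ext1 x
    exact (mul_smul g h x).symm
  have e2 : (⟨fun x => -x, continuous_neg⟩ : C(↥TwoSphere, ↥TwoSphere)).comp
      ⟨fun x => -x, continuous_neg⟩ = ContinuousMap.id _ := by
    ext1 x
    exact neg_neg x
  rw [e1, e2] at D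
  exact id_not_homotopic_neg (D.symm.trans C)
end

section
/- Let G be a finite group of order exactly 2 acting freely by homeomorphisms on the 2-sphere S² (i.e. each g ∈ G acts continuously and g·x ≠ x for all x whenever g ≠ 1). Then the action is topologically equivalent to the antipodal action: there exists a homeomorphism h : S² → S² such that for the nontrivial element g ∈ G one has h(g·x) = −h(x) for every x ∈ S². -/
namespace FI
open Set Complex Metric Topology Filter

/-- continuous branch of the logarithm of `f` on `A` -/
def HasLog {X : Type*} [TopologicalSpace X] (f : X → ℂ) (A : Set X) : Prop :=
  ∃ g : X → ℂ, ContinuousOn g A ∧ ∀ x ∈ A, exp (g x) = f x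

theorem HasLog.mono {X : Type*} [TopologicalSpace X] {f : X → ℂ} {A B : Set X}
    (h : HasLog f A) (hB : B ⊆ A) : HasLog f B := by
  obtain ⟨g, hg, h⟩ := h
  exact ⟨g, hg.mono hB, fun x hx => h x (hB hx)⟩

theorem HasLog.congr {X : Type*} [TopologicalSpace X] {f f' : X → ℂ} {A : Set X}
    (h : HasLog f A) (hB : ∀ x ∈ A, f x = f' x) : HasLog f' A := by
  obtain ⟨g, hg, h⟩ := h
  exact ⟨g, hg, fun x hx => (h x hx).trans (hB x hx)⟩

theorem HasLog.mul {X : Type*} [TopologicalSpace X] {f f' : X → ℂ} {A : Set X}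
    (h : HasLog f A) (h' : HasLog f' A) : HasLog (fun x => f x * f' x) A := by
  obtain ⟨g, hg, h⟩ := h
  obtain ⟨g', hg', h'⟩ := h'
  exact ⟨fun x => g x + g' x, hg.add hg', fun x hx => by rw [exp_add, h x hx, h' x hx]⟩

theorem HasLog.inv {X : Type*} [TopologicalSpace X] {f : X → ℂ} {A : Set X}
    (h : HasLog f A) : HasLog (fun x => (f x)⁻¹) A := by
  obtain ⟨g, hg, h⟩ := h
  exact ⟨fun x => - g x, hg.neg, fun x hx => by rw [exp_neg, h x hx]⟩

theorem HasLog.comp {X Y : Type*} [TopologicalSpace X] [TopologicalSpace Y] {f : X → ℂ} {A : Set X}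
    {B : Set Y} {φ : Y → X} (h : HasLog f A) (hφ : ContinuousOn φ B) (hm : MapsTo φ B A) :
    HasLog (fun y => f (φ y)) B := by
  obtain ⟨g, hg, h⟩ := h
  exact ⟨fun y => g (φ y), hg.comp hφ hm, fun x hx => h _ (hm hx)⟩

theorem hasLog_const {X : Type*} [TopologicalSpace X] {A : Set X} {c : ℂ} (hc : c ≠ 0) :
    HasLog (fun _ : X => c) A :=
  ⟨fun _ => log c, continuousOn_const, fun _ _ => exp_log hc⟩

theorem exp_unique {X : Type*} [TopologicalSpace X] {S : Set X} (hS : IsPreconnected S)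
    {g h : X → ℂ} (hg : ContinuousOn g S) (hh : ContinuousOn h S)
    (he : ∀ x ∈ S, exp (g x) = exp (h x)) {a : X} (ha : a ∈ S) (hga : g a = h a) :
    ∀ x ∈ S, g x = h x := by
  have := isCoveringMap_exp.eqOn_of_comp_eqOn hS hg hh (fun x hx => Subtype.ext (he x hx)) ha hga
  exact this

theorem HasLog.homotopy {X : Type*} [TopologicalSpace X] {A : Set X} {H : ℝ → X → ℂ}
    (hc : ContinuousOn (Function.uncurry H) (Icc 0 1 ×ˢ A))
    (h0 : ∀ t ∈ Icc (0:ℝ) 1, ∀ x ∈ A, H t x ≠ 0) (h : HasLog (H 0) A) : HasLog (H 1) A := by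
  classical
  obtain ⟨g, hg, h⟩ := h
  let HH : C(unitInterval × A, {z : ℂ // z ≠ 0}) :=
    ⟨fun p => ⟨H p.1 p.2, h0 _ p.1.2 _ p.2.2⟩, by
      refine Continuous.subtype_mk ?_ _
      exact hc.comp_continuous (f := fun p : unitInterval × A => ((p.1 : ℝ), (p.2 : X)))
        (by fun_prop) (fun p => ⟨p.1.2, p.2.2⟩)⟩
  let f : C(A, ℂ) := ⟨A.domRestrict g, hg.domRestrict⟩
  have H0 : ∀ a, HH (0, a) = ⟨exp (f a), exp_ne_zero _⟩ := fun a =>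
    Subtype.ext (h a a.2).symm
  let L := isCoveringMap_exp.liftHomotopy HH f H0
  have hL : ∀ p, exp (L p) = HH p := fun p =>
    congrArg Subtype.val (congrFun (isCoveringMap_exp.liftHomotopy_lifts HH f H0) p)
  refine ⟨fun x => if hx : x ∈ A then L (1, ⟨x, hx⟩) else 0, ?_, ?_⟩
  · rw [continuousOn_iff_continuous_domRestrict]
    have : Continuous fun x : A => L (1, x) := by fun_prop
    convert this using 1
    ext x
    simp
  · intro x hx
    beta_reduce
    rw [dif_pos hx, hL]
    rfl

theorem hasLog_convex {E : Type*} [AddCommGroup E] [TopologicalSpace E] [IsTopologicalAddGroup E]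
    [Module ℝ E] [ContinuousSMul ℝ E] {A : Set E} (hA : Convex ℝ A) {f : E → ℂ}
    (hf : ContinuousOn f A) (h0 : ∀ x ∈ A, f x ≠ 0) : HasLog f A := by
  rcases A.eq_empty_or_nonempty with rfl | ⟨a, ha⟩
  · exact ⟨fun _ => 0, by simp, by simp⟩
  have hm : ∀ t ∈ Icc (0:ℝ) 1, ∀ x ∈ A, a + t • (x - a) ∈ A := by
    intro t ht x hx
    exact hA.add_smul_sub_mem ha hx ht
  have := HasLog.homotopy (A := A) (H := fun t x => f (a + t • (x - a))) ?_ ?_ ?_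
  · simpa using this
  · refine hf.comp (f := fun p : ℝ × E => a + p.1 • (p.2 - a)) (by fun_prop) ?_
    rintro ⟨t, x⟩ ⟨ht, hx⟩
    exact hm t ht x hx
  · intro t ht x hx
    exact h0 _ (hm t ht x hx)
  · simpa using hasLog_const (h0 a ha)

/-- the circle has no logarithm -/
theorem not_hasLog_sphere (c : ℂ) {R : ℝ} (hR : 0 < R) : ¬ HasLog (fun z => z - c) (sphere c R) := by
  rintro ⟨g, hg, h⟩
  have hm : ∀ t : ℝ, c + R * exp (t * I) ∈ sphere c R := by
    intro t
    simp [Complex.norm_exp_ofReal_mul_I, abs_of_pos hR]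
  have hcont : Continuous fun t : ℝ => g (c + R * exp (t * I)) :=
    hg.comp_continuous (by fun_prop) hm
  have key := exp_unique (S := (univ : Set ℝ)) isPreconnected_univ
    (g := fun t : ℝ => g (c + R * exp (t * I)))
    (h := fun t : ℝ => t * I + g (c + R * exp ((0:ℝ) * I))) hcont.continuousOn (by fun_prop)
    (by
      intro t _
      rw [exp_add, h _ (hm t), h _ (hm 0)]
      simp; ring) (mem_univ 0) (by simp)
  have h1 := key (2 * Real.pi) (mem_univ _)
  have h2 : exp (((2 * Real.pi : ℝ) : ℂ) * I) = exp (((0:ℝ):ℂ) * I) := by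
    push_cast
    rw [exp_two_pi_mul_I]; simp
  simp only [h2] at h1
  have h3 : (((2 * Real.pi : ℝ) : ℂ) * I) = 0 := by
    linear_combination -h1
  simp [Real.pi_ne_zero, I_ne_zero] at h3

theorem glue_aux {X : Type*} [TopologicalSpace X] {A B : Set X} {f : X → ℂ}
    (hAB : IsPreconnected (A ∩ B)) (hA : HasLog f A) (hB : HasLog f B) :
    ∃ g : X → ℂ, ContinuousOn g A ∧ ContinuousOn g B ∧ ∀ x ∈ A ∪ B, exp (g x) = f x := by
  classical
  obtain ⟨g, hg, hgf⟩ := hA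
  obtain ⟨h, hh, hhf⟩ := hB
  obtain ⟨h', hh', hhf', hEq⟩ : ∃ h' : X → ℂ, ContinuousOn h' B ∧ (∀ x ∈ B, exp (h' x) = f x) ∧
      ∀ x ∈ A ∩ B, g x = h' x := by
    rcases (A ∩ B).eq_empty_or_nonempty with he | ⟨a, ha⟩
    · exact ⟨h, hh, hhf, by simp [he]⟩
    · have he : exp (g a - h a) = 1 := by
        rw [exp_sub, hgf a ha.1, hhf a ha.2, div_self]
        rw [← hgf a ha.1]; exact exp_ne_zero _
      have hc : ContinuousOn (fun x => h x + (g a - h a)) B := by fun_prop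
      have hx : ∀ x ∈ B, exp (h x + (g a - h a)) = f x := fun x hx => by
        rw [exp_add, he, mul_one, hhf x hx]
      refine ⟨_, hc, hx, ?_⟩
      exact exp_unique hAB (hg.mono inter_subset_left) (hc.mono inter_subset_right)
        (fun x hx' => by rw [hgf x hx'.1, hx x hx'.2]) ha (by ring)
  refine ⟨fun x => if x ∈ A then g x else h' x, ?_, ?_, ?_⟩
  · exact hg.congr fun x hx => by simp [hx]
  · refine hh'.congr fun x hx => ?_
    by_cases hxA : x ∈ A
    · simp [hxA, hEq x ⟨hxA, hx⟩]
    · simp [hxA]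
  · intro x hx
    by_cases hxA : x ∈ A
    · simp [hxA, hgf]
    · simp only [hxA, if_false]
      exact hhf' x (hx.resolve_left hxA)

theorem HasLog.glue_closed {X : Type*} [TopologicalSpace X] {A B : Set X} {f : X → ℂ}
    (cA : IsClosed A) (cB : IsClosed B)
    (hAB : IsPreconnected (A ∩ B)) (hA : HasLog f A) (hB : HasLog f B) : HasLog f (A ∪ B) := by
  obtain ⟨g, h1, h2, h3⟩ := glue_aux hAB hA hB
  exact ⟨g, h1.union_of_isClosed h2 cA cB, h3⟩

theorem HasLog.glue_open {X : Type*} [TopologicalSpace X] {A B : Set X} {f : X → ℂ}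
    (cA : IsOpen A) (cB : IsOpen B)
    (hAB : IsPreconnected (A ∩ B)) (hA : HasLog f A) (hB : HasLog f B) : HasLog f (A ∪ B) := by
  obtain ⟨g, h1, h2, h3⟩ := glue_aux hAB hA hB
  exact ⟨g, h1.union_of_isOpen h2 cA cB, h3⟩

theorem odd_log_false {X : Type*} [TopologicalSpace X] {S : Set X} (hS : IsPreconnected S)
    (hne : S.Nonempty) {σ : X → X} (hσ : ContinuousOn σ S) (hm : MapsTo σ S S)
    (hi : ∀ x ∈ S, σ (σ x) = x) {f : X → ℂ} (hf : HasLog f S)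
    (hodd : ∀ x ∈ S, f (σ x) = - f x) : False := by
  obtain ⟨L, hL, hLf⟩ := hf
  obtain ⟨a, ha⟩ := hne
  have hc : exp (L (σ a) - L a) = -1 := by
    rw [exp_sub, hLf a ha, hLf _ (hm ha), hodd a ha, neg_div, div_self]
    rw [← hLf a ha]; exact exp_ne_zero _
  have key := exp_unique hS (g := fun x => L (σ x)) (h := fun x => L x + (L (σ a) - L a))
    (hL.comp hσ hm) (by fun_prop)
    (fun x hx => by rw [exp_add, hc, hLf _ (hm hx), hLf x hx, hodd x hx]; ring) ha (by ring)
  have h1 := key (σ a) (hm ha)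
  simp only [hi a ha] at h1
  have h2 : L (σ a) - L a = 0 := by linear_combination (-1/2) * h1
  rw [h2] at hc
  norm_num at hc

/-- Borsuk-Ulam type statement on the disc -/
theorem no_odd_disc {f : ℂ → ℂ} (hf : ContinuousOn f (closedBall 0 1))
    (h0 : ∀ z ∈ closedBall (0:ℂ) 1, f z ≠ 0) (hodd : ∀ z ∈ sphere (0:ℂ) 1, f (-z) = - f z) :
    False := by
  have hL := hasLog_convex (convex_closedBall (0:ℂ) 1) hf h0
  refine odd_log_false (S := sphere (0:ℂ) 1) (σ := fun z => -z) ?_ ⟨1, by simp⟩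
    (by fun_prop) (fun z hz => by simpa using hz) (by simp) (hL.mono sphere_subset_closedBall) hodd
  exact isPreconnected_sphere (by simp) 0 1

theorem no_free_involution_disc {τ : ℂ → ℂ} (hτ : ContinuousOn τ (closedBall 0 1))
    (hm : MapsTo τ (closedBall 0 1) (closedBall 0 1))
    (hi : ∀ z ∈ closedBall (0:ℂ) 1, τ (τ z) = z) (hfree : ∀ z ∈ closedBall (0:ℂ) 1, τ z ≠ z) :
    False := by
  have hL := hasLog_convex (convex_closedBall (0:ℂ) 1) (f := fun z => z - τ z) (by fun_prop)
    (fun z hz => sub_ne_zero.2 (hfree z hz).symm)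
  refine odd_log_false (convex_closedBall (0:ℂ) 1).isPreconnected ⟨0, by simp⟩ hτ hm hi hL ?_
  intro z hz
  simp only [hi z hz]
  ring

/-- L2 -/
theorem hasLog_of_joined {A : Set ℂ} {p q : ℂ} (h : JoinedIn Aᶜ p q) :
    HasLog (fun z => (z - p) / (z - q)) A := by
  obtain ⟨γ, hγ⟩ := h
  have hq : ∀ z ∈ A, z - q ≠ 0 := fun z hz h' => by
    have := hγ 1
    rw [γ.target, ← sub_eq_zero.1 h'] at this
    exact this hz
  have hne : ∀ t, ∀ z ∈ A, z - γ.extend t ≠ 0 := by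
    intro t z hz h'
    have := hγ (projIcc 0 1 zero_le_one t)
    have h2 : γ (projIcc 0 1 zero_le_one t) = γ.extend t := rfl
    rw [h2, ← sub_eq_zero.1 h'] at this
    exact this hz
  have := HasLog.homotopy (A := A) (H := fun t z => (z - γ.extend (1 - t)) / (z - q)) ?_ ?_ ?_
  · simpa using this
  · refine ContinuousOn.div (by fun_prop) (by fun_prop) ?_
    rintro ⟨t, z⟩ ⟨ht, hz⟩
    exact hq z hz
  · intro t ht z hz
    exact div_ne_zero (hne _ z hz) (hq z hz)
  · refine (hasLog_const one_ne_zero).congr ?_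
    intro z hz
    simp [div_self (hq z hz)]

theorem isPathConnected_compl_closedBall (c : ℂ) {R : ℝ} (hR : 0 < R) :
    IsPathConnected (closedBall c R)ᶜ := by
  have h1 : IsPathConnected {w : ℂ | Real.log R < w.re} := by
    refine Convex.isPathConnected (convex_halfSpace_re_gt _) ⟨(Real.log R + 1 : ℝ), ?_⟩
    simp
  have h2 := h1.image (f := fun w => c + exp w) (by fun_prop)
  convert h2 using 1
  ext z
  simp only [mem_compl_iff, mem_closedBall, not_le, mem_image, mem_ofPred_eq]
  constructor
  · intro hz
    have hz0 : z - c ≠ 0 := by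
      intro h; rw [dist_eq_norm, h, norm_zero] at hz; linarith
    refine ⟨log (z - c), ?_, ?_⟩
    · rw [log_re]
      rw [dist_eq_norm] at hz
      exact Real.log_lt_log hR hz
    · rw [exp_log hz0]; ring
  · rintro ⟨w, hw, rfl⟩
    rw [dist_eq_norm]
    simp only [add_sub_cancel_left, norm_exp]
    exact (Real.log_lt_iff_lt_exp hR).1 hw

theorem frontier_pathComponentIn {K : Set ℂ} (hK : IsClosed K) (p : ℂ) :
    closure (pathComponentIn Kᶜ p) ⊆ pathComponentIn Kᶜ p ∪ K := by
  intro z hz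
  by_cases hzK : z ∈ K
  · exact Or.inr hzK
  left
  obtain ⟨ε, hε, hb⟩ := Metric.isOpen_iff.1 hK.isOpen_compl z hzK
  obtain ⟨y, hy1, hy2⟩ := mem_closure_iff.1 hz (ball z ε) isOpen_ball (mem_ball_self hε)
  have h1 : JoinedIn Kᶜ y z :=
    (((convex_ball z ε).isPathConnected ⟨z, mem_ball_self hε⟩).joinedIn y hy1 z
      (mem_ball_self hε)).mono hb
  exact JoinedIn.trans (y := y) hy2 h1

theorem L3_aux {K : Set ℂ} (hK : IsCompact K) {p q : ℂ}
    (hp : p ∉ K) (hpq : ¬ JoinedIn Kᶜ p q)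
    (hb : Bornology.IsBounded (pathComponentIn Kᶜ p)) :
    ¬ HasLog (fun z => (z - p) / (z - q)) K := by
  classical
  rintro ⟨g, hg, hgf⟩
  set U := pathComponentIn Kᶜ p with hU
  have hUo : IsOpen U := hK.isClosed.isOpen_compl.pathComponentIn p
  have hqU : q ∉ U := hpq
  obtain ⟨G, hG⟩ := ContinuousMap.exists_restrict_eq (Y := ℂ) hK.isClosed ⟨K.domRestrict g, hg.domRestrict⟩
  have hGg : ∀ z ∈ K, G z = g z := fun z hz => congrArg (fun φ => φ ⟨z, hz⟩) hG
  let F : ℂ → ℂ := fun z => if z ∈ U then (z - q) * exp (G z) else z - p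
  have hfr : ∀ z ∈ frontier U, z ∈ K := by
    intro z hz
    rcases frontier_pathComponentIn hK.isClosed p hz.1 with h | h
    · exact absurd h (by rw [hUo.frontier_eq] at hz; exact hz.2)
    · exact h
  have hFc : Continuous F := by
    refine Continuous.if ?_ (by fun_prop) (by fun_prop)
    intro z hz
    have hzK := hfr z hz
    rw [hGg z hzK, hgf z hzK]
    have : z - q ≠ 0 := by
      intro h'
      have := hgf z hzK
      simp only [h', div_zero] at this
      exact exp_ne_zero _ this
    field_simp
  have hF0 : ∀ z, F z ≠ 0 := by
    intro z
    by_cases hz : z ∈ U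
    · simp only [F, hz, if_true]
      refine mul_ne_zero (sub_ne_zero.2 ?_) (exp_ne_zero _)
      rintro rfl; exact hqU hz
    · simp only [F, hz, if_false]
      refine sub_ne_zero.2 ?_
      rintro rfl
      exact hz (mem_pathComponentIn_self hp)
  have hL := hasLog_convex (convex_univ (𝕜 := ℝ) (E := ℂ)) hFc.continuousOn (fun z _ => hF0 z)
  obtain ⟨R, hR⟩ := hb.subset_ball p
  have hR' : U ⊆ ball p (max R 1) := hR.trans (ball_subset_ball (le_max_left _ _))
  refine not_hasLog_sphere p (R := max R 1) (by positivity) ((hL.mono (subset_univ _)).congr ?_)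
  intro z hz
  have : z ∉ U := fun h => by
    have := hR' h
    rw [mem_ball, mem_sphere.1 hz] at this
    exact lt_irrefl _ this
  simp [F, this]

theorem L3 {K : Set ℂ} (hK : IsCompact K) {p q : ℂ}
    (hp : p ∉ K) (hq : q ∉ K) (h : HasLog (fun z => (z - p) / (z - q)) K) : JoinedIn Kᶜ p q := by
  by_contra hpq
  by_cases hb : Bornology.IsBounded (pathComponentIn Kᶜ p)
  · exact L3_aux hK hp hpq hb h
  by_cases hb' : Bornology.IsBounded (pathComponentIn Kᶜ q)
  · refine L3_aux hK hq (fun h => hpq h.symm) hb' (h.inv.congr ?_)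
    intro z _; rw [inv_div]
  obtain ⟨R, hR⟩ := hK.isBounded.subset_closedBall 0
  have hR' : K ⊆ closedBall 0 (max R 1) := hR.trans (closedBall_subset_closedBall (le_max_left _ _))
  have hpc := (isPathConnected_compl_closedBall 0 (R := max R 1) (by positivity))
  have far : ∀ p, ¬ Bornology.IsBounded (pathComponentIn Kᶜ p) →
      ∃ z ∈ (closedBall (0:ℂ) (max R 1))ᶜ, JoinedIn Kᶜ p z := by
    intro p hp
    by_contra hcon
    push Not at hcon
    refine hp ((isBounded_closedBall (x := (0:ℂ)) (r := max R 1)).subset ?_)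
    intro z hz
    by_contra hz'
    exact hcon z hz' hz
  obtain ⟨z, hz, hpz⟩ := far p hb
  obtain ⟨w, hw, hqw⟩ := far q hb'
  exact hpq ((hpz.trans ((hpc.joinedIn z hz w hw).mono (compl_subset_compl.2 hR'))).trans hqw.symm)

/-- Janiszewski -/
theorem L4 {A B : Set ℂ} (hA : IsCompact A) (hB : IsCompact B) (hAB : IsPreconnected (A ∩ B))
    {p q : ℂ} (h1 : JoinedIn Aᶜ p q) (h2 : JoinedIn Bᶜ p q) : JoinedIn (A ∪ B)ᶜ p q := by
  refine L3 (hA.union hB) ?_ ?_ ?_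
  · rintro (h | h)
    exacts [h1.source_mem h, h2.source_mem h]
  · rintro (h | h)
    exacts [h1.target_mem h, h2.target_mem h]
  · exact (hasLog_of_joined h1).glue_closed hA.isClosed hB.isClosed hAB (hasLog_of_joined h2)

theorem L6 {a b : ℂ} (hab : a ≠ b) (α β : Path a b) (h : range α ∩ range β ⊆ {a, b}) :
    ¬ IsPreconnected (range α ∪ range β)ᶜ := by
  intro hc
  have key : ∀ γ : Path a b, HasLog (fun z => (z - a) / (z - b)) (range γ)ᶜ := by
    intro γ
    refine hasLog_of_joined ⟨γ, fun t => ?_⟩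
    rw [compl_compl]; exact mem_range_self t
  have hcl : ∀ γ : Path a b, IsOpen (range γ)ᶜ := fun γ =>
    (isCompact_range γ.continuous).isClosed.isOpen_compl
  rw [compl_union] at hc
  have h1 := (key α).glue_open (hcl α) (hcl β) hc (key β)
  rw [← compl_inter] at h1
  have h2 : HasLog (fun z => (z - a) / (z - b)) ({a, b} : Set ℂ)ᶜ := h1.mono (compl_subset_compl.2 h)
  have hd : 0 < dist b a := dist_pos.2 hab.symm
  have hb : ∀ z ∈ ball a (dist b a), z - b ≠ 0 := by
    intro z hz h'
    rw [sub_eq_zero.1 h'] at hz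
    exact lt_irrefl _ (mem_ball.1 hz)
  have h3 := hasLog_convex (convex_ball a (dist b a)) (f := fun z => z - b) (by fun_prop) hb
  have hsub : sphere a (dist b a / 2) ⊆ ball a (dist b a) := fun z hz => by
    rw [mem_ball, mem_sphere.1 hz]; linarith
  refine not_hasLog_sphere a (R := dist b a / 2) (by linarith)
    (((h2.mono ?_).mul (h3.mono hsub)).congr ?_)
  · intro z hz
    rintro (rfl | h')
    · rw [mem_sphere, dist_self] at hz; linarith
    · exact hb z (hsub hz) (sub_eq_zero.2 h')
  · intro z hz
    exact div_mul_cancel₀ _ (hb z (hsub hz))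

end FI

namespace FI
open Set Complex Metric Topology Filter

theorem crossing {X : Type*} [TopologicalSpace X] {C D : Set X} (hC : IsPreconnected C)
    (hD : IsOpen D) {p q : X} (hp : p ∈ C)
    (hpD : p ∈ D) (hq : q ∈ C) (hqD : q ∉ D) : ∃ z ∈ C, z ∈ closure D ∧ z ∉ D := by
  by_contra hcon
  push Not at hcon
  refine hqD (hC.subset_left_of_subset_union hD isClosed_closure.isOpen_compl
    (disjoint_compl_right.mono_left subset_closure) ?_ ⟨p, hp, hpD⟩ hq)
  intro z hz
  by_cases h : z ∈ closure D
  · exact Or.inl (hcon z hz h)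
  · exact Or.inr h

theorem crossingJ {X : Type*} [TopologicalSpace X] {F D : Set X}
    (hD : IsOpen D) {p q : X} (h : JoinedIn F p q) (hpD : p ∈ D) (hqD : q ∉ D) :
    ∃ z ∈ F, z ∈ closure D ∧ z ∉ D := by
  obtain ⟨γ, hγ⟩ := h
  obtain ⟨z, ⟨t, rfl⟩, hz⟩ := crossing (isPreconnected_range γ.continuous) hD
    (p := p) (q := q) ⟨0, γ.source⟩ hpD ⟨1, γ.target⟩ hqD
  exact ⟨_, hγ t, hz⟩

theorem continuousOn_inv_of_compact {X Y : Type*} [TopologicalSpace X] [TopologicalSpace Y]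
    [T2Space Y] [Nonempty X] {K : Set X} (hK : IsCompact K) {f : X → Y} (hf : ContinuousOn f K)
    (hi : InjOn f K) : ContinuousOn (Function.invFunOn f K) (f '' K) := by
  rw [continuousOn_iff_isClosed]
  intro t ht
  refine ⟨f '' (K ∩ t), ((hK.inter_right ht).image_of_continuousOn
    (hf.mono inter_subset_left)).isClosed, ?_⟩
  ext y
  constructor
  · rintro ⟨h1, x, hx, rfl⟩
    have h1' : Function.invFunOn f K (f x) ∈ t := h1
    rw [hi.leftInvOn_invFunOn hx] at h1'
    exact ⟨⟨x, ⟨hx, h1'⟩, rfl⟩, ⟨x, hx, rfl⟩⟩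
  · rintro ⟨⟨x, ⟨hx, hxt⟩, rfl⟩, _⟩
    refine ⟨?_, ⟨x, hx, rfl⟩⟩
    show Function.invFunOn f K (f x) ∈ t
    rw [hi.leftInvOn_invFunOn hx]
    exact hxt

/-- parametrized Jordan curve of period one -/
structure IsJ (γ : ℝ → ℂ) : Prop where
  cont : Continuous γ
  inj : ∀ u v, γ u = γ v ↔ ∃ n : ℤ, u - v = n

namespace IsJ
variable {γ : ℝ → ℂ} (h : IsJ γ)
include h

theorem per (u : ℝ) : γ (u + 1) = γ u := (h.inj _ _).2 ⟨1, by simp⟩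

theorem exists_rep (s : ℝ) {z : ℂ} (hz : z ∈ range γ) : ∃ u, s ≤ u ∧ u < s + 1 ∧ γ u = z := by
  obtain ⟨v, rfl⟩ := hz
  refine ⟨s + Int.fract (v - s), by linarith [Int.fract_nonneg (v - s)],
    by linarith [Int.fract_lt_one (v - s)], (h.inj _ _).2 ⟨-⌊v - s⌋, ?_⟩⟩
  rw [Int.fract]; push_cast; ring

theorem injOn {s t : ℝ} (hst : t < s + 1) : InjOn γ (Icc s t) := by
  intro u hu v hv huv
  obtain ⟨n, hn⟩ := (h.inj _ _).1 huv
  have h1 : (n:ℝ) < 1 := by rw [← hn]; linarith [hu.2, hv.1]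
  have h2 : (-1:ℝ) < n := by rw [← hn]; linarith [hu.1, hv.2]
  have h1' : n < 1 := by exact_mod_cast h1
  have h2' : -1 < n := by exact_mod_cast h2
  have : n = 0 := by omega
  rw [this] at hn; simp at hn; linarith

theorem range_eq : range γ = γ '' Icc 0 1 := by
  apply subset_antisymm
  · intro z hz
    obtain ⟨u, h1, h2, rfl⟩ := h.exists_rep 0 hz
    exact ⟨u, ⟨h1, by linarith⟩, rfl⟩
  · exact image_subset_range _ _

theorem compact : IsCompact (range γ) := by
  rw [h.range_eq]; exact isCompact_Icc.image h.cont

theorem arc_compact (s t : ℝ) : IsCompact (γ '' Icc s t) := isCompact_Icc.image h.cont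

theorem arc_hasLog {s t : ℝ} (hst : t < s + 1) {f : ℂ → ℂ} (hf : ContinuousOn f (γ '' Icc s t))
    (h0 : ∀ z ∈ γ '' Icc s t, f z ≠ 0) : HasLog f (γ '' Icc s t) := by
  have h1 : HasLog (fun u => f (γ u)) (Icc s t) := by
    refine hasLog_convex (convex_Icc s t) ?_ ?_
    · exact hf.comp h.cont.continuousOn (mapsTo_image _ _)
    · intro u hu; exact h0 _ (mem_image_of_mem _ hu)
  have h2 := continuousOn_inv_of_compact isCompact_Icc h.cont.continuousOn (h.injOn hst)
  refine (h1.comp h2 ?_).congr ?_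
  · rintro _ ⟨u, hu, rfl⟩
    rw [(h.injOn hst).leftInvOn_invFunOn hu]; exact hu
  · rintro _ ⟨u, hu, rfl⟩
    rw [(h.injOn hst).leftInvOn_invFunOn hu]

theorem arc_joined {s t : ℝ} (hst : t < s + 1) {p q : ℂ} (hp : p ∉ γ '' Icc s t)
    (hq : q ∉ γ '' Icc s t) : JoinedIn (γ '' Icc s t)ᶜ p q := by
  have hq' : ∀ z ∈ γ '' Icc s t, z - q ≠ 0 := by
    intro z hz h'; rw [← sub_eq_zero.1 h'] at hq; exact hq hz
  have hp' : ∀ z ∈ γ '' Icc s t, z - p ≠ 0 := by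
    intro z hz h'; rw [← sub_eq_zero.1 h'] at hp; exact hp hz
  refine L3 (h.arc_compact s t) hp hq (h.arc_hasLog hst ?_ ?_)
  · exact ContinuousOn.div (by fun_prop) (by fun_prop) hq'
  · intro z hz; exact div_ne_zero (hp' z hz) (hq' z hz)

theorem not_preconnected : ¬ IsPreconnected (range γ)ᶜ := by
  have hc := h.cont
  let α : Path (γ 0) (γ (1/2)) :=
    { toFun := fun t => γ (t / 2), continuous_toFun := by fun_prop,
      source' := by simp, target' := by simp }
  let β : Path (γ 0) (γ (1/2)) :=
    { toFun := fun t => γ (1 - t / 2), continuous_toFun := by fun_prop,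
      source' := by simpa using h.per 0, target' := by norm_num }
  have hab : γ 0 ≠ γ (1/2) := by
    intro h'
    have := h.injOn (s := 0) (t := 1/2) (by norm_num) ⟨by norm_num, by norm_num⟩
      ⟨by norm_num, by norm_num⟩ h'
    norm_num at this
  have key := L6 hab α β ?_
  · have heq : range γ = range α ∪ range β := ?_
    · rw [heq]; exact key
    apply subset_antisymm
    · intro z hz
      obtain ⟨u, h1, h2, rfl⟩ := h.exists_rep 0 hz
      by_cases hu : u ≤ 1/2
      · left; exact ⟨⟨2 * u, by linarith, by linarith⟩, by simp [α]⟩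
      · right
        push Not at hu
        refine ⟨⟨2 - 2 * u, by linarith, by linarith⟩, ?_⟩
        simp only [β, Path.coe_mk_mk]
        congr 1
        ring
    · rintro z (⟨t, rfl⟩ | ⟨t, rfl⟩)
      exacts [⟨_, rfl⟩, ⟨_, rfl⟩]
  · rintro z ⟨⟨t, rfl⟩, ⟨t', ht'⟩⟩
    have h1 : γ (1 - t' / 2) = γ (t / 2) := ht'
    obtain ⟨n, hn⟩ := (h.inj _ _).1 h1
    have a1 := t.2.1; have a2 := t.2.2; have b1 := t'.2.1; have b2 := t'.2.2
    have h1 : (n:ℝ) ≤ 1 := by linarith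
    have h2 : (0:ℝ) ≤ n := by linarith
    have h1' : n ≤ 1 := by exact_mod_cast h1
    have h2' : 0 ≤ n := by exact_mod_cast h2
    show γ (t / 2) ∈ _
    have : n = 0 ∨ n = 1 := by omega
    rcases this with rfl | rfl
    · right
      have : (t:ℝ) = 1 := by push_cast at hn; linarith
      rw [this]; rfl
    · left
      have : (t:ℝ) = 0 := by push_cast at hn; linarith
      rw [this]; simp

theorem isPathConnected_range : IsPathConnected (range γ) := by
  rw [← image_univ]
  exact (convex_univ.isPathConnected univ_nonempty).image h.cont

theorem punctured (w : ℂ) : IsPreconnected (range γ \ {w}) := by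
  by_cases hw : w ∈ range γ
  · obtain ⟨s, rfl⟩ := hw
    have : range γ \ {γ s} = γ '' Ioo s (s + 1) := by
      ext z
      constructor
      · rintro ⟨hz, hz'⟩
        obtain ⟨u, h1, h2, rfl⟩ := h.exists_rep s hz
        refine ⟨u, ⟨lt_of_le_of_ne h1 ?_, h2⟩, rfl⟩
        rintro rfl; exact hz' rfl
      · rintro ⟨u, hu, rfl⟩
        refine ⟨⟨u, rfl⟩, fun h' => ?_⟩
        have := h.injOn (s := s) (t := u) hu.2 ⟨hu.1.le, le_rfl⟩ ⟨le_rfl, hu.1.le⟩ h'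
        linarith [hu.1]
    rw [this]
    exact isPreconnected_Ioo.image _ h.cont.continuousOn
  · rw [sdiff_singleton_eq_self hw]
    exact h.isPathConnected_range.isConnected.isPreconnected

theorem local_arcs {ε : ℝ} (hε : 0 < ε) : ∃ δ > 0, ∀ a ∈ range γ, ∃ A ⊆ range γ, IsCompact A ∧
    IsPreconnected A ∧ range γ ∩ closedBall a δ ⊆ A ∧ A ⊆ closedBall a ε := by
  have huc := (isCompact_Icc (a := (-2:ℝ)) (b := 3)).uniformContinuousOn_of_continuous
    h.cont.continuousOn
  obtain ⟨η', hη', hu⟩ := Metric.uniformContinuousOn_iff.1 huc ε hε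
  obtain ⟨η, hη0, hη1, hη2⟩ : ∃ η > 0, η < η' ∧ η < 1/4 :=
    ⟨min η' (1/4) / 2, by positivity, by
      have := min_le_left η' (1/4); have : 0 < min η' (1/4) := by positivity
      linarith, by
      have := min_le_right η' (1/4); have : 0 < min η' (1/4) := by positivity
      linarith⟩
  obtain ⟨⟨u0, v0⟩, ⟨hu0, hv0⟩, hmin⟩ :=
    ((isCompact_Icc (a := (0:ℝ)) (b := 1)).prod (isCompact_Icc (a := η) (b := 1 - η))).exists_isMinOn
    ⟨(0, η), ⟨by simp, by simp; linarith⟩⟩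
    (f := fun p : ℝ × ℝ => dist (γ p.1) (γ (p.1 + p.2))) (by have := h.cont; fun_prop)
  have hpos : 0 < dist (γ u0) (γ (u0 + v0)) := by
    rw [dist_pos]
    intro h'
    have := h.injOn (s := u0) (t := u0 + v0) (by have := hv0.2; simp at this; linarith) ⟨le_rfl, by
      have := hv0.1; simp at this; linarith⟩ ⟨by
      have := hv0.1; simp at this; linarith, le_rfl⟩ h'
    have := hv0.1; simp at this; linarith
  refine ⟨dist (γ u0) (γ (u0 + v0)) / 2, by linarith, ?_⟩
  intro a ha
  obtain ⟨u, h1, h2, rfl⟩ := h.exists_rep 0 ha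
  refine ⟨γ '' Icc (u - η) (u + η), image_subset_range _ _, h.arc_compact _ _,
    isPreconnected_Icc.image _ h.cont.continuousOn, ?_, ?_⟩
  · rintro z ⟨hz, hz'⟩
    obtain ⟨v, h3, h4, rfl⟩ := h.exists_rep (u - η) hz
    refine ⟨v, ⟨h3, ?_⟩, rfl⟩
    by_contra hcon
    push Not at hcon
    have := hmin (show (u, v - u) ∈ Icc (0:ℝ) 1 ×ˢ Icc η (1 - η) from
      ⟨⟨h1, by linarith⟩, ⟨by simp; linarith, by simp; linarith⟩⟩)
    simp only [add_sub_cancel, mem_ofPred_eq] at this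
    rw [mem_closedBall, dist_comm] at hz'
    linarith
  · rintro _ ⟨v, hv, rfl⟩
    rw [mem_closedBall]
    refine (hu v ⟨by linarith [hv.1], by linarith [hv.2]⟩ u ⟨by linarith, by linarith⟩ ?_).le
    rw [Real.dist_eq, abs_lt]
    exact ⟨by linarith [hv.1], by linarith [hv.2]⟩

end IsJ

/-- a bounded complementary domain of the Jordan curve -/
structure IsDom (γ : ℝ → ℂ) (D : Set ℂ) : Prop where
  op : IsOpen D
  pc : IsPathConnected D
  bdd : Bornology.IsBounded D
  disj : D ⊆ (range γ)ᶜ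
  comp : ∀ p ∈ D, ∀ q, JoinedIn (range γ)ᶜ p q → q ∈ D
  clo : closure D = D ∪ range γ

theorem IsJ.exists_dom {γ : ℝ → ℂ} (h : IsJ γ) : ∃ D, IsDom γ D := by
  obtain ⟨R, hR⟩ := h.compact.isBounded.subset_closedBall 0
  have hR' : range γ ⊆ closedBall 0 (max R 1) :=
    hR.trans (closedBall_subset_closedBall (le_max_left _ _))
  have hpc := (isPathConnected_compl_closedBall 0 (R := max R 1) (by positivity))
  obtain ⟨z0, hz0⟩ := hpc.nonempty
  have hz0J : z0 ∉ range γ := fun h' => hz0 (hR' h')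
  obtain ⟨p, hp, hpz⟩ : ∃ p ∈ (range γ)ᶜ, ¬ JoinedIn (range γ)ᶜ p z0 := by
    by_contra hcon
    push Not at hcon
    refine h.not_preconnected (IsPathConnected.isConnected ⟨z0, hz0J, fun {y} hy => ?_⟩).isPreconnected
    exact (hcon y hy).symm
  have hfar : ∀ z ∈ (closedBall (0:ℂ) (max R 1))ᶜ, ¬ JoinedIn (range γ)ᶜ p z := fun z hz hpz' =>
    hpz (hpz'.trans ((hpc.joinedIn z hz z0 hz0).mono (compl_subset_compl.2 hR')))
  have hop : IsOpen (pathComponentIn (range γ)ᶜ p) :=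
    h.compact.isClosed.isOpen_compl.pathComponentIn p
  have hcl := frontier_pathComponentIn h.compact.isClosed p
  refine ⟨pathComponentIn (range γ)ᶜ p, hop, isPathConnected_pathComponentIn hp, ?_,
    pathComponentIn_subset, ?_, subset_antisymm hcl ?_⟩
  · refine (isBounded_closedBall (x := (0:ℂ)) (r := max R 1)).subset ?_
    intro z hz
    by_contra hz'
    exact hfar z hz' hz
  · intro a ha b hab
    exact JoinedIn.trans ha hab
  · refine union_subset subset_closure ?_
    rintro _ ⟨s, rfl⟩
    by_contra hs
    have hnb := (isClosed_closure.isOpen_compl.preimage h.cont).mem_nhds hs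
    obtain ⟨δ', hδ', hb⟩ := Metric.mem_nhds_iff.1 hnb
    obtain ⟨δ, hδ, hδ1, hδ2⟩ : ∃ δ > 0, δ < δ' ∧ δ < 1/4 :=
      ⟨min δ' (1/4) / 2, by positivity, by
        have := min_le_left δ' (1/4); have : 0 < min δ' (1/4) := by positivity
        linarith, by
        have := min_le_right δ' (1/4); have : 0 < min δ' (1/4) := by positivity
        linarith⟩
    have hA : ∀ z ∈ range γ, z ∈ closure (pathComponentIn (range γ)ᶜ p) →
        z ∈ γ '' Icc (s + δ) (s + 1 - δ) := by
      intro z hz hz'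
      obtain ⟨u, h1, h2, rfl⟩ := h.exists_rep (s - δ) hz
      by_cases hu : u < s + δ
      · refine absurd hz' (hb ?_)
        rw [mem_ball, Real.dist_eq, abs_lt]
        exact ⟨by linarith, by linarith⟩
      · push Not at hu
        exact ⟨u, ⟨hu, by linarith⟩, rfl⟩
    have hsub : γ '' Icc (s + δ) (s + 1 - δ) ⊆ range γ := image_subset_range _ _
    have hj := h.arc_joined (s := s + δ) (t := s + 1 - δ) (by linarith) (fun h' => hp (hsub h'))
      (fun h' => hz0J (hsub h'))
    obtain ⟨z, hz1, hz2, hz3⟩ := crossingJ hop hj (mem_pathComponentIn_self hp) hpz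
    rcases hcl hz2 with h4 | h4
    · exact hz3 h4
    · exact hz1 (hA z h4 hz2)

namespace IsDom
variable {γ : ℝ → ℂ} {D : Set ℂ} (hD : IsDom γ D)
include hD

theorem mem_of_joined {p q : ℂ} (hp : p ∈ D) {K : Set ℂ} (h : JoinedIn (range γ ∪ K)ᶜ p q) :
    JoinedIn (D \ K) p q := by
  obtain ⟨α, hα⟩ := h
  refine ⟨α, fun t => ⟨hD.comp p hp _ ?_, fun h' => hα t (Or.inr h')⟩⟩
  have hsub : range α ⊆ (range γ)ᶜ := by
    rintro _ ⟨t, rfl⟩ h'; exact hα t (Or.inl h')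
  have : PathConnectedSpace unitInterval := isPathConnected_iff_pathConnectedSpace.1
    ((convex_Icc (0:ℝ) 1).isPathConnected ⟨0, by simp⟩)
  exact ((isPathConnected_range α.continuous).joinedIn p ⟨0, α.source⟩ _ ⟨t, rfl⟩).mono hsub

theorem joined_of_nearJ (h : IsJ γ) {K : Set ℂ} (hK : IsCompact K) (hKD : K ⊆ D) :
    ∃ δ > 0, ∀ p ∈ D, ∀ q ∈ D, p ∈ thickening δ (range γ) → q ∈ thickening δ (range γ) →
      JoinedIn (D \ K) p q := by
  obtain ⟨δ, hδ, hs⟩ := h.compact.exists_thickening_subset_open hK.isClosed.isOpen_compl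
    (fun z hz hzK => hD.disj (hKD hzK) hz)
  refine ⟨δ, hδ, fun p hp q hq hpt hqt => hD.mem_of_joined hp ?_⟩
  refine L4 h.compact hK ?_ ((hD.pc.joinedIn p hp q hq).mono hD.disj) ?_
  · have : range γ ∩ K = ∅ := by
      ext z; simp only [mem_inter_iff, mem_empty_iff_false, iff_false]
      rintro ⟨h1, h2⟩; exact hD.disj (hKD h2) h1
    rw [this]; exact isPreconnected_empty
  · have aux : ∀ p ∈ thickening δ (range γ), ∃ j ∈ range γ, JoinedIn Kᶜ p j := by
      intro p hp
      obtain ⟨j, hj, hpj⟩ := mem_thickening_iff.1 hp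
      refine ⟨j, hj, (((convex_ball j δ).isPathConnected ⟨j, mem_ball_self hδ⟩).joinedIn p hpj j
        (mem_ball_self hδ)).mono ?_⟩
      intro z hz
      exact hs (mem_thickening_iff.2 ⟨j, hj, hz⟩)
    obtain ⟨j, hj, h1⟩ := aux p hpt
    obtain ⟨j', hj', h2⟩ := aux q hqt
    refine (h1.trans ((h.isPathConnected_range.joinedIn j hj j' hj').mono ?_)).trans h2.symm
    exact (self_subset_thickening hδ _).trans hs

theorem log_compact (h : IsJ γ) {f : ℂ → ℂ} (hf : ContinuousOn f D) (hi : InjOn f D)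
    (hop : IsOpen (f '' D)) (hb : Bornology.IsBounded (f '' D)) {a : ℂ} (ha : a ∉ f '' D)
    {K : Set ℂ} (hK : IsCompact K) (hKD : K ⊆ D) : HasLog (fun z => f z - a) K := by
  obtain ⟨R, hR⟩ := hb.subset_ball 0
  have hR' : f '' D ⊆ ball 0 (max R 1) := hR.trans (ball_subset_ball (le_max_left _ _))
  set b : ℂ := ((max R 1 : ℝ) : ℂ) with hbdef
  have hbW : ∀ w ∈ ball (0:ℂ) (max R 1), w - b ≠ 0 := by
    intro w hw h'
    rw [sub_eq_zero.1 h', mem_ball, dist_zero_right, hbdef, norm_real, Real.norm_eq_abs] at hw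
    exact absurd (le_abs_self _) (not_le.2 hw)
  have hbn : b ∉ f '' D := fun h' => hbW b (hR' h') (sub_self b)
  have hfK : IsCompact (f '' K) := hK.image_of_continuousOn (hf.mono hKD)
  have hfKD : f '' K ⊆ f '' D := image_mono hKD
  obtain ⟨δ, hδ, hj⟩ := hD.joined_of_nearJ h hK hKD
  have claim : ∀ c d, c ∉ f '' D → d ∉ pathComponentIn (f '' K)ᶜ c →
      ∃ p ∈ D, p ∈ thickening δ (range γ) ∧ JoinedIn (f '' K)ᶜ c (f p) := by
    intro c d hc hd
    by_contra hcon
    push Not at hcon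
    set U := pathComponentIn (f '' K)ᶜ c with hU
    have hUo : IsOpen U := hfK.isClosed.isOpen_compl.pathComponentIn c
    have hcU : c ∈ U := mem_pathComponentIn_self (fun h' => hc (hfKD h'))
    obtain ⟨z, hz⟩ : (frontier U).Nonempty :=
      nonempty_frontier_iff.2 ⟨⟨c, hcU⟩, fun h' => hd (h' ▸ mem_univ d)⟩
    rw [hUo.frontier_eq] at hz
    have hzK : z ∈ f '' K :=
      (frontier_pathComponentIn hfK.isClosed c hz.1).resolve_left hz.2
    obtain ⟨w, hw1, hw2⟩ := mem_closure_iff.1 hz.1 (f '' D) hop (hfKD hzK)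
    have hK' : IsCompact (closure D ∩ (thickening δ (range γ))ᶜ) :=
      (hD.bdd.isCompact_closure).inter_right isOpen_thickening.isClosed_compl
    have hK'D : closure D ∩ (thickening δ (range γ))ᶜ ⊆ D := by
      rintro z ⟨h1, h2⟩
      rw [hD.clo] at h1
      exact h1.resolve_right fun h' => h2 (self_subset_thickening hδ _ h')
    have hfK' := hK'.image_of_continuousOn (hf.mono hK'D)
    have hin : ∀ w ∈ U, w ∈ f '' D → w ∈ f '' (closure D ∩ (thickening δ (range γ))ᶜ) := by
      rintro _ hw ⟨p, hp, rfl⟩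
      refine ⟨p, ⟨subset_closure hp, fun h' => hcon p hp h' hw⟩, rfl⟩
    have hconn : IsPreconnected U :=
      (isPathConnected_pathComponentIn (F := (f '' K)ᶜ) (x := c)
        (fun h' => hc (hfKD h'))).isConnected.isPreconnected
    obtain ⟨y, hy1, hy2, hy3⟩ := crossing hconn hop hw2 hw1 hcU hc
    obtain ⟨y', hy1', hy2'⟩ := mem_closure_iff.1 hy2 (U ∩ (f '' (closure D ∩ (thickening δ (range γ))ᶜ))ᶜ)
      (hUo.inter hfK'.isClosed.isOpen_compl) ⟨hy1, fun h' => hy3 (image_mono hK'D h')⟩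
    exact hy1'.2 (hin y' hy1'.1 hy2')
  have hjab : JoinedIn (f '' K)ᶜ a b := by
    by_contra hn
    obtain ⟨p, hp1, hp2, hp3⟩ := claim a b ha hn
    obtain ⟨q, hq1, hq2, hq3⟩ := claim b a hbn (fun h' => hn h'.symm)
    have h1 := hj p hp1 q hq1 hp2 hq2
    have h2 := h1.map_continuousOn (hf.mono sdiff_subset)
    refine hn ((hp3.trans (h2.mono ?_)).trans hq3.symm)
    rintro _ ⟨z, hz, rfl⟩ ⟨z', hz', he⟩
    exact hz.2 (hi (hKD hz') hz.1 he ▸ hz')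
  have h1 := hasLog_of_joined hjab
  have h2 := hasLog_convex (convex_ball (0:ℂ) (max R 1)) (f := fun w => w - b) (by fun_prop) hbW
  refine ((h1.mul (h2.mono (hfKD.trans hR'))).comp (hf.mono hKD) (mapsTo_image _ _)).congr ?_
  intro z hz
  exact div_mul_cancel₀ _ (hbW _ (hR' (hfKD ⟨z, hz, rfl⟩)))

/-- L8 -/
theorem log_global (h : IsJ γ) {f : ℂ → ℂ} (hf : ContinuousOn f D) (hi : InjOn f D)
    (hop : IsOpen (f '' D)) (hb : Bornology.IsBounded (f '' D)) {a : ℂ} (ha : a ∉ f '' D) :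
    HasLog (fun z => f z - a) D := by
  classical
  have : PathConnectedSpace D := isPathConnected_iff_pathConnectedSpace.1 hD.pc
  have : LocallyPathConnectedSpace D := hD.op.locallyPathConnectedSpace
  obtain ⟨p0, hp0⟩ := hD.pc.nonempty
  have hne : ∀ z ∈ D, f z - a ≠ 0 := fun z hz h' => ha ⟨z, hz, sub_eq_zero.1 h'⟩
  let F : C(D, {z : ℂ // z ≠ 0}) := ⟨fun z => ⟨f z - a, hne z z.2⟩, by
    refine Continuous.subtype_mk ?_ _
    exact (hf.domRestrict).sub continuous_const⟩
  have he : (⟨exp (log (f p0 - a)), exp_ne_zero _⟩ : {z : ℂ // z ≠ 0}) = F ⟨p0, hp0⟩ :=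
    Subtype.ext (exp_log (hne p0 hp0))
  obtain ⟨L, ⟨_, hL⟩, _⟩ := isCoveringMap_exp.isLocalHomeomorph.existsUnique_continuousMap_lifts F
    ⟨p0, hp0⟩ (log (f p0 - a)) he (by
      intro α hα
      simpa [and_comm] using isCoveringMap_exp.exists_path_lifts (F.comp α) (log (f p0 - a))
        (by simp only [ContinuousMap.comp_apply, hα]; exact he.symm)) (by
      intro α α' Γ Γ' h0 h0' e0 e0' l l' h1
      have hKc : IsCompact (range (fun t => (α t : ℂ)) ∪ range (fun t => (α' t : ℂ))) :=
        (isCompact_range (by fun_prop)).union (isCompact_range (by fun_prop))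
      obtain ⟨g, hg, hgf⟩ := hD.log_compact h hf hi hop hb ha hKc (by
        rintro _ (⟨t, rfl⟩ | ⟨t, rfl⟩)
        exacts [(α t).2, (α' t).2])
      have aux : ∀ (α : C(unitInterval, D)) (Γ : C(unitInterval, ℂ)),
          (∀ t, (α t : ℂ) ∈ range (fun t => (α t : ℂ))) → ContinuousOn g (range (fun t => (α t : ℂ))) →
          (∀ x ∈ range (fun t => (α t : ℂ)), exp (g x) = f x - a) → 
          α 0 = ⟨p0, hp0⟩ → Γ 0 = log (f p0 - a) →
          (fun z : ℂ => (⟨exp z, exp_ne_zero z⟩ : {z : ℂ // z ≠ 0})) ∘ Γ = F.comp α →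
          Γ 1 = g (α 1) + (log (f p0 - a) - g p0) := by
        intro α Γ hm hg hgf h0 e0 l
        have hl : ∀ t, exp (Γ t) = f (α t) - a := fun t => congrArg Subtype.val (congrFun l t)
        have hc : Continuous fun t => g (α t) :=
          hg.comp_continuous (by fun_prop) hm
        refine exp_unique (S := (univ : Set unitInterval)) isPreconnected_univ
          (g := fun t => Γ t) (h := fun t => g (α t) + (log (f p0 - a) - g p0))
          (by fun_prop) (hc.add continuous_const).continuousOn ?_ (mem_univ 0) ?_ 1 (mem_univ 1)
        · intro t _
          have := hgf _ (hm 0)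
          simp only [h0] at this
          rw [exp_add, exp_sub, exp_log (hne p0 hp0), this, div_self (hne p0 hp0), mul_one, hl,
            hgf _ (hm t)]
        · simp only [h0, e0]; ring
      rw [aux α Γ (fun t => ⟨t, rfl⟩) (hg.mono subset_union_left)
          (fun x hx => hgf x (Or.inl hx)) h0 e0 l,
        aux α' Γ' (fun t => ⟨t, rfl⟩) (hg.mono subset_union_right)
          (fun x hx => hgf x (Or.inr hx)) h0' e0' l', h1])
  refine ⟨fun z => if hz : z ∈ D then L ⟨z, hz⟩ else 0, ?_, ?_⟩
  · rw [continuousOn_iff_continuous_domRestrict]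
    have : Continuous fun x : D => L x := by fun_prop
    convert this using 1
    ext x
    simp
  · intro x hx
    beta_reduce
    rw [dif_pos hx]
    exact congrArg Subtype.val (congrFun hL ⟨x, hx⟩)

end IsDom

end FI

namespace FI
open Set Complex Metric Topology Filter

theorem isOpen_image_of_deriv {U : Set ℂ} (hU : IsOpen U) {f : ℂ → ℂ} (hf : DifferentiableOn ℂ f U)
    (h0 : ∀ z ∈ U, deriv f z ≠ 0) : IsOpen (f '' U) := by
  rw [isOpen_iff_mem_nhds]
  rintro _ ⟨z, hz, rfl⟩
  have h1 := ((hf.analyticAt (hU.mem_nhds hz)).hasStrictDerivAt).map_nhds_eq (h0 z hz)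
  rw [← h1]
  exact image_mem_map (hU.mem_nhds hz)

theorem hurwitz {ι : Type*} {l : Filter ι} [l.NeBot] {U : Set ℂ} (hU : IsOpen U) {F : ι → ℂ → ℂ}
    {f : ℂ → ℂ} (hF : TendstoLocallyUniformlyOn F f l U) (hd : ∀ n, DifferentiableOn ℂ (F n) U)
    (h0 : ∀ n, ∀ z ∈ U, F n z ≠ 0) {z0 : ℂ} (hz0 : z0 ∈ U) (hf0 : f z0 = 0) :
    f =ᶠ[𝓝 z0] 0 := by
  have hfd := hF.differentiableOn (Eventually.of_forall hd) hU
  rcases (hfd.analyticAt (hU.mem_nhds hz0)).eventually_eq_zero_or_eventually_ne_zero with h | h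
  · exact h
  exfalso
  rw [eventually_nhdsWithin_iff] at h
  obtain ⟨ρ', hρ', hb⟩ := Metric.mem_nhds_iff.1 (Filter.inter_mem (hU.mem_nhds hz0) h)
  obtain ⟨ρ, hρ, hρ2⟩ := exists_between hρ'
  have hsub : closedBall z0 ρ ⊆ U := fun z hz => (hb (closedBall_subset_ball hρ2 hz)).1
  obtain ⟨w, hw, hmin⟩ := (isCompact_sphere z0 ρ).exists_isMinOn
    (NormedSpace.sphere_nonempty.2 hρ.le) (f := fun z => ‖f z‖)
    ((hfd.continuousOn.mono (sphere_subset_closedBall.trans hsub)).norm)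
  have hm : 0 < ‖f w‖ := by
    rw [norm_pos_iff]
    refine (hb (closedBall_subset_ball hρ2 (sphere_subset_closedBall hw))).2 ?_
    rintro rfl
    rw [mem_sphere, dist_self] at hw; exact hρ.ne hw
  have hun := (tendstoLocallyUniformlyOn_iff_forall_isCompact hU).1 hF _ hsub
    (isCompact_closedBall z0 ρ)
  obtain ⟨n, hn⟩ := ((Metric.tendstoUniformlyOn_iff.1 hun) (‖f w‖ / 2) (by linarith)).exists
  have hb1 : ∀ z ∈ frontier (ball z0 ρ), ‖(F n z)⁻¹‖ ≤ (‖f w‖ / 2)⁻¹ := by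
    intro z hz
    rw [frontier_ball z0 hρ.ne'] at hz
    rw [norm_inv]
    refine inv_anti₀ (by linarith) ?_
    have h1 := hn z (sphere_subset_closedBall hz)
    have h2 : ‖f w‖ ≤ ‖f z‖ := hmin hz
    rw [dist_eq_norm] at h1
    have := norm_sub_norm_le (f z) (F n z)
    linarith
  have hdc : DiffContOnCl ℂ (fun z => (F n z)⁻¹) (ball z0 ρ) := by
    refine DifferentiableOn.diffContOnCl ?_
    rw [closure_ball z0 hρ.ne']
    exact ((hd n).mono hsub).inv fun z hz => h0 n z (hsub hz)
  have h3 := norm_le_of_forall_mem_frontier_norm_le isBounded_ball hdc hb1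
    (subset_closure (mem_ball_self hρ))
  rw [norm_inv] at h3
  have h4 := hn z0 (mem_closedBall_self hρ.le)
  rw [hf0, dist_zero_left] at h4
  have h5 : 0 < ‖F n z0‖ := norm_pos_iff.2 (h0 n z0 hz0)
  rw [inv_le_inv₀ h5 (by linarith)] at h3
  linarith

/-- disc automorphism -/
noncomputable def mob (a w : ℂ) : ℂ := (w - a) / (1 - (starRingEnd ℂ) a * w)

theorem mob_den {a w : ℂ} (ha : ‖a‖ < 1) (hw : ‖w‖ < 1) : 1 - (starRingEnd ℂ) a * w ≠ 0 := by
  intro h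
  have h1 : (starRingEnd ℂ) a * w = 1 := by linear_combination -h
  have h2 : ‖a‖ * ‖w‖ = 1 := by
    rw [← norm_conj a, ← norm_mul, h1, norm_one]
  nlinarith [norm_nonneg a, norm_nonneg w]

theorem mob_lt {a w : ℂ} (ha : ‖a‖ < 1) (hw : ‖w‖ < 1) : ‖mob a w‖ < 1 := by
  rw [mob, norm_div, div_lt_one (norm_pos_iff.2 (mob_den ha hw))]
  refine lt_of_pow_lt_pow_left₀ 2 (norm_nonneg _) ?_
  have ha2 : ‖a‖ ^ 2 < 1 := by nlinarith [norm_nonneg a]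
  have hw2 : ‖w‖ ^ 2 < 1 := by nlinarith [norm_nonneg w]
  rw [← normSq_eq_norm_sq, normSq_apply] at *
  rw [← normSq_eq_norm_sq, normSq_apply] at *
  simp at *
  nlinarith [mul_pos (sub_pos.2 ha2) (sub_pos.2 hw2)]

theorem mob_deriv {a w : ℂ} (ha : ‖a‖ < 1) (hw : ‖w‖ < 1) :
    HasDerivAt (mob a) ((1 - ‖a‖ ^ 2 : ℝ) / (1 - (starRingEnd ℂ) a * w) ^ 2) w := by
  have h1 : HasDerivAt (fun w : ℂ => w - a) 1 w := (hasDerivAt_id w).sub_const a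
  have h2 : HasDerivAt (fun w : ℂ => 1 - (starRingEnd ℂ) a * w) (-((starRingEnd ℂ) a * 1)) w :=
    ((hasDerivAt_id w).const_mul _).const_sub 1
  refine (h1.div h2 (mob_den ha hw)).congr_deriv ?_
  congr 1
  have : ((1 - ‖a‖ ^ 2 : ℝ) : ℂ) = 1 - a * (starRingEnd ℂ) a := by
    rw [mul_conj, normSq_eq_norm_sq]; push_cast; ring
  rw [this]; ring

theorem mob_inj {a w w' : ℂ} (ha : ‖a‖ < 1) (hw : ‖w‖ < 1) (hw' : ‖w'‖ < 1)
    (h : mob a w = mob a w') : w = w' := by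
  rw [mob, mob, div_eq_div_iff (mob_den ha hw) (mob_den ha hw')] at h
  have h1 : (w - w') * ((1 - ‖a‖ ^ 2 : ℝ) : ℂ) = 0 := by
    have : ((1 - ‖a‖ ^ 2 : ℝ) : ℂ) = 1 - a * (starRingEnd ℂ) a := by
      rw [mul_conj, normSq_eq_norm_sq]; push_cast; ring
    rw [this]; linear_combination h
  have h2 : (1 - ‖a‖ ^ 2 : ℝ) ≠ 0 := by nlinarith [norm_nonneg a]
  rcases mul_eq_zero.1 h1 with h3 | h3
  · exact sub_eq_zero.1 h3
  · exact absurd (ofReal_eq_zero.1 h3) h2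

theorem sqrt_deriv {f s : ℂ → ℂ} {z f' : ℂ} (hs : ContinuousAt s z) (hf : HasDerivAt f f' z)
    (h0 : s z ≠ 0) (h : ∀ᶠ w in 𝓝 z, s w ^ 2 = f w) : HasDerivAt s (f' / (2 * s z)) z := by
  rw [hasDerivAt_iff_tendsto_slope] at hf ⊢
  have h1 : Tendsto (fun w => s w + s z) (𝓝[≠] z) (𝓝 (2 * s z)) := by
    have : Tendsto (fun w => s w + s z) (𝓝 z) (𝓝 (s z + s z)) := hs.add tendsto_const_nhds
    rw [two_mul]
    exact this.mono_left nhdsWithin_le_nhds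
  have h2 := hf.div h1 (mul_ne_zero two_ne_zero h0)
  refine h2.congr' ?_
  have h3 : ∀ᶠ w in 𝓝[≠] z, s w + s z ≠ 0 := h1.eventually_ne (mul_ne_zero two_ne_zero h0)
  filter_upwards [h3, h.filter_mono nhdsWithin_le_nhds, self_mem_nhdsWithin] with w hw hw' hne
  have hne' : w - z ≠ 0 := sub_ne_zero.2 hne
  simp only [Pi.div_apply, slope_def_field]
  rw [← hw', ← h.self_of_nhds]
  field_simp
  ring

/-- domains suited to the Riemann mapping theorem -/
structure RD (D : Set ℂ) : Prop where
  op : IsOpen D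
  conn : IsPreconnected D
  bdd : Bornology.IsBounded D
  log : ∀ (f : ℂ → ℂ) (a : ℂ), DifferentiableOn ℂ f D → InjOn f D → (∀ z ∈ D, deriv f z ≠ 0) →
    MapsTo f D (ball 0 1) → a ∉ f '' D → HasLog (fun z => f z - a) D

/-- the competing family -/
structure Fam (D : Set ℂ) (p : ℂ) (f : ℂ → ℂ) : Prop where
  diff : DifferentiableOn ℂ f D
  inj : InjOn f D
  der : ∀ z ∈ D, deriv f z ≠ 0
  maps : MapsTo f D (ball 0 1)
  zero : f p = 0

theorem Fam.exists {D : Set ℂ} (hD : RD D) (p : ℂ) (hp : p ∈ D) : ∃ f, Fam D p f := by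
  obtain ⟨R, hR⟩ := hD.bdd.subset_ball p
  have hR0 : 0 < R := by
    have := hR hp; simpa using this
  have hRc : (R : ℂ) ≠ 0 := by exact_mod_cast hR0.ne'
  have hd : ∀ z, HasDerivAt (fun z => (z - p) / (R:ℂ)) (1 / R) z := fun z =>
    ((hasDerivAt_id z).sub_const p).div_const _
  refine ⟨fun z => (z - p) / R, fun z _ => (hd z).differentiableAt.differentiableWithinAt, ?_, ?_, ?_,
    by simp⟩
  · intro z _ w _ h
    simpa [hRc] using h
  · intro z _
    rw [(hd z).deriv]; simp [hRc]
  · intro z hz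
    have := hR hz
    rw [mem_ball, dist_eq_norm] at this
    rw [mem_ball, dist_zero_right, norm_div, norm_real, Real.norm_eq_abs, abs_of_pos hR0,
      div_lt_one hR0]
    exact this

theorem Fam.improve {D : Set ℂ} (hD : RD D) {p : ℂ} (hp : p ∈ D) {f : ℂ → ℂ} (hf : Fam D p f)
    {a : ℂ} (ha : ‖a‖ < 1) (haf : a ∉ f '' D) : ∃ g, Fam D p g ∧ ‖deriv f p‖ < ‖deriv g p‖ := by
  have hfb : ∀ z ∈ D, ‖f z‖ < 1 := fun z hz => by simpa using hf.maps hz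
  have hfd : ∀ z ∈ D, HasDerivAt f (deriv f z) z := fun z hz =>
    (hf.diff.differentiableAt (hD.op.mem_nhds hz)).hasDerivAt
  have hf1d : ∀ z ∈ D, HasDerivAt (fun z => mob a (f z))
      ((1 - ‖a‖ ^ 2 : ℝ) / (1 - (starRingEnd ℂ) a * f z) ^ 2 * deriv f z) z := fun z hz =>
    (mob_deriv ha (hfb z hz)).comp z (hfd z hz)
  have hapos : (0:ℝ) < 1 - ‖a‖ ^ 2 := by nlinarith [norm_nonneg a]
  have hmobne : ∀ {c w : ℂ}, ‖c‖ < 1 → ‖w‖ < 1 →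
      ((1 - ‖c‖ ^ 2 : ℝ) / (1 - (starRingEnd ℂ) c * w) ^ 2 : ℂ) ≠ 0 := by
    intro c w hc hw
    refine div_ne_zero ?_ (pow_ne_zero 2 (mob_den hc hw))
    have : (0:ℝ) < 1 - ‖c‖ ^ 2 := by nlinarith [norm_nonneg c]
    exact_mod_cast this.ne'
  have hf1ne : ∀ z ∈ D, mob a (f z) ≠ 0 := by
    intro z hz h'
    rw [mob, div_eq_zero_iff] at h'
    rcases h' with h' | h'
    · exact haf ⟨z, hz, sub_eq_zero.1 h'⟩
    · exact mob_den ha (hfb z hz) h'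
  have hf1i : InjOn (fun z => mob a (f z)) D := fun z hz w hw h =>
    hf.inj hz hw (mob_inj ha (hfb z hz) (hfb w hw) h)
  obtain ⟨L, hL, hLf⟩ := hD.log (fun z => mob a (f z)) 0
    (fun z hz => (hf1d z hz).differentiableAt.differentiableWithinAt) hf1i
    (fun z hz => by rw [(hf1d z hz).deriv]; exact mul_ne_zero (hmobne ha (hfb z hz)) (hf.der z hz))
    (fun z hz => by simpa using mob_lt ha (hfb z hz))
    (by rintro ⟨z, hz, h'⟩; exact hf1ne z hz h')
  set s : ℂ → ℂ := fun z => exp (L z / 2) with hs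
  have hs2 : ∀ z ∈ D, s z ^ 2 = mob a (f z) := by
    intro z hz
    have := hLf z hz
    simp only [sub_zero] at this
    rw [hs, ← this, ← exp_nat_mul]; congr 1; push_cast; ring
  have hsne : ∀ z, s z ≠ 0 := fun z => exp_ne_zero _
  have hsc : ContinuousOn s D := by
    have : ContinuousOn (fun z => L z / 2) D := hL.div_const 2
    exact continuous_exp.comp_continuousOn this
  have hsd : ∀ z ∈ D, HasDerivAt s
      ((1 - ‖a‖ ^ 2 : ℝ) / (1 - (starRingEnd ℂ) a * f z) ^ 2 * deriv f z / (2 * s z)) z := fun z hz =>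
    sqrt_deriv (hsc.continuousAt (hD.op.mem_nhds hz)) (hf1d z hz) (hsne z)
      (by filter_upwards [hD.op.mem_nhds hz] with w hw using hs2 w hw)
  have hsb : ∀ z ∈ D, ‖s z‖ < 1 := by
    intro z hz
    have h1 : ‖s z‖ ^ 2 < 1 := by
      rw [← norm_pow, hs2 z hz]; exact mob_lt ha (hfb z hz)
    nlinarith [norm_nonneg (s z)]
  have hb := hsb p hp
  have hFd : ∀ z ∈ D, HasDerivAt (fun z => mob (s p) (s z))
      ((1 - ‖s p‖ ^ 2 : ℝ) / (1 - (starRingEnd ℂ) (s p) * s z) ^ 2 * ((1 - ‖a‖ ^ 2 : ℝ) /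
        (1 - (starRingEnd ℂ) a * f z) ^ 2 * deriv f z / (2 * s z))) z := fun z hz =>
    (mob_deriv hb (hsb z hz)).comp z (hsd z hz)
  refine ⟨fun z => mob (s p) (s z), ⟨fun z hz => (hFd z hz).differentiableAt.differentiableWithinAt,
    ?_, ?_, ?_, ?_⟩, ?_⟩
  · intro z hz w hw h
    have h1 := mob_inj hb (hsb z hz) (hsb w hw) h
    refine hf1i hz hw ?_
    show mob a (f z) = mob a (f w)
    rw [← hs2 z hz, ← hs2 w hw, h1]
  · intro z hz
    rw [(hFd z hz).deriv]
    exact mul_ne_zero (hmobne hb (hsb z hz)) (div_ne_zero (mul_ne_zero (hmobne ha (hfb z hz))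
      (hf.der z hz)) (mul_ne_zero two_ne_zero (hsne z)))
  · intro z hz
    simpa using mob_lt hb (hsb z hz)
  · simp [mob]
  · rw [(hFd p hp).deriv, hf.zero]
    have ht : ‖s p‖ ^ 2 = ‖a‖ := by
      rw [← norm_pow, hs2 p hp, hf.zero]; simp [mob]
    have h1 : (starRingEnd ℂ) (s p) * s p = ((‖s p‖ ^ 2 : ℝ) : ℂ) := by
      rw [mul_comm, mul_conj, normSq_eq_norm_sq]
    rw [h1]
    set t := ‖s p‖ with htdef
    have ht0 : 0 < t := norm_pos_iff.2 (hsne p)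
    have hpos : 0 < ‖deriv f p‖ := norm_pos_iff.2 (hf.der p hp)
    have h2 : (1 : ℂ) - ((t ^ 2 : ℝ) : ℂ) = ((1 - t ^ 2 : ℝ) : ℂ) := by push_cast; ring
    have ht1 : 0 < 1 - t ^ 2 := by nlinarith
    rw [h2, ← ht]
    simp only [norm_mul, norm_div, norm_pow, norm_real, Real.norm_eq_abs, mul_zero, sub_zero, norm_one,
      one_pow, div_one, Complex.norm_ofNat, abs_of_pos ht1]
    rw [abs_of_pos (by nlinarith : 0 < 1 - (t ^ 2) ^ 2), ← htdef]
    have h3 : (1 - t ^ 2) / (1 - t ^ 2) ^ 2 * ((1 - (t ^ 2) ^ 2) * ‖deriv f p‖ / (2 * t)) =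
        ((1 + t ^ 2) / (2 * t)) * ‖deriv f p‖ := by
      field_simp
      ring
    rw [h3]
    have h4 : 1 < (1 + t ^ 2) / (2 * t) := by
      rw [lt_div_iff₀ (by linarith)]; nlinarith [sq_pos_of_pos (sub_pos.2 hb)]
    nlinarith

theorem Fam.lip {D : Set ℂ} {p : ℂ} {f : ℂ → ℂ} (hf : Fam D p f) {c : ℂ} {R : ℝ}
    (hb : ball c R ⊆ D) {z : ℂ} (hz : z ∈ ball c R) : dist (f z) (f c) ≤ 2 / R * dist z c := by
  refine dist_le_div_mul_dist_of_mapsTo_ball (hf.diff.mono hb) ?_ hz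
  intro w hw
  have h1 := hf.maps (hb hw)
  have h2 := hf.maps (hb (mem_ball_self (nonempty_ball.1 ⟨z, hz⟩)))
  rw [mem_closedBall]
  rw [mem_ball] at h1 h2
  have := dist_triangle_right (f w) (f c) 0
  linarith

theorem Fam.exists_max {D : Set ℂ} (hD : RD D) {p : ℂ} (hp : p ∈ D) :
    ∃ f, Fam D p f ∧ ∀ g, Fam D p g → ‖deriv g p‖ ≤ ‖deriv f p‖ := by
  obtain ⟨r, hr, hrD⟩ := Metric.isOpen_iff.1 hD.op p hp
  let S : Set ℝ := {x | ∃ g, Fam D p g ∧ x = ‖deriv g p‖}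
  have hne : S.Nonempty := by
    obtain ⟨f, hf⟩ := Fam.exists hD p hp
    exact ⟨_, f, hf, rfl⟩
  have hbd : BddAbove S := by
    refine ⟨2 / r, ?_⟩
    rintro _ ⟨g, hg, rfl⟩
    refine norm_deriv_le_div_of_mapsTo_ball (hg.diff.mono hrD) ?_ hr
    intro w hw
    have h1 := hg.maps (hrD hw)
    rw [hg.zero]
    exact ball_subset_closedBall (ball_subset_ball (by norm_num) h1)
  obtain ⟨u, -, hu, huS⟩ := exists_seq_tendsto_sSup hne hbd
  choose F hF hFu using huS
  let l : Ultrafilter ℕ := Filter.hyperfilter ℕ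
  have hll : (l : Filter ℕ) ≤ atTop := by
    rw [← Nat.cofinite_eq_atTop]; exact Filter.hyperfilter_le_cofinite
  have hlim : ∀ z, ∃ w, z ∈ D → Tendsto (fun n => F n z) l (𝓝 w) := by
    intro z
    by_cases hz : z ∈ D
    · have h1 : ((l.map fun n => F n z : Ultrafilter ℂ) : Filter ℂ) ≤ 𝓟 (closedBall 0 1) := by
        rw [le_principal_iff]
        exact Eventually.of_forall (f := (l : Filter ℕ)) fun n => ball_subset_closedBall ((hF n).maps hz)
      obtain ⟨w, _, hw⟩ := (isCompact_closedBall (0:ℂ) 1).ultrafilter_le_nhds _ h1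
      exact ⟨w, fun _ => hw⟩
    · exact ⟨0, fun h => absurd h hz⟩
  choose f hf using hlim
  have hunif : TendstoLocallyUniformlyOn F f l D := by
    rw [Metric.tendstoLocallyUniformlyOn_iff]
    intro ε hε z hz
    obtain ⟨R, hR, hRD⟩ := Metric.isOpen_iff.1 hD.op z hz
    have hδ : 0 < min R (ε * R / 8) := by positivity
    refine ⟨ball z (min R (ε * R / 8)), mem_nhdsWithin_of_mem_nhds (ball_mem_nhds z hδ), ?_⟩
    have key : ∀ n, ∀ y ∈ ball z (min R (ε * R / 8)), dist (F n y) (F n z) ≤ ε / 4 := by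
      intro n y hy
      have hy1 := ball_subset_ball (min_le_left _ _) hy
      have hy2 := ball_subset_ball (min_le_right _ _) hy
      refine ((hF n).lip hRD hy1).trans ?_
      rw [mem_ball] at hy2
      rw [div_mul_eq_mul_div, div_le_iff₀ hR]
      linarith
    have key' : ∀ y ∈ ball z (min R (ε * R / 8)), dist (f y) (f z) ≤ ε / 4 := by
      intro y hy
      have hyD : y ∈ D := hRD (ball_subset_ball (min_le_left _ _) hy)
      exact le_of_tendsto ((hf y hyD).dist (hf z hz)) (Eventually.of_forall fun n => key n y hy)
    filter_upwards [(Metric.tendsto_nhds.1 (hf z hz)) (ε / 4) (by linarith)] with n hn y hy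
    have h1 := key n y hy
    have h2 := key' y hy
    have h3 := dist_triangle4 (f y) (f z) (F n z) (F n y)
    rw [dist_comm] at hn
    rw [dist_comm] at h1
    linarith
  have hFd : ∀ n, DifferentiableOn ℂ (F n) D := fun n => (hF n).diff
  have hfd := hunif.differentiableOn (Eventually.of_forall hFd) hD.op
  have hder := hunif.deriv (Eventually.of_forall hFd) hD.op
  have hsup : ‖deriv f p‖ = sSup S := by
    have h1 : Tendsto (fun n => ‖deriv (F n) p‖) l (𝓝 ‖deriv f p‖) :=
      (hder.tendsto_at hp).norm
    have h2 : Tendsto (fun n => ‖deriv (F n) p‖) l (𝓝 (sSup S)) := by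
      have := hu.mono_left hll
      exact this.congr hFu
    exact tendsto_nhds_unique h1 h2
  have hpos : deriv f p ≠ 0 := by
    rw [← norm_pos_iff, hsup]
    obtain ⟨g, hg⟩ := Fam.exists hD p hp
    exact lt_of_lt_of_le (norm_pos_iff.2 (hg.der p hp)) (le_csSup hbd ⟨g, hg, rfl⟩)
  have hnc : ∀ z0 ∈ D, ∀ c, ¬ (fun z => f z - c) =ᶠ[𝓝 z0] 0 := by
    intro z0 hz0 c h'
    have hz := ((hfd.sub_const c).analyticOnNhd hD.op).eqOn_zero_of_preconnected_of_eventuallyEq_zero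
      hD.conn hz0 h'
    apply hpos
    have : f =ᶠ[𝓝 p] fun _ => c := by
      filter_upwards [hD.op.mem_nhds hp] with w hw
      exact sub_eq_zero.1 (hz hw)
    rw [this.deriv_eq]; simp
  have hder0 : ∀ z ∈ D, deriv f z ≠ 0 := by
    intro z hz h0
    have h1 := hurwitz hD.op hder (fun n => (hFd n).deriv hD.op) (fun n z hz => (hF n).der z hz) hz h0
    have h2 := ((hfd.deriv hD.op).analyticOnNhd hD.op).eqOn_zero_of_preconnected_of_eventuallyEq_zero
      hD.conn hz h1
    exact hpos (h2 hp)
  refine ⟨f, ⟨hfd, ?_, hder0, ?_, ?_⟩, ?_⟩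
  · intro z1 hz1 z2 hz2 h12
    by_contra hne
    have hU : IsOpen (D \ {z1}) := hD.op.sdiff isClosed_singleton
    have hz2' : z2 ∈ D \ {z1} := ⟨hz2, fun h => hne h.symm⟩
    have hT : TendstoLocallyUniformlyOn (fun n z => F n z - F n z1) (fun z => f z - f z1) l
        (D \ {z1}) := by
      have h1 := hunif.mono (sdiff_subset (t := {z1}))
      have h2 : TendstoLocallyUniformlyOn (fun n (_ : ℂ) => F n z1) (fun _ => f z1) l (D \ {z1}) := by
        refine TendstoUniformlyOn.tendstoLocallyUniformlyOn ?_
        rw [Metric.tendstoUniformlyOn_iff]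
        intro ε hε
        filter_upwards [(Metric.tendsto_nhds.1 (hf z1 hz1)) ε hε] with n hn x _
        rw [dist_comm]; exact hn
      exact h1.sub h2
    refine hnc z2 hz2 (f z1) (hurwitz hU hT (fun n => ((hFd n).mono sdiff_subset).sub_const _) ?_ hz2' ?_)
    · intro n z hz h'
      exact hz.2 ((hF n).inj hz.1 hz1 (sub_eq_zero.1 h'))
    · show f z2 - f z1 = 0
      rw [h12, sub_self]
  · have hop := isOpen_image_of_deriv hD.op hfd hder0
    have hsub : f '' D ⊆ closedBall 0 1 := by
      rintro _ ⟨z, hz, rfl⟩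
      exact isClosed_closedBall.mem_of_tendsto (hf z hz)
        (Eventually.of_forall fun n => ball_subset_closedBall ((hF n).maps hz))
    have := interior_maximal hsub hop
    rw [interior_closedBall (0:ℂ) one_ne_zero] at this
    exact fun z hz => this ⟨z, hz, rfl⟩
  · refine tendsto_nhds_unique (hf p hp) ?_
    simp only [(hF _).zero]
    exact tendsto_const_nhds
  · intro g hg
    rw [hsup]
    exact le_csSup hbd ⟨g, hg, rfl⟩

/-- Riemann mapping theorem -/
theorem RD.riemann {D : Set ℂ} (hD : RD D) (hne : D.Nonempty) : ∃ f g : ℂ → ℂ,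
    ContinuousOn f D ∧ MapsTo f D (ball 0 1) ∧ DifferentiableOn ℂ g (ball 0 1) ∧
    MapsTo g (ball 0 1) D ∧ (∀ z ∈ D, g (f z) = z) ∧ ∀ w ∈ ball (0:ℂ) 1, f (g w) = w := by
  obtain ⟨p, hp⟩ := hne
  obtain ⟨f, hf, hmax⟩ := Fam.exists_max hD hp
  have hsurj : ∀ a ∈ ball (0:ℂ) 1, a ∈ f '' D := by
    intro a ha
    by_contra hn
    obtain ⟨g, hg, hlt⟩ := hf.improve hD hp (by simpa using ha) hn
    exact absurd (hmax g hg) (not_le.2 hlt)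
  have hgm : ∀ w ∈ ball (0:ℂ) 1, Function.invFunOn f D w ∈ D := fun w hw =>
    Function.invFunOn_mem (hsurj w hw)
  have hfg : ∀ w ∈ ball (0:ℂ) 1, f (Function.invFunOn f D w) = w := fun w hw =>
    Function.invFunOn_eq (hsurj w hw)
  refine ⟨f, Function.invFunOn f D, hf.diff.continuousOn, hf.maps, ?_, hgm,
    fun z hz => hf.inj.leftInvOn_invFunOn hz, hfg⟩
  intro w hw
  have hc : ContinuousAt (Function.invFunOn f D) w := by
    rw [continuousAt_def]
    intro A hA
    obtain ⟨B, hBA, hB, hwB⟩ := _root_.mem_nhds_iff.1 hA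
    have ho : IsOpen (f '' (D ∩ B)) := isOpen_image_of_deriv (hD.op.inter hB)
      (hf.diff.mono inter_subset_left) (fun z hz => hf.der z hz.1)
    have hm : w ∈ f '' (D ∩ B) := ⟨_, ⟨hgm w hw, hwB⟩, hfg w hw⟩
    filter_upwards [ho.mem_nhds hm]
    rintro _ ⟨z, hz, rfl⟩
    show Function.invFunOn f D (f z) ∈ A
    rw [hf.inj.leftInvOn_invFunOn hz.1]
    exact hBA hz.2
  have := HasDerivAt.of_local_left_inverse hc
    ((hf.diff.differentiableAt (hD.op.mem_nhds (hgm w hw))).hasDerivAt) (hf.der _ (hgm w hw))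
    (by filter_upwards [isOpen_ball.mem_nhds hw] with y hy using hfg y hy)
  exact this.differentiableAt.differentiableWithinAt

theorem IsDom.rd {γ : ℝ → ℂ} {D : Set ℂ} (hD : IsDom γ D) (h : IsJ γ) : RD D where
  op := hD.op
  conn := hD.pc.isConnected.isPreconnected
  bdd := hD.bdd
  log := fun f _ hf hi h0 hm ha => hD.log_global h hf.continuousOn hi
    (isOpen_image_of_deriv hD.op hf h0) (isBounded_ball.subset hm.image_subset) ha

end FI

namespace FI
open Set Complex Metric Topology Filter MeasureTheory

def strip : Set ℂ := {w | 0 < w.im ∧ w.im < Real.pi}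

theorem isOpen_strip : IsOpen strip :=
  (isOpen_lt continuous_const Complex.continuous_im).inter (isOpen_lt Complex.continuous_im continuous_const)

theorem det_smul_one (a : ℂ) : ((a • (1 : ℂ →L[ℝ] ℂ)) : ℂ →L[ℝ] ℂ).det = ‖a‖ ^ 2 := by
  rw [← Complex.normSq_eq_norm_sq, ← Algebra.norm_complex_apply, Algebra.norm_apply]
  rw [ContinuousLinearMap.det]
  congr 1

theorem strip_area {G : ℂ → ℂ} (hG : DifferentiableOn ℂ G strip) (hi : InjOn G strip)
    (hb : Bornology.IsBounded (G '' strip)) :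
    ∫⁻ w in strip, ENNReal.ofReal (‖deriv G w‖ ^ 2) < ⊤ := by
  have h := lintegral_abs_det_fderiv_eq_addHaar_image volume isOpen_strip.measurableSet
    (f := G) (f' := fun w => deriv G w • (1 : ℂ →L[ℝ] ℂ)) (fun w hw => by
      have := (hG.differentiableAt (isOpen_strip.mem_nhds hw)).hasDerivAt
      exact this.complexToReal_fderiv.hasFDerivWithinAt) hi
  simp only [det_smul_one, abs_pow, abs_norm] at h
  rw [h]
  exact hb.measure_lt_top

theorem strip_slice {G : ℂ → ℂ} (hG : DifferentiableOn ℂ G strip) (hi : InjOn G strip)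
    (hb : Bornology.IsBounded (G '' strip)) {c : ℝ} (hc : 0 < c) (X : ℝ) :
    ∃ x < X, ∫⁻ y in Ioo 0 Real.pi, ENNReal.ofReal (‖deriv G (x + y * I)‖ ^ 2) < ENNReal.ofReal c := by
  by_contra! hcon
  have h := strip_area hG hi hb
  set F : ℂ → ENNReal := strip.indicator fun w => ENNReal.ofReal (‖deriv G w‖ ^ 2) with hF
  have hFm : Measurable F :=
    (((measurable_deriv G).norm.pow_const 2).ennreal_ofReal).indicator isOpen_strip.measurableSet
  rw [← lintegral_indicator isOpen_strip.measurableSet, ← hF] at h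
  rw [← (Complex.volume_preserving_equiv_real_prod.symm).lintegral_comp_emb
    measurableEquivRealProd.symm.measurableEmbedding] at h
  rw [Measure.volume_eq_prod, lintegral_prod (fun p => F (measurableEquivRealProd.symm p)) (hFm.comp measurableEquivRealProd.symm.measurable).aemeasurable] at h
  have key : ∀ x < X, ENNReal.ofReal c ≤ ∫⁻ y, F (measurableEquivRealProd.symm (x, y)) := by
    intro x hx
    refine (hcon x hx).trans (le_of_eq ?_)
    rw [← lintegral_indicator measurableSet_Ioo]
    congr 1
    ext y
    have e : measurableEquivRealProd.symm (x, y) = x + y * I := by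
      apply Complex.ext <;> simp [measurableEquivRealProd_symm_apply]
    rw [e, hF]
    by_cases hy : y ∈ Ioo 0 Real.pi
    · rw [indicator_of_mem hy, indicator_of_mem]
      simpa [strip] using hy
    · rw [indicator_of_notMem hy, indicator_of_notMem]
      simpa [strip] using hy
  have : ∫⁻ x, (Iio X).indicator (fun _ => ENNReal.ofReal c) x ≤
      ∫⁻ x, ∫⁻ y, F (measurableEquivRealProd.symm (x, y)) := by
    apply lintegral_mono
    intro x
    by_cases hx : x < X
    · rw [indicator_of_mem (by exact hx)]; exact key x hx
    · rw [indicator_of_notMem (by exact hx)]; exact zero_le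
  rw [lintegral_indicator measurableSet_Iio, lintegral_const, Measure.restrict_apply_univ,
    Real.volume_Iio, ENNReal.mul_top (by simpa using hc)] at this
  exact absurd (lt_of_le_of_lt this h) (lt_irrefl _)

theorem strip_dist {G : ℂ → ℂ} (hG : DifferentiableOn ℂ G strip) {x η : ℝ} (hη : 0 < η)
    (h : ∫⁻ y in Ioo 0 Real.pi, ENNReal.ofReal (‖deriv G (x + y * I)‖ ^ 2) < ENNReal.ofReal (η ^ 2))
    {y y' : ℝ} (hy : 0 < y) (hyy : y ≤ y') (hy' : y' < Real.pi) :
    dist (G (x + y * I)) (G (x + y' * I)) ≤ η * (Real.pi + 1) := by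
  have hmem : ∀ s ∈ uIcc y y', (x + s * I : ℂ) ∈ strip := by
    intro s hs
    rw [uIcc_of_le hyy] at hs
    simpa [strip] using ⟨hy.trans_le hs.1, hs.2.trans_lt hy'⟩
  have hline : ∀ s : ℝ, HasDerivAt (fun s : ℝ => (x + s * I : ℂ)) I s := by
    intro s
    have h1 : HasDerivAt (fun s : ℝ => (s : ℂ)) 1 s := Complex.ofRealCLM.hasDerivAt
    simpa using (h1.mul_const I).const_add (x : ℂ)
  have hder : ∀ s ∈ uIcc y y', HasDerivAt (fun s : ℝ => G (x + s * I)) (deriv G (x + s * I) * I) s := by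
    intro s hs
    have h2 := (hG.differentiableAt (isOpen_strip.mem_nhds (hmem s hs))).hasDerivAt
    exact h2.comp s (hline s)
  have hcont : ContinuousOn (fun s : ℝ => deriv G (x + s * I) * I) (uIcc y y') := by
    refine ContinuousOn.mul ?_ continuousOn_const
    have : ContinuousOn (deriv G) strip := (hG.deriv isOpen_strip).continuousOn
    exact this.comp (fun s _ => (hline s).continuousAt.continuousWithinAt) hmem
  have hint := hcont.intervalIntegrable (μ := volume)
  have ftc := intervalIntegral.integral_eq_sub_of_hasDerivAt hder hint
  rw [dist_comm, dist_eq_norm, ← ftc, intervalIntegral.integral_of_le hyy]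
  have h1 := enorm_integral_le_lintegral_enorm (μ := volume.restrict (Ioc y y')) (fun s : ℝ => deriv G (x + s * I) * I)
  have h2 : ∫⁻ s in Ioc y y', ‖deriv G (x + s * I) * I‖ₑ ≤
      ∫⁻ s in Ioo 0 Real.pi, (ENNReal.ofReal η + ENNReal.ofReal η⁻¹ * ENNReal.ofReal (‖deriv G (x + s * I)‖ ^ 2)) := by
    refine (lintegral_mono_set (fun s hs => (⟨hy.trans hs.1, hs.2.trans_lt hy'⟩ : s ∈ Ioo 0 Real.pi))).trans ?_
    apply lintegral_mono
    intro s
    simp only [enorm_mul]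
    rw [← ENNReal.ofReal_mul (by positivity), ← ENNReal.ofReal_add hη.le (by positivity), ← ofReal_norm, ← ofReal_norm,
      ← ENNReal.ofReal_mul (by positivity)]
    apply ENNReal.ofReal_le_ofReal
    simp only [norm_I, mul_one]
    set a := ‖deriv G (x + s * I)‖
    have : η⁻¹ * a ^ 2 = a ^ 2 / η := by ring
    rw [this, ← sub_nonneg]
    have : η + a ^ 2 / η - a = ((a - η)^2 + a * η) / η := by field_simp; ring
    rw [this]; positivity
  rw [lintegral_add_left measurable_const, lintegral_const_mul' _ _ ENNReal.ofReal_ne_top, lintegral_const,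
    Measure.restrict_apply_univ, Real.volume_Ioo, sub_zero, ← ENNReal.ofReal_mul hη.le] at h2
  have h3 : ENNReal.ofReal η⁻¹ * ∫⁻ y in Ioo 0 Real.pi, ENNReal.ofReal (‖deriv G (x + y * I)‖ ^ 2)
      ≤ ENNReal.ofReal η := by
    refine (mul_le_mul_right h.le _).trans (le_of_eq ?_)
    rw [← ENNReal.ofReal_mul (by positivity)]
    congr 1; field_simp
  have h4 := (h1.trans h2).trans (add_le_add_right h3 _)
  rw [← ENNReal.ofReal_add (by positivity) hη.le, ← ofReal_norm, ENNReal.ofReal_le_ofReal_iff (by positivity)] at h4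
  linarith

theorem strip_short {G : ℂ → ℂ} (hG : DifferentiableOn ℂ G strip) (hi : InjOn G strip)
    (hb : Bornology.IsBounded (G '' strip)) {ε : ℝ} (hε : 0 < ε) (X : ℝ) :
    ∃ x < X, ∀ w ∈ strip, ∀ w' ∈ strip, w.re = x → w'.re = x → dist (G w) (G w') ≤ ε := by
  have hpi := Real.pi_pos
  set η := ε / (Real.pi + 1)
  have hη : 0 < η := by positivity
  obtain ⟨x, hx, hs⟩ := strip_slice hG hi hb (c := η ^ 2) (by positivity) X
  have e : η * (Real.pi + 1) = ε := by simp only [η]; field_simp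
  refine ⟨x, hx, fun w hw w' hw' hwx hwx' => ?_⟩
  have e1 : w = x + w.im * I := by rw [← hwx, re_add_im]
  have e2 : w' = x + w'.im * I := by rw [← hwx', re_add_im]
  rcases le_total w.im w'.im with h | h
  · have := strip_dist hG hη hs hw.1 h hw'.2
    rw [← e1, ← e2, e] at this; exact this
  · have := strip_dist hG hη hs hw'.1 h hw.2
    rw [← e1, ← e2, e, dist_comm] at this; exact this

theorem strip_exp {w : ℂ} (hw : w ∈ strip) : 0 < (exp w).im := by
  rw [exp_im]
  exact mul_pos (Real.exp_pos _) (Real.sin_pos_of_pos_of_lt_pi hw.1 hw.2)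

theorem strip_log {E : ℂ} (hE : 0 < E.im) : log E ∈ strip := by
  have h0 : 0 ≤ arg E := arg_nonneg_iff.2 hE.le
  have h1 : arg E ≠ 0 := fun h => by have := (arg_eq_zero_iff.1 h).2; exact hE.ne' this
  have h2 : arg E ≠ Real.pi := fun h => by have := (arg_eq_pi_iff.1 h).2; exact hE.ne' this
  exact ⟨by rw [log_im]; exact lt_of_le_of_ne h0 h1.symm, by rw [log_im]; exact lt_of_le_of_ne (arg_le_pi _) h2⟩

theorem norm_lt_half {E : ℂ} (hE : 0 < E.im) : ‖I - E‖ < ‖I + E‖ := by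
  rw [← sq_lt_sq₀ (norm_nonneg _) (norm_nonneg _), ← normSq_eq_norm_sq, ← normSq_eq_norm_sq, normSq_apply, normSq_apply]
  simp
  nlinarith

theorem ne_half {E : ℂ} (hE : 0 < E.im) : I + E ≠ 0 := by
  intro h
  have := norm_lt_half hE
  rw [h, norm_zero] at this
  exact absurd this (not_lt.2 (norm_nonneg _))

theorem short_cross {g : ℂ → ℂ} (hg : DifferentiableOn ℂ g (ball 0 1)) (hi : InjOn g (ball 0 1))
    (hb : Bornology.IsBounded (g '' ball 0 1)) {ζ : ℂ} (hζ : ‖ζ‖ = 1) {ε X : ℝ} (hε : 0 < ε) (hX : 0 < X) :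
    ∃ t, 0 < t ∧ t < X ∧ ∀ z ∈ ball (0:ℂ) 1, ∀ z' ∈ ball (0:ℂ) 1,
      ‖ζ - z‖ = t * ‖ζ + z‖ → ‖ζ - z'‖ = t * ‖ζ + z'‖ → dist (g z) (g z') ≤ ε := by
  have hζ0 : ζ ≠ 0 := by rintro rfl; simp at hζ
  set m : ℂ → ℂ := fun w => ζ * ((I - exp w) / (I + exp w)) with hm
  have hmaps : MapsTo m strip (ball 0 1) := by
    intro w hw
    have h1 := strip_exp hw
    simp only [hm, mem_ball_zero_iff, norm_mul, hζ, one_mul, norm_div]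
    rw [div_lt_one (norm_pos_iff.2 (ne_half h1))]
    exact norm_lt_half h1
  have hdiff : DifferentiableOn ℂ m strip := by
    intro w hw
    have h1 := ne_half (strip_exp hw)
    apply DifferentiableAt.differentiableWithinAt
    exact ((differentiableAt_exp.const_sub I).div (differentiableAt_exp.const_add I) h1).const_mul ζ
  have hminj : InjOn m strip := by
    intro w hw w' hw' h
    have h1 := ne_half (strip_exp hw)
    have h2 := ne_half (strip_exp hw')
    have h3 := mul_left_cancel₀ hζ0 h
    rw [div_eq_div_iff h1 h2] at h3
    have h4 : (2 * I) * (exp w' - exp w) = 0 := by linear_combination h3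
    have h5 : exp w = exp w' := by
      rcases mul_eq_zero.1 h4 with h | h
      · exact absurd h (by simp)
      · exact (sub_eq_zero.1 h).symm
    have := Real.pi_pos
    exact Complex.exp_inj_of_neg_pi_lt_of_le_pi (by linarith [hw.1]) hw.2.le (by linarith [hw'.1]) hw'.2.le h5
  have hsurj : ∀ z ∈ ball (0:ℂ) 1, ∃ w ∈ strip, m w = z ∧ ‖ζ - z‖ = Real.exp w.re * ‖ζ + z‖ := by
    intro z hz
    rw [mem_ball_zero_iff] at hz
    set v := z / ζ with hv
    have hvz : z = ζ * v := by rw [hv]; field_simp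
    have hv1 : ‖v‖ < 1 := by rw [hv, norm_div, hζ, div_one]; exact hz
    have h1v : 1 + v ≠ 0 := by
      intro h
      have : v = -1 := by linear_combination h
      rw [this] at hv1; simp at hv1
    have hE : 0 < (I * (1 - v) / (1 + v)).im := by
      have hn : 0 < normSq (1 + v) := normSq_pos.2 h1v
      have h2 : normSq v < 1 := by
        rw [normSq_eq_norm_sq]; nlinarith [norm_nonneg v]
      rw [normSq_apply] at h2
      have : (I * (1 - v) / (1 + v)).im = (1 - (v.re * v.re + v.im * v.im)) / normSq (1 + v) := by
        rw [div_im]; simp; ring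
      rw [this]
      apply div_pos _ hn
      linarith
    have hE0 : I * (1 - v) / (1 + v) ≠ 0 := fun h => by rw [h] at hE; simp at hE
    refine ⟨log (I * (1 - v) / (1 + v)), strip_log hE, ?_, ?_⟩
    · simp only [hm]
      have h3 := ne_half hE
      rw [exp_log hE0]
      have e1 : I - I * (1 - v) / (1 + v) = 2 * I * v / (1 + v) := by field_simp; ring
      have e2 : I + I * (1 - v) / (1 + v) = 2 * I / (1 + v) := by field_simp; ring
      rw [e1, e2, hvz]
      field_simp
    · rw [log_re, Real.exp_log (norm_pos_iff.2 hE0), hvz]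
      have e1 : ζ - ζ * v = ζ * (1 - v) := by ring
      have e2 : ζ + ζ * v = ζ * (1 + v) := by ring
      rw [e1, e2]
      have := norm_pos_iff.2 h1v
      simp only [norm_mul, norm_div, hζ, norm_I, one_mul]
      field_simp
  obtain ⟨x, hx, H⟩ := strip_short (G := g ∘ m) (hg.comp hdiff hmaps) (hi.comp hminj hmaps)
    (hb.subset (by rw [image_comp]; exact image_mono hmaps.image_subset)) hε (Real.log X)
  refine ⟨Real.exp x, Real.exp_pos _, by rwa [← Real.lt_log_iff_exp_lt hX], ?_⟩
  have key : ∀ z ∈ ball (0:ℂ) 1, ‖ζ - z‖ = Real.exp x * ‖ζ + z‖ → ∃ w ∈ strip, m w = z ∧ w.re = x := by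
    intro z hz he
    obtain ⟨w, hw, h1, h2⟩ := hsurj z hz
    refine ⟨w, hw, h1, ?_⟩
    have hne : ‖ζ + z‖ ≠ 0 := by
      intro h
      rw [norm_eq_zero] at h
      have : z = - ζ := by linear_combination h
      rw [this] at hz; simp [hζ] at hz
    exact Real.exp_injective (mul_right_cancel₀ hne (h2.symm.trans he))
  intro z hz z' hz' h h'
  obtain ⟨w, hw, rfl, hwx⟩ := key z hz h
  obtain ⟨w', hw', rfl, hwx'⟩ := key z' hz' h'
  exact H w hw w' hw' hwx hwx'
end FI

namespace FI
open Set Complex Metric Topology Filter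

structure RM (γ : ℝ → ℂ) (D : Set ℂ) (f g : ℂ → ℂ) : Prop where
  hJ : IsJ γ
  hD : IsDom γ D
  fc : ContinuousOn f D
  fm : MapsTo f D (ball 0 1)
  gd : DifferentiableOn ℂ g (ball 0 1)
  gm : MapsTo g (ball 0 1) D
  gf : ∀ z ∈ D, g (f z) = z
  fg : ∀ w ∈ ball (0:ℂ) 1, f (g w) = w

variable {γ : ℝ → ℂ} {D : Set ℂ} {f g : ℂ → ℂ}

theorem RM.ginj (h : RM γ D f g) : InjOn g (ball 0 1) := by
  intro z hz w hw e
  rw [← h.fg z hz, ← h.fg w hw, e]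

theorem RM.small (h : RM γ D f g) {ζ : ℂ} (hζ : ‖ζ‖ = 1) {r : ℝ} (hr : 0 < r)
    (hr2 : 2 * r < dist (g 0) (g (-ζ/2))) : ∃ t > 0, ∀ z ∈ ball (0:ℂ) 1, ∀ z' ∈ ball (0:ℂ) 1,
      ‖ζ - z‖ < t * ‖ζ + z‖ → ‖ζ - z'‖ < t * ‖ζ + z'‖ → dist (g z) (g z') ≤ 2 * r := by
  obtain ⟨δ, hδ, harc⟩ := h.hJ.local_arcs hr
  obtain ⟨t, ht0, ht1, ht⟩ := short_cross h.gd h.ginj (h.hD.bdd.subset h.gm.image_subset) hζ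
    (lt_min hδ hr) one_pos
  refine ⟨t, ht0, ?_⟩
  set σ : Set ℂ := g '' {z | z ∈ ball (0:ℂ) 1 ∧ ‖ζ - z‖ = t * ‖ζ + z‖} with hσ
  have hσd : ∀ p ∈ σ, ∀ q ∈ σ, dist p q ≤ min δ r := by
    rintro _ ⟨z, ⟨hz, hz'⟩, rfl⟩ _ ⟨w, ⟨hw, hw'⟩, rfl⟩
    exact ht z hz w hw hz' hw'
  have hσa : ∀ a ∈ closure σ, closure σ ⊆ closedBall a (min δ r) := by
    intro a ha
    apply closure_minimal _ isClosed_closedBall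
    intro p hp
    have : closure σ ⊆ closedBall p (min δ r) :=
      closure_minimal (fun q hq => hσd q hq p hp) isClosed_closedBall
    rw [mem_closedBall, dist_comm]
    exact this ha
  have hσc : ∀ a ∈ closure σ, IsCompact (closure σ) := fun a ha =>
    (isCompact_closedBall a (min δ r)).of_isClosed_subset isClosed_closure (hσa a ha)
  have hσne : σ.Nonempty := by
    have e1 : ‖ζ - ζ * ((1 - t) / (1 + t) : ℝ)‖ = 2 * t / (1 + t) := by
      have : ζ - ζ * ((1 - t) / (1 + t) : ℝ) = ζ * ((2 * t / (1 + t) : ℝ) : ℂ) := by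
        have : (1 + t : ℂ) ≠ 0 := by exact_mod_cast (by positivity : (1 + t) ≠ 0)
        push_cast; field_simp; ring
      rw [this, norm_mul, hζ, one_mul, norm_real, Real.norm_of_nonneg (by positivity)]
    have e2 : ‖ζ + ζ * ((1 - t) / (1 + t) : ℝ)‖ = 2 / (1 + t) := by
      have : ζ + ζ * ((1 - t) / (1 + t) : ℝ) = ζ * ((2 / (1 + t) : ℝ) : ℂ) := by
        have : (1 + t : ℂ) ≠ 0 := by exact_mod_cast (by positivity : (1 + t) ≠ 0)
        push_cast; field_simp; ring
      rw [this, norm_mul, hζ, one_mul, norm_real, Real.norm_of_nonneg (by positivity)]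
    refine ⟨_, ζ * ((1 - t) / (1 + t) : ℝ), ⟨?_, ?_⟩, rfl⟩
    · rw [mem_ball_zero_iff, norm_mul, hζ, one_mul, norm_real, Real.norm_of_nonneg (div_nonneg (by linarith) (by linarith)),
        div_lt_one (by linarith)]
      linarith
    · rw [e1, e2]; ring
  obtain ⟨a, B, hBc, hBa, hσB, hJB⟩ : ∃ a B, IsCompact B ∧ B ⊆ closedBall a r ∧ σ ⊆ B ∧
      IsPreconnected (range γ ∩ B) := by
    by_cases hne : (range γ ∩ closure σ).Nonempty
    · obtain ⟨a, haJ, has⟩ := hne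
      obtain ⟨A, hAJ, hAc, hAp, hA1, hA2⟩ := harc a haJ
      have h1 := hσa a has
      refine ⟨a, A ∪ closure σ, hAc.union (hσc a has), union_subset hA2
        (h1.trans (closedBall_subset_closedBall (min_le_right _ _))), subset_closure.trans subset_union_right, ?_⟩
      have : range γ ∩ (A ∪ closure σ) = A := by
        apply Subset.antisymm
        · rintro x ⟨hx, hx' | hx'⟩
          · exact hx'
          · exact hA1 ⟨hx, closedBall_subset_closedBall (min_le_left _ _) (h1 hx')⟩
        · exact fun x hx => ⟨hAJ hx, Or.inl hx⟩
      rwa [this]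
    · obtain ⟨a, ha⟩ := hσne
      have ha' := subset_closure ha
      refine ⟨a, closure σ, hσc a ha', (hσa a ha').trans (closedBall_subset_closedBall (min_le_right _ _)),
        subset_closure, ?_⟩
      rw [not_nonempty_iff_eq_empty.1 hne]
      exact isPreconnected_empty
  -- separation
  have hsep : ∀ p ∈ D, ∀ q ∈ D, p ∉ closedBall a r → q ∉ closedBall a r →
      ‖ζ - f p‖ - t * ‖ζ + f p‖ < 0 → 0 < ‖ζ - f q‖ - t * ‖ζ + f q‖ → False := by
    intro p hp q hq hpa hqa hup huq
    have j1 : JoinedIn (range γ)ᶜ p q := (h.hD.pc.joinedIn p hp q hq).mono h.hD.disj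
    have j2 : JoinedIn Bᶜ p q :=
      ((isPathConnected_compl_closedBall a hr).joinedIn p hpa q hqa).mono (compl_subset_compl.2 hBa)
    have j3 := h.hD.mem_of_joined hp (L4 h.hJ.compact hBc hJB j1 j2)
    obtain ⟨P, hP⟩ := j3
    have hc : ContinuousOn (fun x => ‖ζ - f x‖ - t * ‖ζ + f x‖) (range P) := by
      have : ContinuousOn f (range P) := h.fc.mono (by rintro _ ⟨s, rfl⟩; exact (hP s).1)
      exact (continuousOn_const.sub this).norm.sub (continuousOn_const.mul (continuousOn_const.add this).norm)
    have := (isPreconnected_range P.continuous).intermediate_value (f := fun x => ‖ζ - f x‖ - t * ‖ζ + f x‖)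
      (a := p) (b := q) ⟨0, P.source⟩ ⟨1, P.target⟩ hc
    obtain ⟨x, ⟨s, rfl⟩, hx⟩ := this ⟨hup.le, huq.le⟩
    refine (hP s).2 (hσB ⟨f (P s), ⟨h.fm (hP s).1, ?_⟩, h.gf _ (hP s).1⟩)
    simp only at hx
    linarith
  obtain ⟨q, hq, hqa, huq⟩ : ∃ q ∈ ball (0:ℂ) 1, g q ∉ closedBall a r ∧ 0 < ‖ζ - q‖ - t * ‖ζ + q‖ := by
    by_cases h0 : g 0 ∈ closedBall a r
    · refine ⟨-ζ/2, ?_, ?_, ?_⟩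
      · simp [hζ]; norm_num
      · intro h1
        rw [mem_closedBall] at h0 h1
        have := dist_triangle_right (g 0) (g (-ζ/2)) a
        linarith
      · have e1 : ζ - -ζ/2 = (3/2 : ℝ) * ζ := by push_cast; ring
        have e2 : ζ + -ζ/2 = (1/2 : ℝ) * ζ := by push_cast; ring
        rw [e1, e2, norm_mul, norm_mul, hζ, norm_real, norm_real]
        norm_num
        linarith
    · refine ⟨0, by simp, h0, ?_⟩
      simp [hζ, ht1]
  have hin : ∀ z ∈ ball (0:ℂ) 1, ‖ζ - z‖ < t * ‖ζ + z‖ → g z ∈ closedBall a r := by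
    intro z hz hzt
    by_contra hcon
    refine hsep _ (h.gm hz) _ (h.gm hq) hcon hqa ?_ ?_
    · rw [h.fg z hz]; linarith
    · rw [h.fg q hq]; exact huq
  intro z hz z' hz' h1 h2
  have h3 := hin z hz h1
  have h4 := hin z' hz' h2
  rw [mem_closedBall] at h3 h4
  have := dist_triangle_right (g z) (g z') a
  linarith

theorem RM.tendsto (h : RM γ D f g) {ζ : ℂ} (hζ : ‖ζ‖ = 1) :
    ∃ l, Tendsto g (𝓝[ball 0 1] ζ) (𝓝 l) := by
  have hcl : ζ ∈ closure (ball (0:ℂ) 1) := by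
    rw [closure_ball _ one_ne_zero]; simp [hζ]
  have : (𝓝[ball 0 1] ζ).NeBot := mem_closure_iff_nhdsWithin_neBot.1 hcl
  apply cauchy_map_iff_exists_tendsto.1
  rw [Metric.cauchy_iff]
  refine ⟨inferInstance, fun ε hε => ?_⟩
  have hdist : 0 < dist (g 0) (g (-ζ/2)) := by
    rw [dist_pos]
    intro e
    have := h.ginj (by simp) (by simp [hζ]; norm_num) e
    have h2 : ζ = 0 := by linear_combination 2 * this
    rw [h2] at hζ; simp at hζ
  set r := min (ε / 4) (dist (g 0) (g (-ζ/2)) / 4)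
  have hr : 0 < r := lt_min (by positivity) (by positivity)
  have hrε : r ≤ ε / 4 := min_le_left _ _
  have hrd : r ≤ dist (g 0) (g (-ζ/2)) / 4 := min_le_right _ _
  obtain ⟨t, ht0, ht⟩ := h.small hζ hr (by linarith)
  have hev : ∀ᶠ z in 𝓝 ζ, ‖ζ - z‖ < t * ‖ζ + z‖ := by
    apply (ContinuousAt.eventually_lt (f := fun z : ℂ => ‖ζ - z‖) (g := fun z : ℂ => t * ‖ζ + z‖) (by fun_prop) (by fun_prop))
    have : ζ + ζ = 2 * ζ := by ring
    simp [this, hζ, ht0]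
  refine ⟨g '' {z | z ∈ ball (0:ℂ) 1 ∧ ‖ζ - z‖ < t * ‖ζ + z‖}, ?_, ?_⟩
  · apply image_mem_map
    filter_upwards [self_mem_nhdsWithin, mem_nhdsWithin_of_mem_nhds hev] with z hz hz'
    exact ⟨hz, hz'⟩
  · rintro _ ⟨z, ⟨hz, hz'⟩, rfl⟩ _ ⟨w, ⟨hw, hw'⟩, rfl⟩
    have := ht z hz w hw hz' hw'
    linarith
end FI

namespace FI
open Set Complex Metric Topology Filter

variable {γ : ℝ → ℂ} {D : Set ℂ} {f g : ℂ → ℂ}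

structure CE (γ : ℝ → ℂ) (D : Set ℂ) (k : ℂ → ℂ) : Prop where
  hJ : IsJ γ
  hD : IsDom γ D
  kc : ContinuousOn k (closedBall 0 1)
  kd : DifferentiableOn ℂ k (ball 0 1)
  ki : InjOn k (ball 0 1)
  kD : k '' ball 0 1 = D
  kJ : k '' sphere 0 1 = range γ

theorem RM.ext (h : RM γ D f g) : ∃ k, CE γ D k := by
  set k := extendFrom (ball (0:ℂ) 1) g with hk
  have hcl : closure (ball (0:ℂ) 1) = closedBall 0 1 := closure_ball _ one_ne_zero
  have hkc : ContinuousOn k (closedBall 0 1) := by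
    apply continuousOn_extendFrom hcl.ge
    intro x hx
    rw [mem_closedBall_zero_iff] at hx
    rcases hx.lt_or_eq with h1 | h1
    · exact ⟨g x, h.gd.continuousOn x (by simpa using h1)⟩
    · exact h.tendsto h1
  have hkg : ∀ z ∈ ball (0:ℂ) 1, k z = g z := fun z hz =>
    extendFrom_eq (subset_closure hz) (h.gd.continuousOn z hz)
  have hkD : k '' ball 0 1 = D := by
    rw [image_congr hkg]
    apply Subset.antisymm h.gm.image_subset
    exact fun z hz => ⟨f z, h.fm hz, h.gf z hz⟩
  have hcomp : closure D ⊆ k '' closedBall 0 1 := by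
    apply closure_minimal _ (((isCompact_closedBall (0:ℂ) 1).image_of_continuousOn hkc).isClosed)
    rw [← hkD]
    exact image_mono ball_subset_closedBall
  have hsub : k '' sphere 0 1 ⊆ range γ := by
    rintro _ ⟨ζ, hζ, rfl⟩
    have hζc : ζ ∈ closedBall (0:ℂ) 1 := sphere_subset_closedBall hζ
    have h1 : k ζ ∈ closure D := by
      rw [← hkD]
      have := hkc.mono hcl.le
      exact this.image_closure ⟨ζ, hcl.ge hζc, rfl⟩
    rw [h.hD.clo] at h1
    refine h1.resolve_left fun hv => ?_
    have : (𝓝[ball 0 1] ζ).NeBot := mem_closure_iff_nhdsWithin_neBot.1 (hcl.ge hζc)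
    have t1 : Tendsto k (𝓝[ball 0 1] ζ) (𝓝 (k ζ)) := (hkc ζ hζc).mono_left (nhdsWithin_mono _ ball_subset_closedBall)
    have t2 : Tendsto (fun z => f (k z)) (𝓝[ball 0 1] ζ) (𝓝 (f (k ζ))) :=
      (h.fc.continuousAt (h.hD.op.mem_nhds hv)).tendsto.comp t1
    have t3 : Tendsto (fun z : ℂ => z) (𝓝[ball 0 1] ζ) (𝓝 ζ) := tendsto_id.mono_left nhdsWithin_le_nhds
    have t4 : Tendsto (fun z => f (k z)) (𝓝[ball 0 1] ζ) (𝓝 ζ) := by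
      refine t3.congr' ?_
      filter_upwards [self_mem_nhdsWithin] with z hz
      rw [hkg z hz, h.fg z hz]
    have e := tendsto_nhds_unique t2 t4
    have := h.fm hv
    rw [e] at this
    simp at this hζ
    linarith
  refine ⟨k, h.hJ, h.hD, hkc, h.gd.congr hkg, ?_, hkD, ?_⟩
  · intro z hz w hw e
    rw [hkg z hz, hkg w hw] at e
    exact h.ginj hz hw e
  · apply Subset.antisymm hsub
    intro w hw
    obtain ⟨z, hz, rfl⟩ := hcomp (by rw [h.hD.clo]; exact Or.inr hw)
    rw [mem_closedBall_zero_iff] at hz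
    rcases hz.lt_or_eq with h1 | h1
    · have : k z ∈ D := by rw [← hkD]; exact ⟨z, by simpa using h1, rfl⟩
      exact absurd hw (h.hD.disj this)
    · exact ⟨z, by simpa using h1, rfl⟩

variable {k : ℂ → ℂ}

theorem CE.not_const (h : CE γ D k) {w : ℂ} (hw : w ∈ range γ) {a b : ℝ} (hab : a < b)
    (hc : ∀ θ ∈ Ioo a b, k (exp (θ * I)) = w) : False := by
  set δ := (b - a) / 2 with hδ
  have hδ0 : 0 < δ := by rw [hδ]; linarith
  obtain ⟨M, hM⟩ := exists_nat_gt (2 * Real.pi / δ + 1)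
  set P : ℂ → ℂ := fun z => ∏ n ∈ Finset.range M, (k (z * exp ((n * δ : ℝ) * I)) - w) with hP
  have hcl : closure (ball (0:ℂ) 1) = closedBall 0 1 := closure_ball _ one_ne_zero
  have hrot : ∀ (z : ℂ) (n : ℕ), ‖z * exp ((n * δ : ℝ) * I)‖ = ‖z‖ := by
    intro z n; rw [norm_mul, norm_exp_ofReal_mul_I, mul_one]
  have hdiff : DiffContOnCl ℂ P (ball 0 1) := by
    refine ⟨?_, ?_⟩
    · apply DifferentiableOn.fun_finsetProd
      intro n _
      refine DifferentiableOn.sub_const ?_ w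
      refine h.kd.comp (t := ball 0 1) (differentiable_id.mul_const _).differentiableOn ?_
      intro z hz
      rw [mem_ball_zero_iff] at hz ⊢
      rw [hrot]; exact hz
    · rw [hcl]
      apply continuousOn_finsetProd
      intro n _
      refine ContinuousOn.sub ?_ continuousOn_const
      refine h.kc.comp (t := closedBall 0 1) (continuous_id.mul continuous_const).continuousOn ?_
      intro z hz
      rw [mem_closedBall_zero_iff] at hz ⊢
      rw [hrot]; exact hz
  have hzero : ∀ z ∈ sphere (0:ℂ) 1, P z = 0 := by
    intro z hz
    rw [mem_sphere_zero_iff_norm] at hz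
    set θ := toIocMod Real.two_pi_pos (a - 2 * Real.pi) (arg z) with hθ
    have hθm := toIocMod_mem_Ioc Real.two_pi_pos (a - 2 * Real.pi) (arg z)
    rw [← hθ] at hθm
    have hzθ : z = exp (θ * I) := by
      have h1 : θ = arg z - toIocDiv Real.two_pi_pos (a - 2 * Real.pi) (arg z) • (2 * Real.pi) := rfl
      have h2 : exp ((θ : ℂ) * I) = exp (arg z * I) := by
        rw [exp_eq_exp_iff_exists_int]
        refine ⟨-toIocDiv Real.two_pi_pos (a - 2 * Real.pi) (arg z), ?_⟩
        rw [h1]; push_cast; simp; ring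
      rw [h2]
      have := norm_mul_exp_arg_mul_I z
      rw [hz] at this; simpa using this.symm
    have hq : 0 ≤ (a - θ) / δ := div_nonneg (by linarith [hθm.2]) hδ0.le
    set n := ⌊(a - θ) / δ⌋₊ + 1 with hn
    have hn1 : (a - θ) / δ < n := by rw [hn]; push_cast; exact Nat.lt_floor_add_one _
    have hn2 : (n : ℝ) ≤ (a - θ) / δ + 1 := by rw [hn]; push_cast; linarith [Nat.floor_le hq]
    have hnM : n < M := by
      have : (a - θ) / δ ≤ 2 * Real.pi / δ := by
        apply div_le_div_of_nonneg_right _ hδ0.le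
        linarith [hθm.1]
      exact_mod_cast (by linarith : (n : ℝ) < M)
    apply Finset.prod_eq_zero (Finset.mem_range.2 hnM)
    rw [sub_eq_zero]
    rw [hzθ, ← exp_add, ← add_mul, ← ofReal_add]
    apply hc
    rw [div_lt_iff₀ hδ0] at hn1
    have : (n : ℝ) * δ ≤ (a - θ) + δ := by
      calc (n : ℝ) * δ ≤ ((a - θ) / δ + 1) * δ := by gcongr
        _ = _ := by field_simp
    constructor <;> linarith
  have h0 : ‖P 0‖ ≤ 0 := by
    refine Complex.norm_le_of_forall_mem_frontier_norm_le isBounded_ball hdiff ?_ (subset_closure (by simp))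
    intro z hz
    rw [frontier_ball _ one_ne_zero] at hz
    rw [hzero z hz, norm_zero]
  have h1 : P 0 = 0 := norm_le_zero_iff.1 h0
  obtain ⟨n, _, hn⟩ := Finset.prod_eq_zero_iff.1 h1
  rw [zero_mul, sub_eq_zero] at hn
  have : w ∈ D := by rw [← h.kD, ← hn]; exact ⟨0, by simp, rfl⟩
  exact h.hD.disj this hw
end FI

namespace FI
open Set Complex Metric Topology Filter

variable {γ : ℝ → ℂ} {D : Set ℂ} {k : ℂ → ℂ}

theorem ray_im {u : ℂ} {θ t : ℝ} (ht : 0 ≤ t) (h : exp u = t * exp (θ * I)) :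
    ∃ n : ℤ, u.im = θ + n * (2 * Real.pi) := by
  have ht0 : 0 < t := by
    refine lt_of_le_of_ne ht ?_
    rintro rfl
    simp at h
  have h1 : (t : ℂ) = exp (Real.log t : ℝ) := by rw [← ofReal_exp, Real.exp_log ht0]
  rw [h1, ← exp_add, exp_eq_exp_iff_exists_int] at h
  obtain ⟨n, hn⟩ := h
  refine ⟨n, ?_⟩
  rw [hn]; simp

def rayS (θ : ℝ) : Set ℂ := (fun t : ℝ => (t : ℂ) * exp (θ * I)) '' Icc 0 1

theorem rayS_sub (θ : ℝ) : rayS θ ⊆ closedBall 0 1 := by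
  rintro _ ⟨t, ht, rfl⟩
  simp only [mem_closedBall_zero_iff, norm_mul, norm_exp_ofReal_mul_I, mul_one, norm_real]
  rw [Real.norm_of_nonneg ht.1]; exact ht.2

theorem rayS_ball {θ : ℝ} {z : ℂ} (hz : z ∈ rayS θ) : z ∈ ball (0:ℂ) 1 ∨ z = exp (θ * I) := by
  obtain ⟨t, ht, rfl⟩ := hz
  rcases ht.2.lt_or_eq with h | h
  · left
    simp only [mem_ball_zero_iff, norm_mul, norm_exp_ofReal_mul_I, mul_one, norm_real]
    rw [Real.norm_of_nonneg ht.1]; exact h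
  · right; simp [h]

theorem not_int_between {x : ℝ} {n : ℤ} (h0 : 0 < x) (h1 : x < 2 * Real.pi) (h : x = n * (2 * Real.pi)) : False := by
  have := Real.two_pi_pos
  have a1 : (0 : ℝ) < n := by
    by_contra hc; push Not at hc
    nlinarith
  have a2 : (n : ℝ) < 1 := by
    by_contra hc; push Not at hc
    nlinarith
  have b1 : (0 : ℤ) < n := by exact_mod_cast a1
  have b2 : n < (1 : ℤ) := by exact_mod_cast a2
  omega

theorem CE.path (h : CE γ D k) (θ : ℝ) : ∃ α : Path (k 0) (k (exp (θ * I))), range α = k '' rayS θ := by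
  have hc : Continuous fun t : unitInterval => k ((t : ℝ) * exp (θ * I)) :=
    h.kc.comp_continuous (by fun_prop) (fun t => rayS_sub θ ⟨t, t.2, rfl⟩)
  refine ⟨⟨⟨_, hc⟩, by simp, by simp⟩, ?_⟩
  apply Subset.antisymm
  · rintro _ ⟨t, rfl⟩
    exact ⟨_, ⟨t, t.2, rfl⟩, rfl⟩
  · rintro _ ⟨_, ⟨t, ht, rfl⟩, rfl⟩
    exact ⟨⟨t, ht⟩, rfl⟩

theorem CE.sphere_mem (h : CE γ D k) (θ : ℝ) : k (exp (θ * I)) ∈ range γ := by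
  rw [← h.kJ]; exact ⟨_, by simp, rfl⟩

theorem CE.ball_mem (h : CE γ D k) {z : ℂ} (hz : z ∈ ball (0:ℂ) 1) : k z ∈ D := by
  rw [← h.kD]; exact ⟨_, hz, rfl⟩

theorem CE.arc_const (h : CE γ D k) {θ₁ θ₂ : ℝ} (h12 : θ₁ < θ₂) (h21 : θ₂ < θ₁ + 2 * Real.pi) {w : ℂ}
    (hw1 : k (exp (θ₁ * I)) = w) (hw2 : k (exp (θ₂ * I)) = w) {θa θb : ℝ} (ha : θa ∈ Ioo θ₁ θ₂)
    (hb : θb ∈ Ioo θ₂ (θ₁ + 2 * Real.pi)) (haw : k (exp (θa * I)) ≠ w) (hbw : k (exp (θb * I)) ≠ w) : False := by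
  have hpi := Real.two_pi_pos
  have hwJ : w ∈ range γ := hw1 ▸ h.sphere_mem θ₁
  have hDJ : ∀ {x}, x ∈ D → x ∉ range γ := fun hx hx' => h.hD.disj hx hx'
  have h0D : k 0 ∈ D := h.ball_mem (by simp)
  have h0w : k 0 ≠ w := fun e => hDJ h0D (e ▸ hwJ)
  obtain ⟨α, hα⟩ := h.path θ₁
  obtain ⟨β, hβ⟩ := h.path θ₂
  set C : Set ℂ := k '' rayS θ₁ ∪ k '' rayS θ₂ with hC
  have hCcomp : IsCompact C := by
    rw [hC, ← hα, ← hβ]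
    exact (isCompact_range α.continuous).union (isCompact_range β.continuous)
  have hwC : w ∈ C := Or.inl ⟨_, ⟨1, by simp, by simp⟩, hw1⟩
  have h0C : k 0 ∈ C := Or.inl ⟨0, ⟨0, by simp, by simp⟩, rfl⟩
  have hCD : ∀ x ∈ C, x ∈ D ∨ x = w := by
    rintro _ (⟨z, hz, rfl⟩ | ⟨z, hz, rfl⟩)
    · rcases rayS_ball hz with h1 | h1
      · exact Or.inl (h.ball_mem h1)
      · right; rw [h1, hw1]
    · rcases rayS_ball hz with h1 | h1
      · exact Or.inl (h.ball_mem h1)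
      · right; rw [h1, hw2]
  have hJC : ∀ x ∈ range γ, x ≠ w → x ∉ C := by
    intro x hx hxw hxC
    rcases hCD x hxC with h1 | h1
    · exact hDJ h1 hx
    · exact hxw h1
  -- points in ball off the rays
  have hoff : ∀ z ∈ ball (0:ℂ) 1, k z ∈ C → z ∈ rayS θ₁ ∪ rayS θ₂ := by
    rintro z hz (⟨z', hz', e⟩ | ⟨z', hz', e⟩)
    · rcases rayS_ball hz' with h1 | h1
      · exact Or.inl (h.ki h1 hz e ▸ hz')
      · exfalso; rw [h1, hw1] at e; exact hDJ (h.ball_mem hz) (e ▸ hwJ)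
    · rcases rayS_ball hz' with h1 | h1
      · exact Or.inr (h.ki h1 hz e ▸ hz')
      · exfalso; rw [h1, hw2] at e; exact hDJ (h.ball_mem hz) (e ▸ hwJ)
  have hpre : IsPreconnected Cᶜ := by
    have hsector : ∀ a b θ₀ : ℝ, θ₀ ∈ Ioo a b → k (exp (θ₀ * I)) ≠ w →
        (∀ θ ∈ Ioo a b, θ ∈ Ioo θ₁ θ₂ ∨ θ ∈ Ioo θ₂ (θ₁ + 2 * Real.pi)) →
        ∃ S : Set ℂ, S ⊆ Cᶜ ∧ k (exp (θ₀ * I)) ∈ S ∧ IsPreconnected S ∧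
          ∀ u : ℂ, u.re < 0 → u.im ∈ Ioo a b → k (exp u) ∈ S := by
      intro a b θ₀ hθ₀ hne hab
      set T : Set ℂ := {u : ℂ | u.re < 0 ∧ u.im ∈ Ioo a b} with hT
      have hTconv : Convex ℝ T :=
        (convex_halfSpace_re_lt 0).inter ((convex_halfSpace_im_gt a).inter (convex_halfSpace_im_lt b))
      have hTball : ∀ u : ℂ, u.re < 0 → exp u ∈ ball (0:ℂ) 1 := by
        intro u hu; rw [mem_ball_zero_iff, norm_exp]; simpa using hu
      set T' : Set ℂ := insert (θ₀ * I : ℂ) T with hT'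
      have hT'pre : IsPreconnected T' := by
        refine hTconv.isPreconnected.subset_closure (subset_insert _ _) (insert_subset ?_ subset_closure)
        have ht : Tendsto (fun n : ℕ => (-(1 / ((n : ℝ) + 1)) : ℝ) + (θ₀ * I : ℂ)) atTop (𝓝 (((-0 : ℝ) : ℂ) + (θ₀ * I : ℂ))) := by
          refine Tendsto.add_const _ ?_
          exact (Complex.continuous_ofReal.tendsto _).comp (tendsto_one_div_add_atTop_nhds_zero_nat (𝕜 := ℝ)).neg
        simp only [neg_zero, ofReal_zero, zero_add] at ht
        refine mem_closure_of_tendsto ht (Eventually.of_forall fun n => ?_)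
        have : (0 : ℝ) < 1 / ((n : ℝ) + 1) := by positivity
        refine ⟨?_, ?_⟩
        · rw [add_re, ofReal_re, re_ofReal_mul, I_re, mul_zero, add_zero]; linarith
        · rw [add_im, ofReal_im, im_ofReal_mul, I_im, mul_one, zero_add]; exact hθ₀
      refine ⟨(fun u => k (exp u)) '' T', ?_, ⟨_, mem_insert _ _, rfl⟩, ?_, ?_⟩
      · rintro _ ⟨u, hu, rfl⟩
        rcases hu with rfl | ⟨hu1, hu2⟩
        · exact hJC _ (h.sphere_mem _) hne
        · intro hcon
          have := hab _ hu2
          rcases hoff _ (hTball u hu1) hcon with ⟨t, ht, e⟩ | ⟨t, ht, e⟩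
          · obtain ⟨n, hn⟩ := ray_im ht.1 e.symm
            rcases this with h1 | h1
            · exact not_int_between (x := u.im - θ₁) (n := n) (by linarith [h1.1]) (by linarith [h1.2]) (by linarith)
            · exact not_int_between (x := u.im - θ₁) (n := n) (by linarith [h1.1]) (by linarith [h1.2]) (by linarith)
          · obtain ⟨n, hn⟩ := ray_im ht.1 e.symm
            rcases this with h1 | h1
            · exact not_int_between (x := u.im - θ₂ + 2 * Real.pi) (n := n + 1) (by linarith [h1.1]) (by linarith [h1.2]) (by push_cast; linarith)
            · exact not_int_between (x := u.im - θ₂) (n := n) (by linarith [h1.1]) (by linarith [h1.2]) (by linarith)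
      · apply hT'pre.image
        refine h.kc.comp continuous_exp.continuousOn ?_
        rintro u (rfl | hu)
        · simp
        · exact ball_subset_closedBall (hTball u hu.1)
      · exact fun u h1 h2 => ⟨u, mem_insert_of_mem _ ⟨h1, h2⟩, rfl⟩
    have hJw : IsPreconnected (range γ \ {w}) := h.hJ.punctured w
    have hJwC : range γ \ {w} ⊆ Cᶜ := fun x hx => hJC x hx.1 hx.2
    have hjJ : k (exp (θa * I)) ∈ range γ \ {w} := ⟨h.sphere_mem _, haw⟩
    apply isPreconnected_of_forall (k (exp (θa * I)))
    intro y hy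
    by_cases hyJ : y ∈ range γ
    · exact ⟨range γ \ {w}, hJwC, hjJ, ⟨hyJ, fun e => hy (e ▸ hwC)⟩, hJw⟩
    by_cases hyD : y ∈ D
    · rw [← h.kD] at hyD
      obtain ⟨z, hz, rfl⟩ := hyD
      have hz0 : z ≠ 0 := by rintro rfl; exact hy h0C
      set θ := toIocMod Real.two_pi_pos θ₁ (arg z) with hθ
      have hθm := toIocMod_mem_Ioc Real.two_pi_pos θ₁ (arg z)
      rw [← hθ] at hθm
      have hzθ : exp ((Real.log ‖z‖ : ℝ) + θ * I) = z := by
        have h1 : θ = arg z - toIocDiv Real.two_pi_pos θ₁ (arg z) • (2 * Real.pi) := rfl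
        have h2 : exp ((θ : ℂ) * I) = exp (arg z * I) := by
          rw [exp_eq_exp_iff_exists_int]
          refine ⟨-toIocDiv Real.two_pi_pos θ₁ (arg z), ?_⟩
          rw [h1]; push_cast; simp; ring
        rw [exp_add, h2, ← ofReal_exp, Real.exp_log (norm_pos_iff.2 hz0), norm_mul_exp_arg_mul_I]
      have hz1 : ‖z‖ < 1 := by simpa using hz
      have hre : ((Real.log ‖z‖ : ℝ) + θ * I : ℂ).re < 0 := by
        simpa using Real.log_neg (norm_pos_iff.2 hz0) hz1
      have him : ((Real.log ‖z‖ : ℝ) + θ * I : ℂ).im = θ := by simp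
      have hnot : ∀ φ : ℝ, exp ((θ:ℂ) * I) = exp (φ * I) → z ∈ rayS φ := by
        intro φ e
        refine ⟨‖z‖, ⟨norm_nonneg _, hz1.le⟩, ?_⟩
        beta_reduce
        rw [← e]
        conv_rhs => rw [← hzθ]
        rw [exp_add, ← ofReal_exp, Real.exp_log (norm_pos_iff.2 hz0)]
      have hne2 : θ ≠ θ₂ := by
        intro e
        exact hy (Or.inr ⟨z, hnot θ₂ (by rw [e]), rfl⟩)
      have hne1 : θ ≠ θ₁ + 2 * Real.pi := by
        intro e
        refine hy (Or.inl ⟨z, hnot θ₁ ?_, rfl⟩)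
        rw [exp_eq_exp_iff_exists_int]
        exact ⟨1, by rw [e]; push_cast; ring⟩
      have fin : ∀ a b θ₀ : ℝ, θ₀ ∈ Ioo a b → k (exp (θ₀ * I)) ≠ w →
          (∀ θ ∈ Ioo a b, θ ∈ Ioo θ₁ θ₂ ∨ θ ∈ Ioo θ₂ (θ₁ + 2 * Real.pi)) → θ ∈ Ioo a b →
          ∃ t ⊆ Cᶜ, k (exp (θa * I)) ∈ t ∧ k z ∈ t ∧ IsPreconnected t := by
        intro a b θ₀ h1 h2 h3 h4
        obtain ⟨S, hS1, hS2, hS3, hS4⟩ := hsector a b θ₀ h1 h2 h3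
        refine ⟨(range γ \ {w}) ∪ S, union_subset hJwC hS1, Or.inl hjJ, Or.inr ?_,
          hJw.union _ (⟨h.sphere_mem _, h2⟩ : k (exp (θ₀ * I)) ∈ range γ \ {w}) hS2 hS3⟩
        rw [← hzθ]
        exact hS4 _ hre (by rw [him]; exact h4)
      rcases lt_or_gt_of_ne hne2 with h1 | h1
      · exact fin θ₁ θ₂ θa ha haw (fun _ h => Or.inl h) ⟨hθm.1, h1⟩
      · exact fin θ₂ _ θb hb hbw (fun _ h => Or.inr h) ⟨h1, lt_of_le_of_ne hθm.2 hne1⟩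
    · set V := pathComponentIn Cᶜ y with hV
      have hVC : V ⊆ Cᶜ := pathComponentIn_subset
      have hyV : y ∈ V := mem_pathComponentIn_self hy
      have hVp : IsPreconnected V := (isPathConnected_pathComponentIn hy).isConnected.isPreconnected
      have hVo : IsOpen V := hCcomp.isClosed.isOpen_compl.pathComponentIn y
      have hVcl : closure V ⊆ V ∪ C := frontier_pathComponentIn hCcomp.isClosed y
      by_cases hne : (V ∩ (range γ \ {w})).Nonempty
      · obtain ⟨j, hjV, hj⟩ := hne
        exact ⟨V ∪ (range γ \ {w}), union_subset hVC hJwC, Or.inr hjJ, Or.inl hyV,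
          hVp.union j hjV hj hJw⟩
      · exfalso
        have hVJ : ∀ x ∈ V, x ∉ range γ := fun x hx hxJ =>
          hne ⟨x, hx, hxJ, fun e => hVC hx (by rw [mem_singleton_iff.1 e]; exact hwC)⟩
        have hVD : ∀ x ∈ V, x ∉ D := by
          intro x hx hxD
          obtain ⟨z, hz1, hz2, hz3⟩ := crossing hVp h.hD.op hx hxD hyV hyD
          rw [h.hD.clo] at hz2
          exact hVJ z hz1 (hz2.resolve_left hz3)
        have hVD' : closure V ⊆ Dᶜ := closure_minimal hVD h.hD.op.isClosed_compl
        have hcon : IsPreconnected ({w}ᶜ : Set ℂ) :=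
          (isConnected_compl_singleton_of_one_lt_rank (by simp) w).isPreconnected
        obtain ⟨z, hz1, hz2, hz3⟩ := crossing hcon hVo (p := y) (q := k 0) (fun e => hy (by rw [mem_singleton_iff.1 e]; exact hwC)) hyV
          (by exact h0w) (fun h' => hVC h' h0C)
        exact hz1 ((hCD z ((hVcl hz2).resolve_left hz3)).resolve_left (hVD' hz2))
  -- contradiction
  subst hw1
  have := L6 h0w α (β.cast rfl hw2.symm)
  rw [Path.cast_coe, hα, hβ] at this
  refine this ?_ hpre
  rintro x ⟨⟨z, hz, rfl⟩, ⟨z', hz', e⟩⟩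
  rcases rayS_ball hz with h1 | h1
  · rcases rayS_ball hz' with h1' | h1'
    · have e1 := h.ki h1' h1 e
      left
      obtain ⟨t, ht, rfl⟩ := hz
      obtain ⟨t', ht', rfl⟩ := hz'
      beta_reduce at e1 ⊢
      rcases eq_or_lt_of_le ht.1 with h2 | h2
      · rw [← h2]; simp
      · exfalso
        have h3 : exp ((Real.log t : ℝ) + θ₁ * I) = t' * exp (θ₂ * I) := by
          rw [exp_add, ← ofReal_exp, Real.exp_log h2, e1]
        obtain ⟨n, hn⟩ := ray_im ht'.1 h3
        have h4 : ((Real.log t : ℝ) + θ₁ * I : ℂ).im = θ₁ := by simp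
        rw [h4] at hn
        exact not_int_between (x := θ₂ - θ₁) (n := -n) (by linarith) (by linarith) (by push_cast; linarith)
    · right; rw [mem_singleton_iff, ← e, h1', hw2]
  · right; rw [h1]; rfl

theorem CE.inj_sphere (h : CE γ D k) {θ₁ θ₂ : ℝ} (h12 : θ₁ < θ₂) (h21 : θ₂ < θ₁ + 2 * Real.pi)
    (he : k (exp (θ₁ * I)) = k (exp (θ₂ * I))) : False := by
  by_cases hA : ∀ θ ∈ Ioo θ₁ θ₂, k (exp (θ * I)) = k (exp (θ₁ * I))
  · exact h.not_const (h.sphere_mem θ₁) h12 hA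
  by_cases hB : ∀ θ ∈ Ioo θ₂ (θ₁ + 2 * Real.pi), k (exp (θ * I)) = k (exp (θ₁ * I))
  · exact h.not_const (h.sphere_mem θ₁) h21 hB
  push Not at hA hB
  obtain ⟨a, ha, ha'⟩ := hA
  obtain ⟨b, hb, hb'⟩ := hB
  exact h.arc_const h12 h21 rfl he.symm ha hb ha' hb'

theorem CE.inj (h : CE γ D k) : InjOn k (closedBall 0 1) := by
  intro z hz w hw e
  rw [← ball_union_sphere] at hz hw
  rcases hz with hz | hz <;> rcases hw with hw | hw
  · exact h.ki hz hw e
  · exfalso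
    have h1 := h.ball_mem hz
    have h2 : k w ∈ range γ := by rw [← h.kJ]; exact ⟨w, hw, rfl⟩
    exact h.hD.disj h1 (e ▸ h2)
  · exfalso
    have h1 := h.ball_mem hw
    have h2 : k z ∈ range γ := by rw [← h.kJ]; exact ⟨z, hz, rfl⟩
    exact h.hD.disj h1 (e ▸ h2)
  · have pol : ∀ v ∈ sphere (0:ℂ) 1, exp (arg v * I) = v := by
      intro v hv
      have := norm_mul_exp_arg_mul_I v
      rw [mem_sphere_zero_iff_norm.1 hv] at this; simpa using this
    rw [← pol z hz, ← pol w hw] at e ⊢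
    have b1 := neg_pi_lt_arg z
    have b2 := neg_pi_lt_arg w
    have b3 := arg_le_pi z
    have b4 := arg_le_pi w
    rcases lt_trichotomy (arg z) (arg w) with h1 | h1 | h1
    · exact (h.inj_sphere h1 (by linarith) e).elim
    · rw [h1]
    · exact (h.inj_sphere h1 (by linarith) e.symm).elim

/-- Jordan–Schoenflies–Carathéodory for the bounded side. -/
theorem IsJ.disc (hJ : IsJ γ) : ∃ (D : Set ℂ) (k : ℂ → ℂ), IsDom γ D ∧ ContinuousOn k (closedBall 0 1) ∧
    InjOn k (closedBall 0 1) ∧ k '' ball 0 1 = D ∧ k '' sphere 0 1 = range γ := by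
  obtain ⟨D, hD⟩ := hJ.exists_dom
  obtain ⟨f, g, h1, h2, h3, h4, h5, h6⟩ := (hD.rd hJ).riemann hD.pc.nonempty
  obtain ⟨k, hk⟩ := (RM.mk hJ hD h1 h2 h3 h4 h5 h6).ext
  exact ⟨D, k, hD, hk.kc, hk.inj, hk.kD, hk.kJ⟩
end FI

namespace FI
open Set Complex Metric Topology Filter

abbrev S2 : Type := ↥(Metric.sphere (0 : EuclideanSpace ℝ (Fin 3)) 1)

theorem stereo (v : S2) : ∃ (φ : S2 → ℂ) (ψ : ℂ → S2), ContinuousOn φ {v}ᶜ ∧ Continuous ψ ∧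
    (∀ x, x ≠ v → ψ (φ x) = x) ∧ ∀ z, ψ z ≠ v ∧ φ (ψ z) = z := by
  have : Fact (Module.finrank ℝ (EuclideanSpace ℝ (Fin 3)) = 2 + 1) := ⟨by simp⟩
  set L := Complex.orthonormalBasisOneI.repr
  set s := stereographic' 2 v with hs
  have h1 : s.source = {v}ᶜ := stereographic'_source v
  have h2 : s.target = univ := stereographic'_target v
  refine ⟨fun x => L.symm (s x), fun z => s.symm (L z), ?_, ?_, ?_, ?_⟩
  · exact L.symm.continuous.comp_continuousOn (h1 ▸ s.continuousOn)
  · have := s.continuousOn_symm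
    rw [h2] at this
    exact (continuousOn_univ.1 this).comp L.continuous
  · intro x hx
    simp only [LinearIsometryEquiv.apply_symm_apply]
    exact s.left_inv (by rw [h1]; exact hx)
  · intro z
    have hz : L z ∈ s.target := by rw [h2]; trivial
    refine ⟨?_, ?_⟩
    · have := s.map_target hz
      rw [h1] at this; exact this
    · simp only [s.right_inv hz, LinearIsometryEquiv.symm_apply_apply]

theorem infinite_S2 : Infinite S2 := by
  obtain ⟨φ, ψ, -, -, -, h⟩ := stereo ⟨EuclideanSpace.single 0 1, by simp⟩
  exact Infinite.of_injective ψ (fun a b e => by rw [← (h a).2, ← (h b).2, e])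

variable {T : S2 → S2}

theorem arc_exists (hT : Continuous T) (hTT : ∀ x, T (T x) = x) (hfree : ∀ x, T x ≠ x) :
    ∃ Q : ℝ → S2, Continuous Q ∧ Function.Injective Q ∧ Q 1 = T (Q 0) ∧
      ∀ u ∈ Icc (0:ℝ) 1, ∀ v ∈ Icc (0:ℝ) 1, Q u = T (Q v) → 1 ≤ |u - v| := by
  classical
  have := infinite_S2
  obtain ⟨x⟩ : Nonempty S2 := inferInstance
  obtain ⟨v, hv⟩ := Infinite.exists_notMem_finset ({x, T x} : Finset S2)
  simp only [Finset.mem_insert, Finset.mem_singleton, not_or] at hv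
  obtain ⟨φ, ψ, hφ, hψ, h1, h2⟩ := stereo v
  have hψi : Function.Injective ψ := fun a b e => by rw [← (h2 a).2, ← (h2 b).2, e]
  have hne : φ (T x) - φ x ≠ 0 := by
    intro h
    apply hfree x
    rw [← h1 (T x) (Ne.symm hv.2), sub_eq_zero.1 h, h1 x (Ne.symm hv.1)]
  set P : ℝ → S2 := fun s => ψ (φ x + s * (φ (T x) - φ x)) with hP
  have hPc : Continuous P := hψ.comp (by fun_prop)
  have hPi : Function.Injective P := by
    intro a b e
    have := hψi e
    have := mul_right_cancel₀ hne (add_left_cancel this)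
    exact_mod_cast this
  have hP0 : P 0 = x := by simp [hP, h1 x (Ne.symm hv.1)]
  have hP1 : P 1 = T x := by simp [hP, h1 (T x) (Ne.symm hv.2)]
  set K : Set (ℝ × ℝ) := (Icc 0 1 ×ˢ Icc 0 1) ∩ {p | P p.2 = T (P p.1)} with hK
  have hKc : IsCompact K := (isCompact_Icc.prod isCompact_Icc).inter_right
    (isClosed_eq (hPc.comp continuous_snd) (hT.comp (hPc.comp continuous_fst)))
  obtain ⟨p, hp, hmin⟩ := hKc.exists_isMinOn (f := fun p : ℝ × ℝ => |p.2 - p.1|)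
    ⟨(0, 1), ⟨by simp, by simp⟩, by simp [hP0, hP1]⟩ (by fun_prop)
  obtain ⟨s, t, hst, hsK, htK, hPst, hm⟩ : ∃ s t : ℝ, s < t ∧ s ∈ Icc (0:ℝ) 1 ∧ t ∈ Icc (0:ℝ) 1 ∧ P t = T (P s) ∧
      ∀ s' ∈ Icc (0:ℝ) 1, ∀ t' ∈ Icc (0:ℝ) 1, P t' = T (P s') → t - s ≤ |t' - s'| := by
    have hmin' : ∀ s' ∈ Icc (0:ℝ) 1, ∀ t' ∈ Icc (0:ℝ) 1, P t' = T (P s') → |p.2 - p.1| ≤ |t' - s'| :=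
      fun s' hs' t' ht' e => hmin (⟨⟨hs', ht'⟩, e⟩ : (s', t') ∈ K)
    have hpe : P p.2 = T (P p.1) := hp.2
    rcases lt_trichotomy p.1 p.2 with h | h | h
    · refine ⟨p.1, p.2, h, hp.1.1, hp.1.2, hpe, fun s' hs' t' ht' e => ?_⟩
      have := hmin' s' hs' t' ht' e
      rwa [abs_of_pos (by linarith : 0 < p.2 - p.1)] at this
    · rw [h] at hpe; exact absurd hpe.symm (hfree _)
    · refine ⟨p.2, p.1, h, hp.1.2, hp.1.1, by rw [hpe, hTT], fun s' hs' t' ht' e => ?_⟩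
      have := hmin' s' hs' t' ht' e
      rwa [abs_of_neg (by linarith : p.2 - p.1 < 0), neg_sub] at this
  have hd : 0 < t - s := by linarith
  refine ⟨fun u => P (s + u * (t - s)), hPc.comp (by fun_prop), ?_, ?_, ?_⟩
  · intro a b e
    exact mul_right_cancel₀ hd.ne' (add_left_cancel (hPi e))
  · simp only [one_mul, zero_mul, add_zero, add_sub_cancel]; exact hPst
  · intro u hu v hv e
    have hI : ∀ u ∈ Icc (0:ℝ) 1, s + u * (t - s) ∈ Icc (0:ℝ) 1 := by
      intro u hu
      refine ⟨by nlinarith [hu.1, hsK.1], ?_⟩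
      have : u * (t - s) ≤ 1 * (t - s) := by gcongr; exact hu.2
      linarith [htK.2]
    have := hm _ (hI v hv) _ (hI u hu) e
    have e2 : s + u * (t - s) - (s + v * (t - s)) = (u - v) * (t - s) := by ring
    rw [e2, abs_mul, abs_of_pos hd] at this
    by_contra hc
    push Not at hc
    nlinarith

structure IsG (T : S2 → S2) (Γ : ℝ → S2) : Prop where
  cont : Continuous Γ
  inj : ∀ u v, Γ u = Γ v ↔ ∃ n : ℤ, u - v = n
  half : ∀ u, Γ (u + 1 / 2) = T (Γ u)

theorem curve_exists (hT : Continuous T) (hTT : ∀ x, T (T x) = x) (hfree : ∀ x, T x ≠ x) :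
    ∃ Γ, IsG T Γ := by
  obtain ⟨Q, hQ, hQi, hQ1, hQm⟩ := arc_exists hT hTT hfree
  have hTi : Function.Injective T := fun a b e => by rw [← hTT a, e, hTT]
  set F : ℝ → S2 := fun u => if u ≤ 1 / 2 then Q (2 * u) else T (Q (2 * u - 1)) with hF
  have hFc : Continuous F := by
    apply Continuous.if_le (by fun_prop) (by fun_prop) (by fun_prop) (by fun_prop)
    rintro u rfl
    norm_num [hQ1]
  have hF01 : F 0 = F 1 := by
    norm_num [hF, hQ1, hTT]
  have hFlow : ∀ u, u ≤ 1 / 2 → F u = Q (2 * u) := fun u hu => by simp only [hF]; rw [if_pos hu]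
  have hFhigh : ∀ u, 1 / 2 ≤ u → F u = T (Q (2 * u - 1)) := by
    intro u hu
    rcases hu.eq_or_lt with rfl | h
    · norm_num [hF, hQ1]
    · simp only [hF]; rw [if_neg (not_le.2 h)]
  have hmix : ∀ u v : ℝ, 0 ≤ u → u ≤ 1 / 2 → 1 / 2 < v → v < 1 → F u ≠ F v := by
    intro u v h0 h1 h2 h3 e
    rw [hFlow u h1, hFhigh v h2.le] at e
    have := hQm _ ⟨by linarith, by linarith⟩ _ ⟨by linarith, by linarith⟩ e
    have : |2 * u - (2 * v - 1)| < 1 := by rw [abs_lt]; constructor <;> linarith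
    linarith
  have hFi : ∀ u v : ℝ, 0 ≤ u → u < 1 → 0 ≤ v → v < 1 → F u = F v → u = v := by
    intro u v h0 h1 h2 h3 e
    rcases le_or_gt u (1/2) with hu | hu <;> rcases le_or_gt v (1/2) with hv | hv
    · rw [hFlow u hu, hFlow v hv] at e
      linarith [hQi e]
    · exact absurd e (hmix u v h0 hu hv h3)
    · exact absurd e.symm (hmix v u h2 hv hu h1)
    · rw [hFhigh u hu.le, hFhigh v hv.le] at e
      linarith [hQi (hTi e)]
  refine ⟨F ∘ Int.fract, ?_, ?_, ?_⟩
  · exact hFc.continuousOn.comp_fract'' hF01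
  · intro u v
    constructor
    · intro e
      have := hFi _ _ (Int.fract_nonneg u) (Int.fract_lt_one u) (Int.fract_nonneg v) (Int.fract_lt_one v) e
      exact Int.fract_eq_fract.1 this
    · intro h
      simp only [Function.comp, Int.fract_eq_fract.2 h]
  · intro u
    simp only [Function.comp]
    have h0 := Int.fract_nonneg u
    have h1 := Int.fract_lt_one u
    rcases lt_or_ge (Int.fract u) (1/2) with h | h
    · have e : Int.fract (u + 1/2) = Int.fract u + 1/2 := by
        rw [Int.fract_eq_iff]
        refine ⟨by linarith, by linarith, ⌊u⌋, ?_⟩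
        rw [Int.fract]; ring
      rw [e, hFhigh _ (by linarith), hFlow _ h.le]
      congr 2; ring
    · have e : Int.fract (u + 1/2) = Int.fract u - 1/2 := by
        rw [Int.fract_eq_iff]
        refine ⟨by linarith, by linarith, ⌊u⌋ + 1, ?_⟩
        push_cast
        rw [Int.fract]; ring
      rw [e, hFlow _ (by linarith), hFhigh _ h, hTT]
      congr 1; ring

variable {Γ : ℝ → S2}

theorem IsG.mem_Icc (h : IsG T Γ) (u : ℝ) : ∃ v ∈ Icc (0:ℝ) 1, Γ v = Γ u :=
  ⟨Int.fract u, ⟨Int.fract_nonneg _, (Int.fract_lt_one _).le⟩,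
    (h.inj _ _).2 ⟨-⌊u⌋, by push_cast; rw [Int.fract]; ring⟩⟩

theorem IsG.not_surj (h : IsG T Γ) : ∃ v, v ∉ range Γ := by
  by_contra hcon
  push Not at hcon
  have hne : ∀ u v : ℝ, |u - v| < 1 → u ≠ v → Γ u ≠ Γ v := by
    intro u v h1 h2 e
    obtain ⟨n, hn⟩ := (h.inj u v).1 e
    rw [hn] at h1
    have : |n| < 1 := by exact_mod_cast h1
    rw [Int.abs_lt_one_iff.1 this] at hn
    apply h2; simp at hn; linarith
  have h01 : Γ 1 = Γ 0 := (h.inj _ _).2 ⟨1, by simp⟩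
  obtain ⟨φ, ψ, hφ, hψ, h1, h2⟩ := stereo (Γ 0)
  set w := φ (Γ (1/2)) with hw
  have hcon2 : IsPreconnected ({w}ᶜ : Set ℂ) :=
    (isConnected_compl_singleton_of_one_lt_rank (by simp) w).isPreconnected
  have hC : IsPreconnected (ψ '' {w}ᶜ) := hcon2.image _ hψ.continuousOn
  have hmem : ∀ x, x ≠ Γ 0 → x ≠ Γ (1/2) → x ∈ ψ '' {w}ᶜ := by
    intro x hx hx'
    refine ⟨φ x, ?_, h1 x hx⟩
    intro e
    apply hx'
    rw [← h1 x hx, mem_singleton_iff.1 e, hw, h1]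
    exact hne _ _ (by norm_num [abs_lt]) (by norm_num)
  have hmem' : ∀ x ∈ ψ '' {w}ᶜ, x ≠ Γ 0 ∧ x ≠ Γ (1/2) := by
    rintro _ ⟨z, hz, rfl⟩
    refine ⟨(h2 z).1, fun e => hz ?_⟩
    rw [mem_singleton_iff, hw, ← e, (h2 z).2]
  set A := Γ '' Icc 0 (1/2) with hA
  set B := Γ '' Icc (1/2) 1 with hB
  have hAc : IsClosed A := (isCompact_Icc.image h.cont).isClosed
  have hBc : IsClosed B := (isCompact_Icc.image h.cont).isClosed
  have hABu : ∀ x, x ∈ A ∨ x ∈ B := by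
    intro x
    obtain ⟨u, rfl⟩ := hcon x
    obtain ⟨v, hv, e⟩ := h.mem_Icc u
    rcases le_total v (1/2) with h' | h'
    · exact Or.inl ⟨v, ⟨hv.1, h'⟩, e⟩
    · exact Or.inr ⟨v, ⟨h', hv.2⟩, e⟩
  have hABi : ∀ x, x ∈ A → x ∈ B → x = Γ 0 ∨ x = Γ (1/2) := by
    rintro _ ⟨u, hu, rfl⟩ ⟨v, hv, e⟩
    by_cases huv : u = v
    · right; congr 1; linarith [hu.2, hv.1]
    by_cases hl : |v - u| < 1
    · exact absurd e (hne v u hl (Ne.symm huv))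
    · left; congr 1
      rw [abs_of_nonneg (by linarith [hu.2, hv.1])] at hl
      linarith [hu.1, hv.2]
  obtain ⟨z, hz1, hz2, hz3⟩ := crossing hC (D := Bᶜ) hBc.isOpen_compl (p := Γ (1/4)) (q := Γ (3/4))
    (hmem _ (hne _ _ (by norm_num [abs_lt]) (by norm_num)) (hne _ _ (by norm_num [abs_lt]) (by norm_num)))
    (fun hB' => by
      rcases hABi (Γ (1/4)) ⟨1/4, by norm_num, rfl⟩ hB' with e | e
      · exact hne _ _ (by norm_num [abs_lt]) (by norm_num) e
      · exact hne _ _ (by norm_num [abs_lt]) (by norm_num) e)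
    (hmem _ (hne _ _ (by norm_num [abs_lt]) (by norm_num)) (hne _ _ (by norm_num [abs_lt]) (by norm_num)))
    (fun hB' => hB' ⟨3/4, by norm_num, rfl⟩)
  have hzA : z ∈ A := closure_minimal (fun x hx => (hABu x).resolve_right hx) hAc hz2
  have hzB : z ∈ B := not_not.1 hz3
  have := hmem' z hz1
  rcases hABi z hzA hzB with e | e
  · exact this.1 e
  · exact this.2 e
end FI

namespace FI
open Set Complex Metric Topology Filter

variable {T : S2 → S2} {Γ : ℝ → S2}

theorem IsG.disc (h : IsG T Γ) : ∃ k : ℂ → S2, ContinuousOn k (closedBall 0 1) ∧ InjOn k (closedBall 0 1) ∧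
    IsOpen (k '' ball 0 1) ∧ k '' sphere 0 1 = range Γ := by
  obtain ⟨v, hv⟩ := h.not_surj
  obtain ⟨φ, ψ, hφ, hψ, h1, h2⟩ := stereo v
  have hψi : Function.Injective ψ := fun a b e => by rw [← (h2 a).2, ← (h2 b).2, e]
  have hΓv : ∀ u, Γ u ≠ v := fun u e => hv ⟨u, e⟩
  have hJ : IsJ (φ ∘ Γ) := by
    refine ⟨hφ.comp_continuous h.cont (fun u => hΓv u), fun u w => ?_⟩
    rw [← h.inj]
    constructor
    · intro e
      rw [← h1 _ (hΓv u), ← h1 _ (hΓv w)]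
      exact congrArg ψ e
    · intro e; simp only [Function.comp, e]
  obtain ⟨D, k, hD, hkc, hki, hkD, hkJ⟩ := hJ.disc
  refine ⟨ψ ∘ k, hψ.comp_continuousOn hkc, hψi.comp_injOn hki, ?_, ?_⟩
  · rw [image_comp, hkD]
    have : ψ '' D = {v}ᶜ ∩ φ ⁻¹' D := by
      apply Subset.antisymm
      · rintro _ ⟨z, hz, rfl⟩
        exact ⟨(h2 z).1, by rw [mem_preimage, (h2 z).2]; exact hz⟩
      · rintro x ⟨hx, hx'⟩
        exact ⟨φ x, hx', h1 x hx⟩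
    rw [this]
    exact hφ.isOpen_inter_preimage isOpen_compl_singleton hD.op
  · rw [image_comp, hkJ, ← range_comp]
    congr 1
    ext u : 1
    exact h1 _ (hΓv u)

/-- The circle parametrisation. -/
noncomputable def circ (Γ : ℝ → S2) (z : ℂ) : S2 := Γ (arg z / (2 * Real.pi))

theorem IsG.periodic (h : IsG T Γ) : Function.Periodic (fun θ : ℝ => Γ (θ / (2 * Real.pi))) (2 * Real.pi) := by
  intro θ
  beta_reduce
  rw [h.inj]
  refine ⟨1, ?_⟩
  have := Real.two_pi_pos
  field_simp
  simp

theorem IsG.circ_cont (h : IsG T Γ) {z : ℂ} (hz : z ≠ 0) : ContinuousAt (circ Γ) z := by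
  have hl : Continuous (h.periodic.lift) := by
    apply Continuous.quotient_liftOn'
    exact h.cont.comp (by fun_prop)
  exact ContinuousAt.comp (g := (h.periodic.lift : Real.Angle → S2)) hl.continuousAt (continuousAt_arg_coe_angle hz)

theorem IsG.circ_neg (h : IsG T Γ) {z : ℂ} (hz : z ≠ 0) : circ Γ (-z) = T (circ Γ z) := by
  have e : circ Γ (-z) = (h.periodic.lift : Real.Angle → S2) (arg (-z) : Real.Angle) := rfl
  rw [e, arg_neg_coe_angle hz, ← Real.Angle.coe_add]
  have e2 : (h.periodic.lift : Real.Angle → S2) ((arg z + Real.pi : ℝ) : Real.Angle) = Γ ((arg z + Real.pi) / (2 * Real.pi)) := rfl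
  rw [e2, circ, ← h.half]
  congr 1
  have := Real.pi_pos
  field_simp

theorem IsG.circ_inj (h : IsG T Γ) {z w : ℂ} (e : circ Γ z = circ Γ w) : arg z = arg w := by
  obtain ⟨n, hn⟩ := (h.inj _ _).1 e
  have := Real.two_pi_pos
  have h1 : arg z - arg w = n * (2 * Real.pi) := by rw [← hn]; field_simp
  have b1 := neg_pi_lt_arg z
  have b2 := neg_pi_lt_arg w
  have b3 := arg_le_pi z
  have b4 := arg_le_pi w
  rcases lt_trichotomy (arg z) (arg w) with h2 | h2 | h2
  · exact (not_int_between (x := arg w - arg z) (n := -n) (by linarith) (by linarith) (by push_cast; linarith)).elim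
  · exact h2
  · exact (not_int_between (x := arg z - arg w) (n := n) (by linarith) (by linarith) (by linarith)).elim

theorem halfdisc (hT : Continuous T) (hTT : ∀ x, T (T x) = x) (hfree : ∀ x, T x ≠ x) :
    ∃ E : ℂ → S2, ContinuousOn E (closedBall 0 1) ∧ InjOn E (closedBall 0 1) ∧
      (∀ z ∈ sphere (0:ℂ) 1, E (-z) = T (E z)) ∧
      ∀ z ∈ ball (0:ℂ) 1, ∀ w ∈ closedBall (0:ℂ) 1, T (E z) ≠ E w := by
  obtain ⟨Γ, h⟩ := curve_exists hT hTT hfree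
  obtain ⟨k, hkc, hki, hko, hkJ⟩ := h.disc
  have hTJ : ∀ x, x ∈ range Γ → T x ∈ range Γ := by
    rintro _ ⟨u, rfl⟩; exact ⟨_, h.half u⟩
  have hDJ : ∀ z ∈ ball (0:ℂ) 1, k z ∉ range Γ := by
    intro z hz hc
    rw [← hkJ] at hc
    obtain ⟨w, hw, e⟩ := hc
    have := hki (sphere_subset_closedBall hw) (ball_subset_closedBall hz) e
    rw [this] at hw
    simp at hw hz; linarith
  have hsplit : ∀ z ∈ closedBall (0:ℂ) 1, z ∈ ball (0:ℂ) 1 ∨ z ∈ sphere (0:ℂ) 1 := by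
    intro z hz; rw [← ball_union_sphere] at hz; exact hz
  have hkcl : closure (k '' ball 0 1) ⊆ k '' closedBall 0 1 :=
    closure_minimal (image_mono ball_subset_closedBall) ((isCompact_closedBall (0:ℂ) 1).image_of_continuousOn hkc).isClosed
  -- T D ∩ D = ∅
  have hTD : ∀ z ∈ ball (0:ℂ) 1, T (k z) ∉ k '' ball 0 1 := by
    intro z₀ hz₀ hcon
    have hsub : ∀ z ∈ ball (0:ℂ) 1, T (k z) ∈ k '' ball 0 1 := by
      intro z hz
      by_contra hc
      have hpre : IsPreconnected ((fun z => T (k z)) '' ball 0 1) :=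
        (convex_ball (0:ℂ) 1).isPreconnected.image _ (hT.comp_continuousOn (hkc.mono ball_subset_closedBall))
      obtain ⟨x, ⟨y, hy, rfl⟩, hx2, hx3⟩ := crossing hpre hko (mem_image_of_mem (fun z => T (k z)) hz₀) hcon (mem_image_of_mem (fun z => T (k z)) hz) hc
      obtain ⟨y', hy', e⟩ := hkcl hx2
      have hy'' : y' ∈ sphere (0:ℂ) 1 := (hsplit y' hy').resolve_left (fun hb => hx3 ⟨y', hb, e⟩)
      have h1 : T (k y) ∈ range Γ := by rw [← hkJ]; exact ⟨y', hy'', e⟩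
      have h2 := hTJ _ h1
      rw [hTT] at h2
      exact hDJ y hy h2
    have hsub2 : ∀ z ∈ closedBall (0:ℂ) 1, T (k z) ∈ k '' closedBall 0 1 := by
      intro z hz
      rcases hsplit z hz with hz | hz
      · exact image_mono ball_subset_closedBall (hsub z hz)
      · apply image_mono sphere_subset_closedBall
        rw [hkJ]
        apply hTJ
        rw [← hkJ]; exact ⟨z, hz, rfl⟩
    set κ := Function.invFunOn k (closedBall 0 1) with hκ
    have hκ1 : ∀ x ∈ k '' closedBall 0 1, k (κ x) = x := fun x hx => Function.invFunOn_eq hx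
    have hκ2 : ∀ x ∈ k '' closedBall 0 1, κ x ∈ closedBall (0:ℂ) 1 := fun x hx => Function.invFunOn_mem hx
    refine no_free_involution_disc (τ := fun z => κ (T (k z))) ?_ ?_ ?_ ?_
    · exact (continuousOn_inv_of_compact (isCompact_closedBall _ _) hkc hki).comp (hT.comp_continuousOn hkc) hsub2
    · exact fun z hz => hκ2 _ (hsub2 z hz)
    · intro z hz
      beta_reduce
      rw [hκ1 _ (hsub2 z hz), hTT]
      exact hki (hκ2 _ ⟨z, hz, rfl⟩) hz (hκ1 _ ⟨z, hz, rfl⟩)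
    · intro z hz e
      apply hfree (k z)
      rw [← hκ1 _ (hsub2 z hz)]
      exact congrArg k e
  -- the reparametrisation
  set κ := Function.invFunOn k (closedBall 0 1) with hκ
  have hκ1 : ∀ x ∈ k '' closedBall 0 1, k (κ x) = x := fun x hx => Function.invFunOn_eq hx
  have hκc : ContinuousOn κ (k '' closedBall 0 1) := continuousOn_inv_of_compact (isCompact_closedBall _ _) hkc hki
  have hJk : ∀ z, circ Γ z ∈ k '' closedBall 0 1 := by
    intro z
    apply image_mono sphere_subset_closedBall
    rw [hkJ]; exact ⟨_, rfl⟩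
  have hκs : ∀ z, ‖κ (circ Γ z)‖ = 1 := by
    intro z
    have : circ Γ z ∈ k '' sphere 0 1 := by rw [hkJ]; exact ⟨_, rfl⟩
    obtain ⟨y, hy, e⟩ := this
    have h1 : κ (circ Γ z) = y := hki (Function.invFunOn_mem (hJk z)) (sphere_subset_closedBall hy) (by rw [hκ1 _ (hJk z), e])
    rw [h1]; simpa using hy
  set e : ℂ → ℂ := fun z => ‖z‖ * κ (circ Γ z) with he
  have hen : ∀ z, ‖e z‖ = ‖z‖ := by
    intro z; simp [he, hκs]
  have heC : Continuous e := by
    rw [continuous_iff_continuousAt]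
    intro z
    by_cases hz : z = 0
    · subst hz
      have h0 : e 0 = 0 := by simp [he]
      rw [ContinuousAt, h0, tendsto_zero_iff_norm_tendsto_zero]
      simp only [hen]
      simpa using (continuous_norm (E := ℂ)).tendsto 0
    · refine ContinuousAt.mul (by fun_prop) ?_
      have h1 : ContinuousWithinAt κ (k '' closedBall 0 1) (circ Γ z) := hκc _ (hJk z)
      exact h1.comp_of_preimage_mem_nhdsWithin (s := univ) (f := circ Γ) (h.circ_cont hz).continuousWithinAt
        (by rw [nhdsWithin_univ]; exact Filter.univ_mem' hJk) |>.continuousAt univ_mem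
  have hei : Function.Injective e := by
    intro z w hzw
    have hn : ‖z‖ = ‖w‖ := by rw [← hen z, hzw, hen]
    by_cases hz : z = 0
    · rw [hz, norm_zero] at hn
      rw [hz, norm_eq_zero.1 hn.symm]
    · have hne : (‖z‖ : ℂ) ≠ 0 := by simpa using hz
      simp only [he] at hzw
      rw [← hn] at hzw
      have h1 := congrArg k (mul_left_cancel₀ hne hzw)
      rw [hκ1 _ (hJk z), hκ1 _ (hJk w)] at h1
      exact Complex.ext_norm_arg hn (h.circ_inj h1)
  have heb : MapsTo e (closedBall 0 1) (closedBall 0 1) := by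
    intro z hz; rw [mem_closedBall_zero_iff] at hz ⊢; rwa [hen]
  have hEs : ∀ z ∈ sphere (0:ℂ) 1, k (e z) = circ Γ z := by
    intro z hz
    rw [mem_sphere_zero_iff_norm] at hz
    simp only [he, hz, ofReal_one, one_mul]
    exact hκ1 _ (hJk z)
  have hebb : ∀ z ∈ ball (0:ℂ) 1, e z ∈ ball (0:ℂ) 1 := by
    intro z hz; rw [mem_ball_zero_iff] at hz ⊢; rwa [hen]
  refine ⟨k ∘ e, hkc.comp heC.continuousOn heb, hki.comp hei.injOn heb, ?_, ?_⟩
  · intro z hz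
    have hz0 : z ≠ 0 := by rintro rfl; simp at hz
    simp only [Function.comp]
    rw [hEs z hz, hEs (-z) (by simpa using hz), h.circ_neg hz0]
  · intro z hz w hw heq
    simp only [Function.comp] at heq
    rcases hsplit w hw with hw | hw
    · exact hTD _ (hebb z hz) ⟨e w, hebb w hw, heq.symm⟩
    · have h1 : T (k (e z)) ∈ range Γ := by rw [heq, hEs w hw]; exact ⟨_, rfl⟩
      have h2 := hTJ _ h1
      rw [hTT] at h2
      exact hDJ _ (hebb z hz) h2

theorem cover (hT : Continuous T) (hTT : ∀ x, T (T x) = x) (hfree : ∀ x, T x ≠ x) {E : ℂ → S2}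
    (hE : ContinuousOn E (closedBall 0 1)) (hEs : ∀ z ∈ sphere (0:ℂ) 1, E (-z) = T (E z)) (r : S2) :
    ∃ z ∈ closedBall (0:ℂ) 1, E z = r ∨ T (E z) = r := by
  by_contra! hcon
  obtain ⟨φ, ψ, hφ, hψ, h1, h2⟩ := stereo r
  refine no_odd_disc (f := fun z => φ (E z) - φ (T (E z))) ?_ ?_ ?_
  · exact (hφ.comp hE (fun z hz => (hcon z hz).1)).sub
      (hφ.comp (hT.comp_continuousOn hE) (fun z hz => (hcon z hz).2))
  · intro z hz e
    rw [sub_eq_zero] at e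
    apply hfree (E z)
    rw [← h1 _ (hcon z hz).2, ← e, h1 _ (hcon z hz).1]
  · intro z hz
    beta_reduce
    rw [hEs z hz, hTT]; ring
end FI

namespace FI
open Set Complex Metric Topology Filter

variable {T : S2 → S2}

theorem sph_sum (x : S2) : (x.1 0) ^ 2 + (x.1 1) ^ 2 + (x.1 2) ^ 2 = 1 := by
  have h : ‖x.1‖ = 1 := by simpa using x.2
  have h2 := EuclideanSpace.norm_sq_eq x.1
  rw [h, Fin.sum_univ_three] at h2
  simp only [Real.norm_eq_abs, sq_abs] at h2
  linarith

noncomputable def prj (x : S2) : ℂ := ⟨x.1 0, x.1 1⟩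

theorem prj_norm (x : S2) : ‖prj x‖ ^ 2 = 1 - (x.1 2) ^ 2 := by
  rw [← normSq_eq_norm_sq, normSq_apply]
  have := sph_sum x
  simp only [prj]
  linarith

theorem prj_cont : Continuous prj := by
  have h0 : Continuous fun x : S2 => ((x.1 0 : ℝ) : ℂ) + ((x.1 1 : ℝ) : ℂ) * I := by fun_prop
  refine h0.congr fun x => ?_
  apply Complex.ext <;> simp [prj]

theorem prj_mem (x : S2) : prj x ∈ closedBall (0:ℂ) 1 := by
  rw [mem_closedBall_zero_iff]
  have := prj_norm x
  nlinarith [norm_nonneg (prj x), sq_nonneg (x.1 2)]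

theorem prj_neg (x : S2) : prj (-x) = - prj x := by
  apply Complex.ext <;> simp [prj]

theorem prj_inj {x y : S2} (h : prj x = prj y) (h2 : 0 ≤ x.1 2 * y.1 2) : x = y := by
  have h0 : x.1 0 = y.1 0 := congrArg Complex.re h
  have h1 : x.1 1 = y.1 1 := congrArg Complex.im h
  have sx := sph_sum x
  have sy := sph_sum y
  have h3 : x.1 2 ^ 2 = y.1 2 ^ 2 := by rw [h0, h1] at sx; linarith
  have h4 : x.1 2 = y.1 2 := by
    rcases sq_eq_sq_iff_eq_or_eq_neg.1 h3 with h | h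
    · exact h
    · rw [h] at h2
      have : y.1 2 = 0 := by nlinarith [sq_nonneg (y.1 2)]
      rw [h, this, neg_zero]
  apply Subtype.ext
  ext i
  fin_cases i
  exacts [h0, h1, h4]

theorem prj_surj {z : ℂ} (hz : z ∈ closedBall (0:ℂ) 1) : ∃ x : S2, prj x = z ∧ 0 ≤ x.1 2 := by
  rw [mem_closedBall_zero_iff] at hz
  have h1 : 0 ≤ 1 - normSq z := by rw [normSq_eq_norm_sq]; nlinarith [norm_nonneg z]
  refine ⟨⟨!₂[z.re, z.im, Real.sqrt (1 - normSq z)], ?_⟩, ?_, ?_⟩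
  · rw [mem_sphere_zero_iff_norm, EuclideanSpace.norm_eq, Real.sqrt_eq_one, Fin.sum_univ_three]
    simp only [Real.norm_eq_abs, sq_abs]
    simp [Real.sq_sqrt h1]
    rw [normSq_apply]; ring
  · apply Complex.ext <;> simp [prj]
  · simp

theorem main (hT : Continuous T) (hTT : ∀ x, T (T x) = x) (hfree : ∀ x, T x ≠ x) :
    ∃ h : S2 ≃ₜ S2, ∀ x, h (T x) = - h x := by
  obtain ⟨E, hEc, hEi, hEs, hEd⟩ := halfdisc hT hTT hfree
  have hTi : Function.Injective T := fun a b e => by rw [← hTT a, e, hTT]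
  have hEp : Continuous fun x : S2 => E (prj x) := hEc.comp_continuous prj_cont prj_mem
  set Φ : S2 → S2 := fun x => if 0 ≤ x.1 2 then E (prj x) else T (E (prj (-x))) with hΦ
  have hpos : ∀ x : S2, 0 ≤ x.1 2 → Φ x = E (prj x) := fun x hx => by simp only [hΦ]; rw [if_pos hx]
  have hneg : ∀ x : S2, x.1 2 < 0 → Φ x = T (E (prj (-x))) := fun x hx => by
    simp only [hΦ]; rw [if_neg (not_le.2 hx)]
  have hn2 : ∀ x : S2, (-x).1 2 = - x.1 2 := fun x => by simp
  have hbd : ∀ x : S2, x.1 2 = 0 → E (prj (-x)) = T (E (prj x)) := by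
    intro x hx
    rw [prj_neg]
    apply hEs
    rw [mem_sphere_zero_iff_norm]
    have := prj_norm x
    rw [hx] at this
    nlinarith [norm_nonneg (prj x)]
  have hΦc : Continuous Φ := by
    apply Continuous.if_le hEp (hT.comp (hEp.comp continuous_neg)) continuous_const (by fun_prop)
    intro x hx
    simp only [Function.comp]
    rw [hbd x hx.symm, hTT]
  have hΦn : ∀ x, Φ (-x) = T (Φ x) := by
    intro x
    rcases lt_trichotomy (x.1 2) 0 with h | h | h
    · rw [hneg x h, hTT, hpos (-x) (by rw [hn2]; linarith)]
    · rw [hpos x h.ge, hpos (-x) (by rw [hn2]; linarith), hbd x h]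
    · rw [hpos x h.le, hneg (-x) (by rw [hn2]; linarith), neg_neg]
  have hball : ∀ x : S2, x.1 2 < 0 → prj (-x) ∈ ball (0:ℂ) 1 := by
    intro x hx
    rw [mem_ball_zero_iff]
    have := prj_norm (-x)
    rw [hn2] at this
    nlinarith [norm_nonneg (prj (-x))]
  have hΦi : Function.Injective Φ := by
    intro x y e
    rcases le_or_gt 0 (x.1 2) with hx | hx <;> rcases le_or_gt 0 (y.1 2) with hy | hy
    · rw [hpos x hx, hpos y hy] at e
      exact prj_inj (hEi (prj_mem x) (prj_mem y) e) (mul_nonneg hx hy)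
    · rw [hpos x hx, hneg y hy] at e
      exact absurd e.symm (hEd _ (hball y hy) _ (prj_mem x))
    · rw [hneg x hx, hpos y hy] at e
      exact absurd e (hEd _ (hball x hx) _ (prj_mem y))
    · rw [hneg x hx, hneg y hy] at e
      have := prj_inj (hEi (prj_mem _) (prj_mem _) (hTi e)) (by rw [hn2, hn2]; nlinarith)
      exact neg_injective this
  have hΦs : Function.Surjective Φ := by
    intro r
    obtain ⟨z, hz, h⟩ := cover hT hTT hfree hEc hEs r
    obtain ⟨x, rfl, hx⟩ := prj_surj hz
    rcases h with h | h
    · exact ⟨x, by rw [hpos x hx, h]⟩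
    · exact ⟨-x, by rw [hΦn, hpos x hx, h]⟩
  have : CompactSpace S2 := isCompact_iff_compactSpace.1 (isCompact_sphere _ _)
  let H : S2 ≃ₜ S2 := Continuous.homeoOfEquivCompactToT2 (f := Equiv.ofBijective Φ ⟨hΦi, hΦs⟩) hΦc
  have hH : ∀ x, H x = Φ x := fun x => rfl
  refine ⟨H.symm, fun x => ?_⟩
  rw [H.symm_apply_eq, hH, hΦn, ← hH, H.apply_symm_apply]
end FI

/-- A free action of a group of order exactly 2 on the 2-sphere by
homeomorphisms is topologically equivalent to the antipodal action: there is a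
homeomorphism `h` of `S²` with `h (g • x) = - h x` for the nontrivial `g`. -/
theorem stmt_4 {G : Type*} [Group G] [Fintype G] [MulAction G ↥TwoSphere]
    (hcard : Fintype.card G = 2)
    (hcont : ∀ g : G, Continuous fun x : ↥TwoSphere => g • x)
    (hfree : ∀ g : G, g ≠ 1 → ∀ x : ↥TwoSphere, g • x ≠ x) :
    ∃ h : ↥TwoSphere ≃ₜ ↥TwoSphere,
      ∀ g : G, g ≠ 1 → ∀ x : ↥TwoSphere, h (g • x) = -(h x) := by
  classical
  have h1 : 1 < Fintype.card G := by omega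
  obtain ⟨g, hg⟩ := Fintype.exists_ne_of_one_lt_card h1 (1 : G)
  have hgg : g * g = 1 := by
    have := pow_card_eq_one (x := g)
    rw [hcard, pow_two] at this
    exact this
  have huniq : ∀ g' : G, g' ≠ 1 → g' = g := by
    intro g' hg'
    by_contra hne
    have h3 : ({1, g, g'} : Finset G).card = 3 :=
      Finset.card_eq_three.2 ⟨1, g, g', hg.symm, hg'.symm, fun e => hne e.symm, rfl⟩
    have := Finset.card_le_univ ({1, g, g'} : Finset G)
    omega
  obtain ⟨h, hh⟩ := FI.main (T := fun x => g • x) (hcont g)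
    (fun x => by beta_reduce; rw [← mul_smul, hgg, one_smul]) (hfree g hg)
  refine ⟨h, fun g' hg' x => ?_⟩
  rw [huniq g' hg']
  exact hh x
end
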